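/- Let a ∈ ℝ with |a| ≤ 1/2 and let b > 2π. Let Γ = ℤ(1,0) + ℤ(a,b) ⊂ ℝ², let ω : ℝ² → ℝ be a smooth function with ω(p + γ) = ω(p) for all p ∈ ℝ², γ ∈ Γ, let λ > 0, and let φ = (φ₁, φ₂) : ℝ² → ℂ² be a smooth function, not identically zero, with φ(p + γ) = φ(p) for all p ∈ ℝ², γ ∈ Γ, satisfying (∂ₓ − i∂_y)φ₂ = λ e^{ω} φ₁ and −(∂ₓ + i∂_y)φ₁ = λ e^{ω} φ₂ on ℝ². Then λ² · b · ∫₀¹∫₀¹ e^{2ω(s + ta, tb)} ds dt ≥ 4π²/b. (This is the inequality Λ₁(𝕋², [g_{a,b}], S₀) = 2π/√b of Theorem 1.4: every positive Dirac eigenvalue of a metric conformal to the flat metric g_{a,b} on the torus with the trivial spin structure, normalized by the square root of the area, is at least 2π/√b.) -/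

import Mathlib

/-- Partial derivative in the first coordinate direction of a map on `ℝ × ℝ`. -/
noncomputable def dX (f : ℝ × ℝ → ℂ) (p : ℝ × ℝ) : ℂ := fderiv ℝ f p (1, 0)

/-- Partial derivative in the second coordinate direction of a map on `ℝ × ℝ`. -/
noncomputable def dY (f : ℝ × ℝ → ℂ) (p : ℝ × ℝ) : ℂ := fderiv ℝ f p (0, 1)

namespace DiracT
open Complex MeasureTheory

/-- weight -/
noncomputable def wt (k : ℤ × ℤ) : ℝ := 1 + |(k.1 : ℝ)| + |(k.2 : ℝ)|

lemma wt_one_le (k : ℤ × ℤ) : 1 ≤ wt k := by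
  unfold wt; have := abs_nonneg (k.1 : ℝ); have := abs_nonneg (k.2 : ℝ); linarith

lemma wt_pos (k : ℤ × ℤ) : 0 < wt k := lt_of_lt_of_le one_pos (wt_one_le k)

lemma wt_add_le (k l : ℤ × ℤ) : wt (k + l) ≤ wt k * wt l := by
  unfold wt
  have h1 := abs_add_le (k.1 : ℝ) (l.1 : ℝ)
  have h2 := abs_add_le (k.2 : ℝ) (l.2 : ℝ)
  have a1 := abs_nonneg (k.1 : ℝ)
  have a2 := abs_nonneg (k.2 : ℝ)
  have a3 := abs_nonneg (l.1 : ℝ)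
  have a4 := abs_nonneg (l.2 : ℝ)
  simp only [Prod.fst_add, Prod.snd_add, Int.cast_add]
  nlinarith [mul_nonneg a1 a3, mul_nonneg a1 a4, mul_nonneg a2 a3, mul_nonneg a2 a4]

lemma wt_neg (k : ℤ × ℤ) : wt (-k) = wt k := by simp [wt]

lemma summable_int_aux : Summable (fun n : ℤ => ((1 + |(n : ℝ)|) ^ 2)⁻¹) := by
  have h : Summable (fun n : ℕ => ((1 + (n : ℝ)) ^ 2)⁻¹) := by
    have h0 := (summable_nat_add_iff 1).2 (Real.summable_nat_pow_inv.2 (one_lt_two))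
    refine h0.congr fun n => ?_
    push_cast; rw [add_comm]
  refine Summable.of_nat_of_neg ?_ ?_ <;> simpa using h

lemma summable_wt : Summable (fun k : ℤ × ℤ => ((wt k) ^ 4)⁻¹) := by
  have h := Summable.mul_of_nonneg summable_int_aux summable_int_aux
    (fun n => by positivity) (fun n => by positivity)
  refine Summable.of_nonneg_of_le (fun k => by have := wt_pos k; positivity) (fun k => ?_) h
  rw [← mul_inv]
  have h1 := abs_nonneg (k.1 : ℝ)
  have h2 := abs_nonneg (k.2 : ℝ)
  apply inv_anti₀ (by positivity)
  have e : (wt k) ^ 4 = (wt k) ^ 2 * (wt k) ^ 2 := by ring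
  rw [e]
  have k1 : 1 + |(k.1 : ℝ)| ≤ wt k := by unfold wt; linarith
  have k2 : 1 + |(k.2 : ℝ)| ≤ wt k := by unfold wt; linarith
  exact mul_le_mul (pow_le_pow_left₀ (by positivity) k1 2) (pow_le_pow_left₀ (by positivity) k2 2)
    (by positivity) (by positivity)

/-- rapid decay -/
def RD (c : ℤ × ℤ → ℂ) : Prop := ∀ N : ℕ, ∃ C : ℝ, ∀ k, ‖c k‖ * (wt k) ^ N ≤ C

lemma RD.add {c d : ℤ × ℤ → ℂ} (hc : RD c) (hd : RD d) : RD (fun k => c k + d k) := by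
  intro N
  obtain ⟨C, hC⟩ := hc N
  obtain ⟨D, hD⟩ := hd N
  refine ⟨C + D, fun k => ?_⟩
  have := norm_add_le (c k) (d k)
  have hw : 0 < wt k ^ N := pow_pos (wt_pos k) N
  nlinarith [hC k, hD k]

/-- multiplication by symbols of polynomial growth -/
lemma RD.mul_poly {c : ℤ × ℤ → ℂ} (hc : RD c) {m : ℤ × ℤ → ℂ} {A : ℝ} {j : ℕ}
    (hm : ∀ k, ‖m k‖ ≤ A * (wt k) ^ j) : RD (fun k => m k * c k) := by
  intro N
  obtain ⟨C, hC⟩ := hc (N + j)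
  have hA : 0 ≤ A := by
    have := (norm_nonneg _).trans (hm 0)
    exact nonneg_of_mul_nonneg_left this (pow_pos (wt_pos 0) j)
  refine ⟨A * C, fun k => ?_⟩
  rw [norm_mul]
  have hw : 0 < wt k ^ N := pow_pos (wt_pos k) N
  calc ‖m k‖ * ‖c k‖ * wt k ^ N ≤ (A * (wt k) ^ j) * ‖c k‖ * wt k ^ N := by
        gcongr; exact hm k
    _ = A * (‖c k‖ * wt k ^ (N + j)) := by ring
    _ ≤ A * C := by gcongr; exact hC k

lemma RD.of_le {c d : ℤ × ℤ → ℂ} (hc : RD c) (h : ∀ k, ‖d k‖ ≤ ‖c k‖) : RD d := by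
  intro N
  obtain ⟨C, hC⟩ := hc N
  refine ⟨C, fun k => le_trans ?_ (hC k)⟩
  have hw : 0 < wt k ^ N := pow_pos (wt_pos k) N
  gcongr; exact h k

lemma RD.const_mul {c : ℤ × ℤ → ℂ} (hc : RD c) (z : ℂ) : RD (fun k => z * c k) :=
  hc.mul_poly (m := fun _ => z) (A := ‖z‖) (j := 0) (by simp)

lemma RD.summable_mul_pow {c : ℤ × ℤ → ℂ} (hc : RD c) (N : ℕ) :
    Summable (fun k => ‖c k‖ * (wt k) ^ N) := by
  obtain ⟨C, hC⟩ := hc (N + 4)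
  refine Summable.of_nonneg_of_le (fun k => ?_) (fun k => ?_) (summable_wt.mul_left C)
  · have hw : 0 < wt k ^ N := pow_pos (wt_pos k) N
    positivity
  · have hw : 0 < wt k ^ 4 := pow_pos (wt_pos k) 4
    rw [← div_eq_mul_inv, le_div_iff₀ hw]
    calc _ = ‖c k‖ * wt k ^ (N + 4) := by ring
      _ ≤ C := hC k

lemma RD.summable_norm {c : ℤ × ℤ → ℂ} (hc : RD c) : Summable (fun k => ‖c k‖) := by
  simpa using hc.summable_mul_pow 0

/-- characters -/
noncomputable def ee (a b : ℝ) (k : ℤ × ℤ) (p : ℝ × ℝ) : ℂ :=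
  cexp (((2 * Real.pi * (k.1 * p.1 + (k.2 - a * k.1) / b * p.2) : ℝ) : ℂ) * I)

lemma norm_ee (a b : ℝ) (k : ℤ × ℤ) (p : ℝ × ℝ) : ‖ee a b k p‖ = 1 := by
  unfold ee; exact Complex.norm_exp_ofReal_mul_I _

lemma ee_add (a b : ℝ) (k l : ℤ × ℤ) (p : ℝ × ℝ) :
    ee a b (k + l) p = ee a b k p * ee a b l p := by
  unfold ee
  rw [← Complex.exp_add]; congr 1; push_cast [Prod.fst_add, Prod.snd_add]; ring

lemma ee_zero (a b : ℝ) (p : ℝ × ℝ) : ee a b 0 p = 1 := by simp [ee]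

lemma ee_neg (a b : ℝ) (k : ℤ × ℤ) (p : ℝ × ℝ) :
    ee a b (-k) p = (starRingEnd ℂ) (ee a b k p) := by
  unfold ee
  rw [← Complex.exp_conj]; congr 1
  simp only [map_mul, conj_I, conj_ofReal, Prod.fst_neg, Prod.snd_neg]; push_cast; ring

lemma ee_per1 (a b : ℝ) (k : ℤ × ℤ) (p : ℝ × ℝ) : ee a b k (p.1 + 1, p.2) = ee a b k p := by
  unfold ee
  have : (((2 * Real.pi * (k.1 * (p.1 + 1) + (k.2 - a * k.1) / b * p.2) : ℝ) : ℂ) * I)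
    = (((2 * Real.pi * (k.1 * p.1 + (k.2 - a * k.1) / b * p.2) : ℝ) : ℂ) * I)
      + (k.1 : ℤ) * (2 * Real.pi * I) := by push_cast; ring
  simp only [this]
  rw [Complex.exp_add, Complex.exp_int_mul_two_pi_mul_I, mul_one]

lemma ee_per2 (a b : ℝ) (hb : b ≠ 0) (k : ℤ × ℤ) (p : ℝ × ℝ) :
    ee a b k (p.1 + a, p.2 + b) = ee a b k p := by
  unfold ee
  have : (((2 * Real.pi * (k.1 * (p.1 + a) + (k.2 - a * k.1) / b * (p.2 + b)) : ℝ) : ℂ) * I)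
    = (((2 * Real.pi * (k.1 * p.1 + (k.2 - a * k.1) / b * p.2) : ℝ) : ℂ) * I)
      + (k.2 : ℤ) * (2 * Real.pi * I) := by
    have hb' : (b : ℂ) ≠ 0 := by exact_mod_cast hb
    push_cast; field_simp; ring
  simp only [this]
  rw [Complex.exp_add, Complex.exp_int_mul_two_pi_mul_I, mul_one]

/-- the series -/
noncomputable def ev (a b : ℝ) (c : ℤ × ℤ → ℂ) (p : ℝ × ℝ) : ℂ := ∑' k, c k * ee a b k p

lemma RD.summable_ee {c : ℤ × ℤ → ℂ} (hc : RD c) (a b : ℝ) (p : ℝ × ℝ) :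
    Summable (fun k => c k * ee a b k p) := by
  apply Summable.of_norm
  simpa [norm_ee] using hc.summable_norm

lemma ev_per1 (a b : ℝ) (c : ℤ × ℤ → ℂ) (p : ℝ × ℝ) : ev a b c (p.1 + 1, p.2) = ev a b c p := by
  simp only [ev, ee_per1]

lemma ev_per2 (a b : ℝ) (hb : b ≠ 0) (c : ℤ × ℤ → ℂ) (p : ℝ × ℝ) :
    ev a b c (p.1 + a, p.2 + b) = ev a b c p := by
  simp only [ev, ee_per2 a b hb]

lemma ev_add {c d : ℤ × ℤ → ℂ} (hc : RD c) (hd : RD d) (a b : ℝ) (p : ℝ × ℝ) :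
    ev a b (fun k => c k + d k) p = ev a b c p + ev a b d p := by
  unfold ev
  rw [← (hc.summable_ee a b p).tsum_add (hd.summable_ee a b p)]
  simp only [add_mul]

lemma ev_const_mul (c : ℤ × ℤ → ℂ) (z : ℂ) (a b : ℝ) (p : ℝ × ℝ) :
    ev a b (fun k => z * c k) p = z * ev a b c p := by
  unfold ev
  rw [← tsum_mul_left]
  simp only [mul_assoc]

/-- symbols -/
noncomputable def sx (k : ℤ × ℤ) : ℂ := 2 * Real.pi * k.1 * I
noncomputable def sy (a b : ℝ) (k : ℤ × ℤ) : ℂ := 2 * Real.pi * ((k.2 - a * k.1) / b) * I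

lemma norm_sx_le (k : ℤ × ℤ) : ‖sx k‖ ≤ (2 * Real.pi) * (wt k) ^ 1 := by
  have h2 := abs_nonneg (k.2 : ℝ)
  have : ‖sx k‖ = 2 * Real.pi * |(k.1 : ℝ)| := by
    simp [sx, abs_of_pos Real.pi_pos]
  rw [this, pow_one]; unfold wt
  have := Real.pi_pos
  gcongr; linarith

lemma norm_sy_le (a b : ℝ) (k : ℤ × ℤ) :
    ‖sy a b k‖ ≤ (2 * Real.pi * ((1 + |a|) / |b|)) * (wt k) ^ 1 := by
  have h2 := abs_nonneg (k.2 : ℝ)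
  have h1 := abs_nonneg (k.1 : ℝ)
  have h3 := abs_nonneg a
  have e : sy a b k = ((2 * Real.pi * ((k.2 - a * k.1) / b) : ℝ) : ℂ) * I := by
    simp [sy]
  have : ‖sy a b k‖ = 2 * Real.pi * (|(k.2 - a * k.1 : ℝ)| / |b|) := by
    rw [e, norm_mul, norm_I, mul_one, Complex.norm_real, Real.norm_eq_abs, abs_mul, abs_div,
      abs_of_pos (by have := Real.pi_pos; positivity : (0:ℝ) < 2 * Real.pi)]
  rw [this, pow_one, mul_assoc (2 * Real.pi) _ (wt k), div_mul_eq_mul_div]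
  have := Real.pi_pos
  gcongr
  calc |(k.2 - a * k.1 : ℝ)| ≤ |(k.2 : ℝ)| + |a * k.1| := abs_sub _ _
    _ ≤ (1 + |a|) * wt k := by
      rw [abs_mul]; unfold wt
      nlinarith [mul_nonneg h3 h1, mul_nonneg h3 h2]

lemma RD.sx {c : ℤ × ℤ → ℂ} (hc : RD c) : RD (fun k => sx k * c k) := hc.mul_poly norm_sx_le
lemma RD.sy {c : ℤ × ℤ → ℂ} (hc : RD c) (a b : ℝ) : RD (fun k => sy a b k * c k) :=
  hc.mul_poly (norm_sy_le a b)

lemma hasFDerivAt_ee (a b : ℝ) (k : ℤ × ℤ) (p : ℝ × ℝ) :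
    HasFDerivAt (ee a b k)
      ((ContinuousLinearMap.fst ℝ ℝ ℝ).smulRight (sx k * ee a b k p) +
        (ContinuousLinearMap.snd ℝ ℝ ℝ).smulRight (sy a b k * ee a b k p)) p := by
  have h0 : HasFDerivAt (fun p : ℝ × ℝ => 2 * Real.pi * (k.1 * p.1 + (k.2 - a * k.1) / b * p.2))
      ((2 * Real.pi) • ((k.1 : ℝ) • (ContinuousLinearMap.fst ℝ ℝ ℝ) +
        ((k.2 - a * k.1) / b : ℝ) • (ContinuousLinearMap.snd ℝ ℝ ℝ))) p :=
    ((hasFDerivAt_fst.const_mul _).add (hasFDerivAt_snd.const_mul _)).const_mul _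
  have h1 := ((Complex.ofRealCLM.hasFDerivAt.comp p h0).mul_const I).cexp
  refine h1.congr_fderiv ?_
  ext <;> simp [sx, sy, ee] <;> ring

lemma hasFDerivAt_ev {c : ℤ × ℤ → ℂ} (hc : RD c) (a b : ℝ) (p : ℝ × ℝ) :
    HasFDerivAt (ev a b c)
      ((ContinuousLinearMap.fst ℝ ℝ ℝ).smulRight (ev a b (fun k => sx k * c k) p) +
        (ContinuousLinearMap.snd ℝ ℝ ℝ).smulRight (ev a b (fun k => sy a b k * c k) p)) p := by
  have hs := hc.sx.summable_norm.add (hc.sy a b).summable_norm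
  have key := hasFDerivAt_tsum (𝕜 := ℝ) (f := fun k p => c k * ee a b k p)
    (f' := fun k p => (ContinuousLinearMap.fst ℝ ℝ ℝ).smulRight (sx k * c k * ee a b k p) +
        (ContinuousLinearMap.snd ℝ ℝ ℝ).smulRight (sy a b k * c k * ee a b k p))
    (x₀ := p) hs ?_ ?_ (hc.summable_ee a b p) p
  · refine key.congr_fderiv ?_
    have h1 := (hc.sx.summable_ee a b p)
    have h2 := ((hc.sy a b).summable_ee a b p)
    have H1 := ((ContinuousLinearMap.smulRightL ℝ (ℝ × ℝ) ℂ (ContinuousLinearMap.fst ℝ ℝ ℝ)).hasSum h1.hasSum)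
    have H2 := ((ContinuousLinearMap.smulRightL ℝ (ℝ × ℝ) ℂ (ContinuousLinearMap.snd ℝ ℝ ℝ)).hasSum h2.hasSum)
    exact (H1.add H2).tsum_eq
  · intro k q
    refine ((hasFDerivAt_ee a b k q).const_mul (c k)).congr_fderiv ?_
    ext <;> simp <;> ring
  · intro k q
    refine (norm_add_le _ _).trans (add_le_add ?_ ?_)
    · rw [ContinuousLinearMap.norm_smulRight_apply, norm_mul _ (ee a b k q), norm_ee, mul_one]
      exact mul_le_of_le_one_left (norm_nonneg _) (ContinuousLinearMap.norm_fst_le ℝ ℝ ℝ)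
    · rw [ContinuousLinearMap.norm_smulRight_apply, norm_mul _ (ee a b k q), norm_ee, mul_one]
      exact mul_le_of_le_one_left (norm_nonneg _) (ContinuousLinearMap.norm_snd_le ℝ ℝ ℝ)

lemma dX_ev {c : ℤ × ℤ → ℂ} (hc : RD c) (a b : ℝ) (p : ℝ × ℝ) :
    dX (ev a b c) p = ev a b (fun k => sx k * c k) p := by
  unfold dX; rw [(hasFDerivAt_ev hc a b p).fderiv]; simp

lemma dY_ev {c : ℤ × ℤ → ℂ} (hc : RD c) (a b : ℝ) (p : ℝ × ℝ) :
    dY (ev a b c) p = ev a b (fun k => sy a b k * c k) p := by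
  unfold dY; rw [(hasFDerivAt_ev hc a b p).fderiv]; simp

lemma contDiff_ev (a b : ℝ) {c : ℤ × ℤ → ℂ} (hc : RD c) : ContDiff ℝ (⊤ : ℕ∞) (ev a b c) := by
  rw [contDiff_infty]
  intro n
  induction n generalizing c with
  | zero =>
    rw [Nat.cast_zero, contDiff_zero]
    exact continuous_iff_continuousAt.2 fun p => (hasFDerivAt_ev hc a b p).continuousAt
  | succ n ih =>
    push_cast
    rw [contDiff_succ_iff_hasFDerivAt]
    refine ⟨_, ?_, fun p => hasFDerivAt_ev hc a b p⟩
    have h1 := ih hc.sx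
    have h2 := ih (hc.sy a b)
    exact ((ContinuousLinearMap.smulRightL ℝ (ℝ × ℝ) ℂ (ContinuousLinearMap.fst ℝ ℝ ℝ)).contDiff.comp h1).add
      ((ContinuousLinearMap.smulRightL ℝ (ℝ × ℝ) ℂ (ContinuousLinearMap.snd ℝ ℝ ℝ)).contDiff.comp h2)

end DiracT

namespace DiracT
open Complex MeasureTheory

/-- Lebesgue measure on the rectangle `(0,1] × (0,b]`. -/
noncomputable def muT (b : ℝ) : Measure (ℝ × ℝ) :=
  ((volume : Measure ℝ).restrict (Set.Ioc 0 1)).prod ((volume : Measure ℝ).restrict (Set.Ioc 0 b))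

instance (b : ℝ) : IsFiniteMeasure (muT b) := by unfold muT; infer_instance

lemma muT_eq (b : ℝ) : muT b =
    (volume : Measure (ℝ × ℝ)).restrict (Set.Ioc (0:ℝ) 1 ×ˢ Set.Ioc (0:ℝ) b) := by
  unfold muT; rw [Measure.prod_restrict]; rfl

lemma integrable_muT {E : Type*} [NormedAddCommGroup E] {g : ℝ × ℝ → E} (hg : Continuous g)
    (b : ℝ) : Integrable g (muT b) := by
  rw [muT_eq]
  have : IntegrableOn g (Set.Icc (0:ℝ) 1 ×ˢ Set.Icc (0:ℝ) b) volume :=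
    hg.continuousOn.integrableOn_compact (isCompact_Icc.prod isCompact_Icc)
  exact this.mono_set (Set.prod_mono Set.Ioc_subset_Icc_self Set.Ioc_subset_Icc_self)

lemma integral_muT_yx {E : Type*} [NormedAddCommGroup E] [NormedSpace ℝ E] {g : ℝ × ℝ → E}
    (hg : Continuous g) {b : ℝ} (hb : 0 ≤ b) :
    ∫ p, g p ∂(muT b) = ∫ y in (0:ℝ)..b, ∫ x in (0:ℝ)..1, g (x, y) := by
  have h := integrable_muT hg b
  unfold muT at *
  rw [integral_prod_symm _ h, intervalIntegral.integral_of_le hb]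
  simp only [intervalIntegral.integral_of_le (zero_le_one' ℝ)]

lemma integral_muT_xy {E : Type*} [NormedAddCommGroup E] [NormedSpace ℝ E] {g : ℝ × ℝ → E}
    (hg : Continuous g) {b : ℝ} (hb : 0 ≤ b) :
    ∫ p, g p ∂(muT b) = ∫ x in (0:ℝ)..1, ∫ y in (0:ℝ)..b, g (x, y) := by
  have h := integrable_muT hg b
  unfold muT at *
  rw [integral_prod _ h, intervalIntegral.integral_of_le (zero_le_one' ℝ)]
  simp only [intervalIntegral.integral_of_le hb]

lemma continuous_ee (a b : ℝ) (k : ℤ × ℤ) : Continuous (ee a b k) :=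
  continuous_iff_continuousAt.2 fun p => (hasFDerivAt_ee a b k p).continuousAt

lemma integral_exp_int (T : ℝ) (hT : 0 < T) (n : ℤ) (hn : n ≠ 0) :
    ∫ x in (0:ℝ)..T, cexp (((2 * Real.pi * (n / T * x) : ℝ) : ℂ) * I) = 0 := by
  have hc : (2 * Real.pi * n / T * I : ℂ) ≠ 0 := by
    have h1 : (T : ℂ) ≠ 0 := by exact_mod_cast hT.ne'
    have h2 : (Real.pi : ℂ) ≠ 0 := by exact_mod_cast Real.pi_ne_zero
    have h3 : (n : ℂ) ≠ 0 := by exact_mod_cast hn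
    exact mul_ne_zero (div_ne_zero (mul_ne_zero (mul_ne_zero two_ne_zero h2) h3) h1) I_ne_zero
  have e : ∀ x : ℝ, cexp (((2 * Real.pi * (n / T * x) : ℝ) : ℂ) * I)
      = cexp ((2 * Real.pi * n / T * I : ℂ) * x) := by
    intro x; congr 1; push_cast; ring
  simp only [e]
  rw [integral_exp_mul_complex hc]
  have h1 : (T : ℂ) ≠ 0 := by exact_mod_cast hT.ne'
  have : (2 * Real.pi * n / T * I : ℂ) * T = n * (2 * Real.pi * I) := by field_simp
  rw [this, Complex.exp_int_mul_two_pi_mul_I]; simp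

lemma integral_ee_x (a b y : ℝ) (k : ℤ × ℤ) :
    ∫ x in (0:ℝ)..1, ee a b k (x, y) = if k.1 = 0 then ee a b k (0, y) else 0 := by
  have e : ∀ x : ℝ, ee a b k (x, y) = cexp (((2 * Real.pi * (k.1 / (1:ℝ) * x) : ℝ) : ℂ) * I) *
      ee a b k (0, y) := by
    intro x; unfold ee; rw [← Complex.exp_add]; congr 1; push_cast; ring
  split_ifs with h
  · have e1 : ∀ x : ℝ, ee a b k (x, y) = ee a b k (0, y) := by
      intro x; unfold ee; rw [h]; simp
    rw [intervalIntegral.integral_congr (fun x _ => e1 x)]; simp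
  · rw [intervalIntegral.integral_congr (fun x _ => e x)]
    rw [intervalIntegral.integral_mul_const, integral_exp_int 1 one_pos k.1 h, zero_mul]

lemma integral_ee {a b : ℝ} (hb : 0 < b) (k : ℤ × ℤ) :
    ∫ p, ee a b k p ∂(muT b) = if k = 0 then (b : ℂ) else 0 := by
  rw [integral_muT_yx (continuous_ee a b k) hb.le]
  simp only [integral_ee_x]
  by_cases h1 : k.1 = 0
  · simp only [h1, if_true]
    by_cases h2 : k.2 = 0
    · have : k = 0 := Prod.ext h1 h2
      subst this
      simp [ee_zero]
    · have : k ≠ 0 := fun h => h2 (by rw [h]; rfl)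
      rw [if_neg this, ← integral_exp_int b hb k.2 h2]
      congr 1; ext y; unfold ee; congr 2; simp [h1]
  · have : k ≠ 0 := fun h => h1 (by rw [h]; rfl)
    simp [h1, this]

lemma integral_ev {a b : ℝ} (hb : 0 < b) {c : ℤ × ℤ → ℂ} (hc : RD c) :
    ∫ p, ev a b c p ∂(muT b) = b * c 0 := by
  unfold ev
  have h := hasSum_integral_of_summable_integral_norm (μ := muT b)
    (F := fun k p => c k * ee a b k p)
    (fun k => integrable_muT (continuous_const.mul (continuous_ee a b k)) b) ?_
  · rw [← h.tsum_eq]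
    simp only [integral_const_mul, integral_ee hb]
    rw [tsum_eq_single 0]
    · simp [mul_comm]
    · intro k hk; simp [hk]
  · simp only [norm_mul, norm_ee, mul_one, integral_const, smul_eq_mul]
    exact hc.summable_norm.mul_left _

lemma integral_ev_x {a b : ℝ} {c : ℤ × ℤ → ℂ} (hc : RD c) (y : ℝ) :
    ∫ x in (0:ℝ)..1, ev a b c (x, y) = ev a b (fun k => if k.1 = 0 then c k else 0) (0, y) := by
  unfold ev
  rw [intervalIntegral.integral_of_le zero_le_one]
  have h := hasSum_integral_of_summable_integral_norm (μ := volume.restrict (Set.Ioc (0:ℝ) 1))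
    (F := fun k x => c k * ee a b k (x, y)) ?_ ?_
  · rw [← h.tsum_eq]
    congr 1; ext k
    rw [integral_const_mul, ← intervalIntegral.integral_of_le zero_le_one, integral_ee_x]
    split_ifs with h0 <;> simp [h0]
  · intro k
    have : Continuous (fun x : ℝ => c k * ee a b k (x, y)) :=
      continuous_const.mul ((continuous_ee a b k).comp (by fun_prop))
    exact (this.integrableOn_Icc).mono_set Set.Ioc_subset_Icc_self
  · simp only [norm_mul, norm_ee, mul_one, integral_const, smul_eq_mul]
    exact hc.summable_norm.mul_left _

/-- convolution -/
noncomputable def conv (c d : ℤ × ℤ → ℂ) (k : ℤ × ℤ) : ℂ := ∑' j, c j * d (k - j)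

lemma conv_bound {c d : ℤ × ℤ → ℂ} (hc : RD c) (N : ℕ) {C : ℝ} (hd : ∀ k, ‖d k‖ * wt k ^ N ≤ C) :
    ∃ D : ℝ, ∀ k, ‖conv c d k‖ * wt k ^ N ≤ D := by
  have hs := hc.summable_mul_pow N
  refine ⟨(∑' j, ‖c j‖ * wt j ^ N) * C, fun k => ?_⟩
  have hle : ∀ j, ‖c j * d (k - j)‖ * wt k ^ N ≤ ‖c j‖ * wt j ^ N * C := by
    intro j
    have h1 : wt k ^ N ≤ wt j ^ N * wt (k - j) ^ N := by
      rw [← mul_pow]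
      have := wt_add_le j (k - j)
      rw [add_sub_cancel] at this
      exact pow_le_pow_left₀ (wt_pos k).le this N
    have hj := pow_pos (wt_pos j) N
    calc ‖c j * d (k - j)‖ * wt k ^ N ≤ ‖c j * d (k - j)‖ * (wt j ^ N * wt (k - j) ^ N) := by gcongr
      _ = ‖c j‖ * wt j ^ N * (‖d (k - j)‖ * wt (k - j) ^ N) := by rw [norm_mul]; ring
      _ ≤ ‖c j‖ * wt j ^ N * C := by gcongr; exact hd _
  have hk := pow_pos (wt_pos k) N
  have hs2 : Summable (fun j => ‖c j * d (k - j)‖) := by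
    have : Summable (fun j => ‖c j * d (k - j)‖ * wt k ^ N) :=
      Summable.of_nonneg_of_le (fun j => by positivity) hle (hs.mul_right C)
    exact (summable_mul_right_iff hk.ne').1 this
  calc ‖conv c d k‖ * wt k ^ N ≤ (∑' j, ‖c j * d (k - j)‖) * wt k ^ N := by
        gcongr; exact norm_tsum_le_tsum_norm hs2
    _ = ∑' j, ‖c j * d (k - j)‖ * wt k ^ N := tsum_mul_right.symm
    _ ≤ ∑' j, ‖c j‖ * wt j ^ N * C := (hs2.mul_right _).tsum_le_tsum hle (hs.mul_right C)
    _ = _ := tsum_mul_right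

lemma RD.conv {c d : ℤ × ℤ → ℂ} (hc : RD c) (hd : RD d) : RD (conv c d) := by
  intro N
  obtain ⟨C, hC⟩ := hd N
  exact conv_bound hc N hC

/-- reindexing equivalence -/
def shEquiv : (ℤ × ℤ) × (ℤ × ℤ) ≃ (ℤ × ℤ) × (ℤ × ℤ) where
  toFun z := (z.2, z.1 - z.2)
  invFun z := (z.1 + z.2, z.1)
  left_inv z := by simp
  right_inv z := by simp

lemma ev_mul {c d : ℤ × ℤ → ℂ} (hc : RD c) (hd : RD d) (a b : ℝ) (p : ℝ × ℝ) :
    ev a b c p * ev a b d p = ev a b (conv c d) p := by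
  unfold ev
  have h1 : Summable (fun k => ‖c k * ee a b k p‖) := by simpa [norm_ee] using hc.summable_norm
  have h2 : Summable (fun k => ‖d k * ee a b k p‖) := by simpa [norm_ee] using hd.summable_norm
  have hs := summable_mul_of_summable_norm h1 h2
  rw [tsum_mul_tsum_of_summable_norm h1 h2, ← shEquiv.tsum_eq]
  have hs' : Summable (fun z : (ℤ × ℤ) × (ℤ × ℤ) => c (shEquiv z).1 * ee a b (shEquiv z).1 p *
      (d (shEquiv z).2 * ee a b (shEquiv z).2 p)) := shEquiv.summable_iff.2 hs
  rw [hs'.tsum_prod]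
  congr 1; ext k
  unfold conv
  rw [← tsum_mul_right]
  congr 1; ext j
  have : ee a b k p = ee a b j p * ee a b (k - j) p := by rw [← ee_add]; congr 1; abel
  simp only [shEquiv, Equiv.coe_fn_mk]
  rw [this]; ring

lemma RD.star {c : ℤ × ℤ → ℂ} (hc : RD c) : RD (fun k => (starRingEnd ℂ) (c (-k))) := by
  intro N
  obtain ⟨C, hC⟩ := hc N
  refine ⟨C, fun k => ?_⟩
  have := hC (-k)
  rw [wt_neg] at this
  simpa using this

lemma conj_ev (c : ℤ × ℤ → ℂ) (a b : ℝ) (p : ℝ × ℝ) :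
    (starRingEnd ℂ) (ev a b c p) = ev a b (fun k => (starRingEnd ℂ) (c (-k))) p := by
  unfold ev
  rw [Complex.conj_tsum, ← (Equiv.neg (ℤ × ℤ)).tsum_eq]
  congr 1; ext k
  simp [ee_neg]

/-- Parseval -/
lemma parseval {a b : ℝ} (hb : 0 < b) {c d : ℤ × ℤ → ℂ} (hc : RD c) (hd : RD d) :
    ∫ p, (starRingEnd ℂ) (ev a b c p) * ev a b d p ∂(muT b)
      = b * ∑' k, (starRingEnd ℂ) (c k) * d k := by
  simp only [conj_ev, ev_mul hc.star hd]
  rw [integral_ev hb (hc.star.conv hd)]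
  congr 1
  unfold conv
  rw [← (Equiv.neg (ℤ × ℤ)).tsum_eq]
  simp

lemma ev_coeff {a b : ℝ} (hb : 0 < b) {c : ℤ × ℤ → ℂ} (hc : RD c) (h : ∀ p, ev a b c p = 0) :
    ∀ k, c k = 0 := by
  have h1 := parseval (a := a) hb hc hc
  simp only [h, mul_zero, integral_zero] at h1
  have hb' : (b : ℂ) ≠ 0 := by exact_mod_cast hb.ne'
  have h2 : ∑' k, (starRingEnd ℂ) (c k) * c k = 0 := by
    rcases mul_eq_zero.1 h1.symm with h | h
    · exact absurd h hb'
    · exact h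
  have h3 : ∀ k, (starRingEnd ℂ) (c k) * c k = ((‖c k‖ ^ 2 : ℝ) : ℂ) := fun k => by
    rw [← Complex.normSq_eq_conj_mul_self, Complex.normSq_eq_norm_sq]
  simp only [h3] at h2
  rw [← Complex.ofReal_tsum] at h2
  have h4 : ∑' k, ‖c k‖ ^ 2 = 0 := by exact_mod_cast h2
  have hs : Summable (fun k => ‖c k‖ ^ 2) := by
    obtain ⟨C, hC⟩ := hc 0
    refine Summable.of_nonneg_of_le (fun k => by positivity) (fun k => ?_)
      (hc.summable_norm.mul_left C)
    have := hC k
    rw [pow_zero, mul_one] at this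
    nlinarith [norm_nonneg (c k)]
  intro k
  have := (hasSum_zero_iff_of_nonneg (fun k => by positivity)).1 (h4 ▸ hs.hasSum)
  have := congrFun this k
  simpa using this

end DiracT

namespace DiracT
open Complex MeasureTheory

/-- smooth periodic functions -/
structure SP {E : Type*} [NormedAddCommGroup E] [NormedSpace ℝ E] (a b : ℝ) (h : ℝ × ℝ → E) :
    Prop where
  smooth : ContDiff ℝ (⊤ : ℕ∞) h
  p1 : ∀ p : ℝ × ℝ, h (p.1 + 1, p.2) = h p
  p2 : ∀ p : ℝ × ℝ, h (p.1 + a, p.2 + b) = h p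

section
variable {E : Type*} [NormedAddCommGroup E] [NormedSpace ℝ E]

lemma fderiv_shift {h : ℝ × ℝ → E} {u v : ℝ} (hp : ∀ p : ℝ × ℝ, h (p.1 + u, p.2 + v) = h p)
    (p : ℝ × ℝ) : fderiv ℝ h (p.1 + u, p.2 + v) = fderiv ℝ h p := by
  have : (fun p : ℝ × ℝ => h (p + (u, v))) = h := by ext p; exact hp p
  calc fderiv ℝ h (p + (u, v)) = fderiv ℝ (fun p : ℝ × ℝ => h (p + (u, v))) p := by
        rw [fderiv_comp_add_right]
    _ = _ := by rw [this]

lemma SP.pd {a b : ℝ} {h : ℝ × ℝ → E} (hh : SP a b h) (v : ℝ × ℝ) :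
    SP a b (fun p => fderiv ℝ h p v) where
  smooth := (hh.smooth.fderiv_right (m := (⊤ : ℕ∞)) (by simp)).clm_apply contDiff_const
  p1 := fun p => by
    have := fderiv_shift (h := h) (u := 1) (v := 0) (by simpa using hh.p1) p
    simp only [add_zero] at this
    simp only [this]
  p2 := fun p => by
    have := fderiv_shift (h := h) (u := a) (v := b) hh.p2 p
    simp only [this]

lemma SP.cont {a b : ℝ} {h : ℝ × ℝ → E} (hh : SP a b h) : Continuous h := hh.smooth.continuous

lemma SP.diff {a b : ℝ} {h : ℝ × ℝ → E} (hh : SP a b h) : Differentiable ℝ h :=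
  hh.smooth.differentiable (by simp)
end

lemma SP.dX {a b : ℝ} {h : ℝ × ℝ → ℂ} (hh : SP a b h) : SP a b (dX h) := hh.pd _
lemma SP.dY {a b : ℝ} {h : ℝ × ℝ → ℂ} (hh : SP a b h) : SP a b (dY h) := hh.pd _

lemma SP.mul {a b : ℝ} {h g : ℝ × ℝ → ℂ} (hh : SP a b h) (hg : SP a b g) :
    SP a b (fun p => h p * g p) where
  smooth := hh.smooth.mul hg.smooth
  p1 := fun p => by simp only [hh.p1, hg.p1]
  p2 := fun p => by simp only [hh.p2, hg.p2]

lemma SP_ee (a : ℝ) {b : ℝ} (hb : b ≠ 0) (k : ℤ × ℤ) : SP a b (ee a b k) where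
  smooth := by
    unfold ee
    apply ContDiff.cexp
    apply ContDiff.mul _ contDiff_const
    have h : ContDiff ℝ (⊤ : ℕ∞) (fun p : ℝ × ℝ =>
        (2 * Real.pi * (k.1 * p.1 + (k.2 - a * k.1) / b * p.2) : ℝ)) := by fun_prop
    exact Complex.ofRealCLM.contDiff.comp h
  p1 := ee_per1 a b k
  p2 := ee_per2 a b hb k

lemma hasDerivAt_x {E : Type*} [NormedAddCommGroup E] [NormedSpace ℝ E] {h : ℝ × ℝ → E}
    (hh : Differentiable ℝ h) (x y : ℝ) :
    HasDerivAt (fun x => h (x, y)) (fderiv ℝ h (x, y) (1, 0)) x := by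
  have := (hh (x, y)).hasFDerivAt.comp_hasDerivAt x
    ((hasDerivAt_id x).prodMk (hasDerivAt_const x y))
  exact this

lemma hasDerivAt_y {E : Type*} [NormedAddCommGroup E] [NormedSpace ℝ E] {h : ℝ × ℝ → E}
    (hh : Differentiable ℝ h) (x y : ℝ) :
    HasDerivAt (fun y => h (x, y)) (fderiv ℝ h (x, y) (0, 1)) y := by
  have := (hh (x, y)).hasFDerivAt.comp_hasDerivAt y
    ((hasDerivAt_const y x).prodMk (hasDerivAt_id y))
  exact this

lemma integral_dX_unit {h : ℝ × ℝ → ℂ} (hh : SP 0 1 h) : ∫ p, dX h p ∂(muT 1) = 0 := by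
  rw [integral_muT_yx hh.dX.cont zero_le_one]
  have : ∀ y : ℝ, ∫ x in (0:ℝ)..1, dX h (x, y) = 0 := by
    intro y
    rw [intervalIntegral.integral_eq_sub_of_hasDerivAt (f' := fun x => _root_.dX h (x, y))
      (fun x _ => hasDerivAt_x hh.diff x y)]
    · have := hh.p1 (0, y); simp at this; rw [this, sub_self]
    · exact (hh.dX.cont.comp (by fun_prop : Continuous fun x : ℝ => (x, y))).intervalIntegrable _ _
  simp [this]

lemma integral_dY_unit {h : ℝ × ℝ → ℂ} (hh : SP 0 1 h) : ∫ p, dY h p ∂(muT 1) = 0 := by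
  rw [integral_muT_xy hh.dY.cont zero_le_one]
  have : ∀ x : ℝ, ∫ y in (0:ℝ)..1, dY h (x, y) = 0 := by
    intro x
    rw [intervalIntegral.integral_eq_sub_of_hasDerivAt (f' := fun y => _root_.dY h (x, y))
      (fun y _ => hasDerivAt_y hh.diff x y)]
    · have := hh.p2 (x, 0); simp at this; rw [this, sub_self]
    · exact (hh.dY.cont.comp (by fun_prop : Continuous fun y : ℝ => (x, y))).intervalIntegrable _ _
  simp [this]

lemma dX_mul {h g : ℝ × ℝ → ℂ} (hh : Differentiable ℝ h) (hg : Differentiable ℝ g) (p : ℝ × ℝ) :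
    dX (fun p => h p * g p) p = h p * dX g p + dX h p * g p := by
  unfold dX
  rw [fderiv_fun_mul (hh p) (hg p)]
  simp; ring

lemma dY_mul {h g : ℝ × ℝ → ℂ} (hh : Differentiable ℝ h) (hg : Differentiable ℝ g) (p : ℝ × ℝ) :
    dY (fun p => h p * g p) p = h p * dY g p + dY h p * g p := by
  unfold dY
  rw [fderiv_fun_mul (hh p) (hg p)]
  simp; ring

lemma dX_ee (a b : ℝ) (k : ℤ × ℤ) (p : ℝ × ℝ) : dX (ee a b k) p = sx k * ee a b k p := by
  unfold dX; rw [(hasFDerivAt_ee a b k p).fderiv]; simp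
lemma dY_ee (a b : ℝ) (k : ℤ × ℤ) (p : ℝ × ℝ) : dY (ee a b k) p = sy a b k * ee a b k p := by
  unfold dY; rw [(hasFDerivAt_ee a b k p).fderiv]; simp

/-- Fourier coefficients on the unit torus -/
noncomputable def cc (h : ℝ × ℝ → ℂ) (k : ℤ × ℤ) : ℂ := ∫ p, h p * ee 0 1 (-k) p ∂(muT 1)

lemma cc_dX {h : ℝ × ℝ → ℂ} (hh : SP 0 1 h) (k : ℤ × ℤ) : cc (dX h) k = sx k * cc h k := by
  have he := SP_ee 0 one_ne_zero (-k)
  have h1 := integral_dX_unit (hh.mul he)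
  simp only [dX_mul hh.diff he.diff, dX_ee] at h1
  rw [integral_add] at h1
  · unfold cc
    rw [← integral_const_mul]
    have : ∀ p, sx k * (h p * ee 0 1 (-k) p) = - (h p * (sx (-k) * ee 0 1 (-k) p)) := by
      intro p; simp [sx]; ring
    simp only [this]
    rw [integral_neg]
    linear_combination h1
  · exact integrable_muT (hh.cont.mul (continuous_const.mul he.cont)) 1
  · exact integrable_muT (hh.dX.cont.mul he.cont) 1

lemma cc_dY {h : ℝ × ℝ → ℂ} (hh : SP 0 1 h) (k : ℤ × ℤ) : cc (dY h) k = sy 0 1 k * cc h k := by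
  have he := SP_ee 0 one_ne_zero (-k)
  have h1 := integral_dY_unit (hh.mul he)
  simp only [dY_mul hh.diff he.diff, dY_ee] at h1
  rw [integral_add] at h1
  · unfold cc
    rw [← integral_const_mul]
    have : ∀ p, sy 0 1 k * (h p * ee 0 1 (-k) p) = - (h p * (sy 0 1 (-k) * ee 0 1 (-k) p)) := by
      intro p; simp [sy]; ring
    simp only [this]
    rw [integral_neg]
    linear_combination h1
  · exact integrable_muT (hh.cont.mul (continuous_const.mul he.cont)) 1
  · exact integrable_muT (hh.dY.cont.mul he.cont) 1

lemma cc_bound0 (h : ℝ × ℝ → ℂ) (k : ℤ × ℤ) : ‖cc h k‖ ≤ ∫ p, ‖h p‖ ∂(muT 1) := by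
  unfold cc
  refine (norm_integral_le_integral_norm _).trans (le_of_eq ?_)
  simp [norm_ee]

lemma cc_RD {h : ℝ × ℝ → ℂ} (hh : SP 0 1 h) : RD (cc h) := by
  intro N
  induction N generalizing h with
  | zero => exact ⟨_, fun k => by simpa using cc_bound0 h k⟩
  | succ N ih =>
    obtain ⟨C0, h0⟩ := ih hh
    obtain ⟨C1, h1⟩ := ih hh.dX
    obtain ⟨C2, h2⟩ := ih hh.dY
    refine ⟨C0 + C1 + C2, fun k => ?_⟩
    have e1 : |(k.1 : ℝ)| * ‖cc h k‖ ≤ ‖cc (dX h) k‖ := by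
      rw [cc_dX hh, norm_mul]
      gcongr
      simp [sx, abs_of_pos Real.pi_pos]
      nlinarith [Real.pi_gt_three, abs_nonneg (k.1 : ℝ)]
    have e2 : |(k.2 : ℝ)| * ‖cc h k‖ ≤ ‖cc (dY h) k‖ := by
      rw [cc_dY hh, norm_mul]
      gcongr
      simp [sy, abs_of_pos Real.pi_pos]
      nlinarith [Real.pi_gt_three, abs_nonneg (k.2 : ℝ)]
    have hw : 0 < wt k ^ N := pow_pos (wt_pos k) N
    calc ‖cc h k‖ * wt k ^ (N + 1) = (‖cc h k‖ + |(k.1 : ℝ)| * ‖cc h k‖ + |(k.2 : ℝ)| * ‖cc h k‖)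
          * wt k ^ N := by rw [pow_succ]; unfold wt; ring
      _ ≤ (‖cc h k‖ + ‖cc (dX h) k‖ + ‖cc (dY h) k‖) * wt k ^ N := by gcongr
      _ = ‖cc h k‖ * wt k ^ N + ‖cc (dX h) k‖ * wt k ^ N + ‖cc (dY h) k‖ * wt k ^ N := by ring
      _ ≤ _ := add_le_add (add_le_add (h0 k) (h1 k)) (h2 k)

/-- one-dimensional Fourier inversion -/
lemma fourier1 {g : ℝ → ℂ} (hg : Continuous g) (hp : ∀ x, g (x + 1) = g x)
    (hs : Summable (fun n : ℤ => ∫ x in (0:ℝ)..1, g x * cexp (-(2 * Real.pi * n * x * I)))) (x : ℝ) :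
    HasSum (fun n : ℤ => (∫ x in (0:ℝ)..1, g x * cexp (-(2 * Real.pi * n * x * I))) *
      cexp (2 * Real.pi * n * x * I)) (g x) := by
  have : Fact ((0:ℝ) < 1) := ⟨one_pos⟩
  have hper : Function.Periodic g 1 := hp
  let G : C(AddCircle (1:ℝ), ℂ) := ⟨hper.lift, continuous_coinduced_dom.2 hg⟩
  have hG : ∀ x : ℝ, G x = g x := fun x => hper.lift_coe x
  have hc : ∀ n : ℤ, fourierCoeff G n = ∫ x in (0:ℝ)..1, g x * cexp (-(2 * Real.pi * n * x * I)) := by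
    intro n
    rw [fourierCoeff_eq_intervalIntegral G n 0]
    simp only [hG, fourier_coe_apply, zero_add, div_one, one_smul, smul_eq_mul]
    congr 1; ext x
    rw [mul_comm]; congr 2; push_cast; ring
  have hs' : Summable (fourierCoeff G) := by
    refine hs.congr fun n => (hc n).symm
  have := has_pointwise_sum_fourier_series_of_summable hs' (x : AddCircle (1:ℝ))
  rw [hG] at this
  convert this using 2 with n
  rw [hc, fourier_coe_apply, smul_eq_mul]
  congr 2; push_cast; ring

lemma ev_cc {h : ℝ × ℝ → ℂ} (hh : SP 0 1 h) (p : ℝ × ℝ) : ev 0 1 (cc h) p = h p := by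
  obtain ⟨s, t⟩ := p
  set C : ℤ → ℝ → ℂ := fun n t => ∫ s in (0:ℝ)..1, h (s, t) * cexp (-(2 * Real.pi * n * s * I)) with hC
  have hRD := cc_RD hh
  have hCc : ∀ n, Continuous (C n) := by
    intro n
    apply intervalIntegral.continuous_parametric_intervalIntegral_of_continuous'
    have := hh.cont
    simp only [Function.uncurry_def]
    apply Continuous.mul
    · exact this.comp (by fun_prop)
    · fun_prop
  have hCp : ∀ n t, C n (t + 1) = C n t := by
    intro n t
    simp only [hC]
    congr 1; ext s
    have := hh.p2 (s, t)
    simp at this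
    rw [this]
  have hcc : ∀ n m : ℤ, ∫ t in (0:ℝ)..1, C n t * cexp (-(2 * Real.pi * m * t * I)) = cc h (n, m) := by
    intro n m
    unfold cc
    rw [integral_muT_yx (g := fun p => h p * ee 0 1 (-(n, m)) p)
      (hh.cont.mul (continuous_ee 0 1 _)) zero_le_one]
    congr 1; ext t
    rw [← intervalIntegral.integral_mul_const]
    congr 1; ext s
    rw [mul_assoc, ← Complex.exp_add]
    unfold ee
    congr 2
    simp; ring
  have hsn : Summable (fun z : ℤ × ℤ => ‖cc h z‖) := hRD.summable_norm
  have hCsum : ∀ (n : ℤ) (t : ℝ), HasSum (fun m : ℤ => cc h (n, m) * cexp (2 * Real.pi * m * t * I)) (C n t) := by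
    intro n t
    have := fourier1 (hCc n) (hCp n) (by
      simp only [hcc]
      exact Summable.of_norm (hsn.prod_factor n)) t
    simpa only [hcc] using this
  have hCle : ∀ n t, ‖C n t‖ ≤ ∑' m, ‖cc h (n, m)‖ := by
    intro n t
    rw [← (hCsum n t).tsum_eq]
    have e : ∀ m : ℤ, ‖cc h (n, m) * cexp (2 * Real.pi * m * t * I)‖ = ‖cc h (n, m)‖ := by
      intro m
      rw [norm_mul]
      have : (2 * Real.pi * m * t * I : ℂ) = ((2 * Real.pi * m * t : ℝ) : ℂ) * I := by push_cast; ring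
      rw [this, Complex.norm_exp_ofReal_mul_I, mul_one]
    refine (norm_tsum_le_tsum_norm ?_).trans (le_of_eq ?_)
    · simp only [e]; exact hsn.prod_factor n
    · simp only [e]
  have hs1 : Summable (fun n => C n t) :=
    Summable.of_norm_bounded hsn.prod (fun n => hCle n t)
  have hmain := fourier1 (g := fun s => h (s, t)) (hh.cont.comp (by fun_prop))
    (fun s => by have := hh.p1 (s, t); simpa using this) hs1 s
  unfold ev
  have hse := hRD.summable_ee 0 1 (s, t)
  rw [hse.tsum_prod, ← hmain.tsum_eq]
  congr 1; ext n
  rw [show (∫ x in (0:ℝ)..1, h (x, t) * cexp (-(2 * Real.pi * n * x * I))) = C n t from rfl]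
  rw [← (hCsum n t).tsum_eq, ← tsum_mul_right]
  congr 1; ext m
  rw [mul_assoc, ← Complex.exp_add]
  unfold ee
  congr 2
  simp; ring

/-- Fourier expansion of smooth periodic functions. -/
theorem exists_coeff {a b : ℝ} (hb : b ≠ 0) {h : ℝ × ℝ → ℂ} (hh : SP a b h) :
    ∃ c, RD c ∧ ∀ p, ev a b c p = h p := by
  have hH : SP 0 1 (fun p : ℝ × ℝ => h (p.1 + p.2 * a, p.2 * b)) := by
    refine ⟨hh.smooth.comp (by fun_prop), fun p => ?_, fun p => ?_⟩
    · have := hh.p1 (p.1 + p.2 * a, p.2 * b)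
      rw [← this]; congr 2; simp; ring
    · have := hh.p2 (p.1 + p.2 * a, p.2 * b)
      rw [← this]; congr 2 <;> simp <;> ring
  refine ⟨_, cc_RD hH, fun p => ?_⟩
  have h1 := ev_cc hH (p.1 - a * p.2 / b, p.2 / b)
  have e : (p.1 - a * p.2 / b + p.2 / b * a, p.2 / b * b) = p := by
    ext <;> simp <;> field_simp <;> ring
  simp only [e] at h1
  rw [← h1]
  unfold ev
  congr 1; ext k; congr 1
  unfold ee; congr 3
  field_simp; ring

lemma SP_ev (a : ℝ) {b : ℝ} (hb : b ≠ 0) {c : ℤ × ℤ → ℂ} (hc : RD c) : SP a b (ev a b c) :=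
  ⟨contDiff_ev a b hc, ev_per1 a b c, ev_per2 a b hb c⟩

end DiracT

namespace DiracT
open Complex MeasureTheory Filter Topology

section abstractH
variable {H : Type*} [NormedAddCommGroup H] [InnerProductSpace ℂ H] [CompleteSpace H]

lemma exists_sing (T : H →L[ℂ] H) (hT : IsCompactOperator T) (h0 : T ≠ 0) :
    ∃ x : H, x ≠ 0 ∧ (ContinuousLinearMap.adjoint T) (T x) = ((‖T‖ ^ 2 : ℝ) : ℂ) • x := by
  have hpos : 0 < ‖T‖ := norm_pos_iff.2 h0
  set R := ‖T‖ with hR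
  -- almost maximizers
  have hex : ∀ n : ℕ, ∃ x : H, ‖x‖ = 1 ∧ R - 1 / ((n : ℝ) + 1) ≤ ‖T x‖ := by
    intro n
    by_contra hcon
    push Not at hcon
    have hn : (0:ℝ) < 1 / ((n : ℝ) + 1) := by positivity
    obtain ⟨x1, hx1⟩ : ∃ x : H, x ≠ 0 := by
      by_contra hc; push Not at hc
      exact h0 (by ext x; rw [hc x]; simp)
    have hR' : 0 ≤ R - 1 / ((n : ℝ) + 1) := by
      have := hcon ((‖x1‖⁻¹ : ℂ) • x1) (by
        rw [norm_smul]; simp [norm_ne_zero_iff.2 hx1])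
      exact (norm_nonneg _).trans this.le
    have : ‖T‖ ≤ R - 1 / ((n : ℝ) + 1) := by
      apply T.opNorm_le_bound hR'
      intro x
      by_cases hx : x = 0
      · simp [hx]
      · have hx' := norm_ne_zero_iff.2 hx
        have := (hcon ((‖x‖⁻¹ : ℂ) • x) (by rw [norm_smul]; simp [hx'])).le
        rw [map_smul, norm_smul] at this
        simp only [norm_inv, norm_real, norm_norm] at this
        rwa [inv_mul_le_iff₀ (norm_pos_iff.2 hx), mul_comm] at this
    linarith
  choose x hx1 hx2 using hex
  have hTle : ∀ n, ‖T (x n)‖ ≤ R := fun n => by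
    have := T.le_opNorm (x n); rwa [hx1, mul_one] at this
  have hlim : Tendsto (fun n => ‖T (x n)‖) atTop (𝓝 R) := by
    refine tendsto_of_tendsto_of_tendsto_of_le_of_le ?_ tendsto_const_nhds hx2 hTle
    have := (tendsto_one_div_add_atTop_nhds_zero_nat (𝕜 := ℝ)).const_sub R
    simpa using this
  set S := ContinuousLinearMap.adjoint T
  have hdiff : ∀ n, ‖S (T (x n)) - ((R ^ 2 : ℝ) : ℂ) • x n‖ ^ 2 ≤ R ^ 4 - R ^ 2 * ‖T (x n)‖ ^ 2 := by
    intro n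
    rw [@norm_sub_sq ℂ, norm_smul, hx1]
    have h1 : ‖S (T (x n))‖ ≤ R * ‖T (x n)‖ := by
      have := S.le_opNorm (T (x n))
      rwa [show ‖S‖ = R from LinearIsometryEquiv.norm_map _ _] at this
    have h2 : RCLike.re (inner ℂ (S (T (x n))) (((R ^ 2 : ℝ) : ℂ) • x n)) = R ^ 2 * ‖T (x n)‖ ^ 2 := by
      rw [inner_smul_right, ContinuousLinearMap.adjoint_inner_left, inner_self_eq_norm_sq_to_K]
      simp [← ofReal_pow, ← ofReal_mul]
    rw [h2]
    have h3 : ‖((R ^ 2 : ℝ) : ℂ)‖ = R ^ 2 := by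
      rw [norm_real, Real.norm_eq_abs, abs_of_nonneg (by positivity)]
    rw [h3]
    have : ‖S (T (x n))‖ ^ 2 ≤ (R * ‖T (x n)‖) ^ 2 := pow_le_pow_left₀ (norm_nonneg _) h1 2
    nlinarith
  have hdl : Tendsto (fun n => S (T (x n)) - ((R ^ 2 : ℝ) : ℂ) • x n) atTop (𝓝 0) := by
    rw [tendsto_zero_iff_norm_tendsto_zero]
    have h1 : Tendsto (fun n => R ^ 4 - R ^ 2 * ‖T (x n)‖ ^ 2) atTop (𝓝 0) := by
      have := ((hlim.pow 2).const_mul (R ^ 2)).const_sub (R ^ 4)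
      convert this using 2; ring
    have h2 : Tendsto (fun n => ‖S (T (x n)) - ((R ^ 2 : ℝ) : ℂ) • x n‖ ^ 2) atTop (𝓝 0) :=
      squeeze_zero (fun n => by positivity) hdiff h1
    have := h2.sqrt
    simpa [Real.sqrt_sq (norm_nonneg _)] using this
  have hcpt := hT.isCompact_closure_image_closedBall 1
  obtain ⟨y, _, φ, hφ, hy⟩ := hcpt.tendsto_subseq (x := fun n => T (x n))
    (fun n => subset_closure ⟨x n, by simp [hx1], rfl⟩)
  have hRc : ((R ^ 2 : ℝ) : ℂ) ≠ 0 := by exact_mod_cast (pow_pos hpos 2).ne'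
  have hxl : Tendsto (fun n => x (φ n)) atTop (𝓝 (((R ^ 2 : ℝ) : ℂ)⁻¹ • (S y))) := by
    have h1 := ((S.continuous.tendsto y).comp hy).sub (hdl.comp hφ.tendsto_atTop)
    have h2 := h1.const_smul ((R ^ 2 : ℝ) : ℂ)⁻¹
    rw [sub_zero] at h2
    refine h2.congr fun n => ?_
    simp only [Function.comp, sub_sub_cancel]
    rw [smul_smul, inv_mul_cancel₀ hRc, one_smul]
  set z := ((R ^ 2 : ℝ) : ℂ)⁻¹ • (S y)
  refine ⟨z, ?_, ?_⟩
  · have : ‖z‖ = 1 := by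
      refine tendsto_nhds_unique hxl.norm ?_
      simp [hx1]
    intro h; rw [h] at this; simp at this
  · have h1 := ((S.comp T).continuous.tendsto z).comp hxl
    have h2 := (hxl.const_smul ((R ^ 2 : ℝ) : ℂ))
    have h3 := h1.sub h2
    have h4 := tendsto_nhds_unique h3 (hdl.comp hφ.tendsto_atTop)
    exact sub_eq_zero.1 h4

lemma abstract_spectral (G A : H →L[ℂ] H) (hG : ∀ x y, (inner ℂ (G x) (y)) = (inner ℂ (x) (G y)))
    (hA : IsCompactOperator A) (e0 : H)
    (hne : ∃ x y : H, (inner ℂ (G e0) (x)) = 0 ∧ (inner ℂ (G e0) (y)) = 0 ∧ (inner ℂ (y) (G (A (G x)))) ≠ 0) :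
    ∃ R : ℝ, 0 < R ∧ (∃ (x y : H) (β γ : ℂ), x ≠ 0 ∧ (inner ℂ (G e0) (x)) = 0 ∧ (inner ℂ (G e0) (y)) = 0 ∧
      G (A (G x) - β • e0) = (R : ℂ) • y ∧
      G ((ContinuousLinearMap.adjoint A) (G y) - γ • e0) = (R : ℂ) • x) ∧
      ∀ x y : H, (inner ℂ (G e0) (x)) = 0 → (inner ℂ (G e0) (y)) = 0 → ‖(inner ℂ (y) (G (A (G x))))‖ ≤ R * ‖x‖ * ‖y‖ := by
  set w := G e0 with hw
  set K : Submodule ℂ H := (Submodule.span ℂ {w})ᗮ with hK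
  set P : H →L[ℂ] H := K.starProjection with hP
  have hPmem : ∀ x, (inner ℂ (w) (P x)) = 0 := fun x => by
    have : P x ∈ K := Submodule.starProjection_apply_mem K x
    exact (Submodule.mem_orthogonal_singleton_iff_inner_right).1 this
  have hPeq : ∀ x, (inner ℂ (w) (x)) = 0 → P x = x := fun x hx =>
    Submodule.starProjection_eq_self_iff.2 ((Submodule.mem_orthogonal_singleton_iff_inner_right).2 hx)
  have hPsa : ∀ x y, (inner ℂ (P x) (y)) = (inner ℂ (x) (P y)) := fun x y => Submodule.inner_starProjection_left_eq_right K x y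
  have hPres : ∀ x, ∃ β : ℂ, x - P x = β • w := fun x => by
    have h1 : x - P x ∈ Kᗮ := Submodule.sub_starProjection_mem_orthogonal x
    rw [hK, Submodule.orthogonal_orthogonal] at h1
    obtain ⟨β, hβ⟩ := Submodule.mem_span_singleton.1 h1
    exact ⟨β, hβ.symm⟩
  set T : H →L[ℂ] H := P ∘L G ∘L A ∘L G ∘L P with hTdef
  have hTapp : ∀ x, T x = P (G (A (G (P x)))) := fun x => rfl
  have hTc : IsCompactOperator T := by
    have h1 : IsCompactOperator (A ∘L (G ∘L P)) := hA.comp_clm (G ∘L P)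
    exact h1.clm_comp (P ∘L G)
  have hTadj : ∀ y, (ContinuousLinearMap.adjoint T) y
      = P (G ((ContinuousLinearMap.adjoint A) (G (P y)))) := by
    intro y
    apply ext_inner_right ℂ
    intro x
    rw [ContinuousLinearMap.adjoint_inner_left, hTapp, ← hPsa, ← hG,
      ← ContinuousLinearMap.adjoint_inner_left, hPsa, hG, ← hG, ← hPsa]
  have hTin : ∀ x y : H, (inner ℂ (w) (x)) = 0 → (inner ℂ (w) (y)) = 0 → (inner ℂ (y) (G (A (G x)))) = (inner ℂ (y) (T x)) := by
    intro x y hx hy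
    rw [hTapp, ← hPsa, hPeq x hx, hPeq y hy]
  have hT0 : T ≠ 0 := by
    obtain ⟨x, y, hx, hy, h⟩ := hne
    rw [hTin x y hx hy] at h
    intro h0; rw [h0] at h; simp at h
  obtain ⟨x, hx0, hxe⟩ := exists_sing T hTc hT0
  have hpos : 0 < ‖T‖ := norm_pos_iff.2 hT0
  have hRc : (‖T‖ : ℂ) ≠ 0 := by exact_mod_cast hpos.ne'
  refine ⟨‖T‖, hpos, ?_, ?_⟩
  · have hwx : (inner ℂ (w) (x)) = 0 := by
      have : x = ((‖T‖ ^ 2 : ℝ) : ℂ)⁻¹ • (ContinuousLinearMap.adjoint T) (T x) := by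
        rw [hxe, smul_smul, inv_mul_cancel₀, one_smul]
        exact_mod_cast (pow_pos hpos 2).ne'
      rw [this, inner_smul_right, hTadj, hPmem, mul_zero]
    set y := (‖T‖ : ℂ)⁻¹ • T x with hy
    have hwy : (inner ℂ (w) (y)) = 0 := by
      rw [hy, inner_smul_right, hTapp, hPmem, mul_zero]
    obtain ⟨β, hβ⟩ := hPres (G (A (G x)))
    obtain ⟨γ, hγ⟩ := hPres (G ((ContinuousLinearMap.adjoint A) (G y)))
    refine ⟨x, y, β, γ, hx0, hwx, hwy, ?_, ?_⟩
    · rw [map_sub, map_smul, ← hw, ← hβ, sub_sub_cancel, hy, smul_smul, mul_inv_cancel₀ hRc, one_smul,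
        hTapp, hPeq x hwx]
    · rw [map_sub G, map_smul G γ e0, ← hw, ← hγ, sub_sub_cancel]
      have : (ContinuousLinearMap.adjoint T) y = (‖T‖ : ℂ) • x := by
        rw [hy, map_smul, hxe, smul_smul]
        congr 1
        push_cast
        field_simp
      rw [← this, hTadj, hPeq y hwy]
  · intro x y hx hy
    rw [hTin x y hx hy]
    calc ‖(inner ℂ (y) (T x))‖ ≤ ‖y‖ * ‖T x‖ := norm_inner_le_norm _ _
      _ ≤ ‖y‖ * (‖T‖ * ‖x‖) := by gcongr; exact T.le_opNorm x
      _ = _ := by ring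

end abstractH

end DiracT

namespace DiracT
open Complex MeasureTheory Filter Topology

/-- the sequence space -/
noncomputable abbrev H2 := lp (fun _ : ℤ × ℤ => ℂ) 2

lemma memH {c : ℤ × ℤ → ℂ} (h : Summable fun k => ‖c k‖ ^ 2) : Memℓp c 2 := by
  apply memℓp_gen
  simpa using h

lemma H2_summable (x : H2) : Summable fun k => ‖x k‖ ^ 2 := by
  have := (lp.memℓp x).summable (by simp)
  simpa using this

lemma H2_norm_sq (x : H2) : ‖x‖ ^ 2 = ∑' k, ‖x k‖ ^ 2 := by
  have := lp.norm_rpow_eq_tsum (p := 2) (by simp) x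
  simpa using this

lemma H2_norm_le {x : H2} {C : ℝ} {y : ℤ × ℤ → ℂ} (hs : Summable fun k => ‖y k‖ ^ 2)
    (h : ∀ k, ‖x k‖ ≤ C * ‖y k‖) : ‖x‖ ^ 2 ≤ C ^ 2 * ∑' k, ‖y k‖ ^ 2 := by
  rw [H2_norm_sq, ← tsum_mul_left]
  refine (H2_summable x).tsum_le_tsum (fun k => ?_) (hs.mul_left _)
  rw [← mul_pow]
  exact pow_le_pow_left₀ (norm_nonneg _) (h k) 2

lemma exists_diag (m : ℤ × ℤ → ℂ) (C : ℝ) (hC : 0 ≤ C) (hm : ∀ k, ‖m k‖ ≤ C) :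
    ∃ T : H2 →L[ℂ] H2, (∀ x k, T x k = m k * x k) ∧ ‖T‖ ≤ C := by
  have hmem : ∀ x : H2, Memℓp (fun k => m k * x k) 2 := fun x => by
    apply memH
    refine Summable.of_nonneg_of_le (fun k => by positivity) (fun k => ?_)
      ((H2_summable x).mul_left (C ^ 2))
    rw [norm_mul, mul_pow]
    gcongr; exact hm k
  let T : H2 →ₗ[ℂ] H2 :=
    { toFun := fun x => ⟨fun k => m k * x k, hmem x⟩
      map_add' := fun x y => by ext k; exact mul_add _ _ _
      map_smul' := fun c x => by ext k; simp; ring }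
  have hT : ∀ x k, T x k = m k * x k := fun x k => rfl
  have hb : ∀ x, ‖T x‖ ≤ C * ‖x‖ := fun x => by
    have h1 := H2_norm_le (x := T x) (H2_summable x) (fun k => by
      rw [hT, norm_mul]; exact mul_le_mul_of_nonneg_right (hm k) (norm_nonneg _))
    rw [← H2_norm_sq, ← mul_pow] at h1
    exact le_of_sq_le_sq h1 (by positivity)
  exact ⟨T.mkContinuous C hb, fun x k => hT x k, T.mkContinuous_norm_le hC hb⟩

lemma exists_diag_compact (m : ℤ × ℤ → ℂ) (hm : Tendsto m cofinite (𝓝 0)) :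
    ∃ T : H2 →L[ℂ] H2, (∀ x k, T x k = m k * x k) ∧ IsCompactOperator T := by
  have hfin : ∀ ε : ℝ, 0 < ε → {k | ε < ‖m k‖}.Finite := fun ε hε => by
    have := hm.norm
    rw [norm_zero] at this
    have h2 := this.eventually (gt_mem_nhds hε)
    refine Set.Finite.subset h2 fun k hk => ?_
    simp only [Set.mem_ofPred_eq] at hk
    simp only [Set.mem_compl_iff, Set.mem_ofPred_eq, not_lt]
    exact hk.le
  obtain ⟨C, hC0, hC⟩ : ∃ C : ℝ, 0 ≤ C ∧ ∀ k, ‖m k‖ ≤ C := by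
    refine ⟨1 + ∑ k ∈ (hfin 1 one_pos).toFinset, ‖m k‖, by positivity, fun k => ?_⟩
    by_cases hk : 1 < ‖m k‖
    · have := Finset.single_le_sum (f := fun k => ‖m k‖) (fun i _ => norm_nonneg _)
        ((hfin 1 one_pos).mem_toFinset.2 hk)
      linarith
    · have : 0 ≤ ∑ k ∈ (hfin 1 one_pos).toFinset, ‖m k‖ := by positivity
      linarith
  obtain ⟨T, hT, _⟩ := exists_diag m C hC0 hC
  refine ⟨T, hT, ?_⟩
  have hseq : ∀ n : ℕ, ∃ S : H2 →L[ℂ] H2, IsCompactOperator S ∧ ‖S - T‖ ≤ 1 / ((n : ℝ) + 1) := by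
    intro n
    have hn : (0:ℝ) < 1 / ((n : ℝ) + 1) := by positivity
    set F := (hfin _ hn).toFinset with hF
    let S : H2 →L[ℂ] H2 := ∑ k ∈ F, (lp.singleContinuousLinearMap ℂ (fun _ : ℤ × ℤ => ℂ) 2 k) ∘L
        (m k • lp.evalCLM ℂ (fun _ : ℤ × ℤ => ℂ) 2 k)
    refine ⟨S, ?_, ?_⟩
    · have : ∀ F : Finset (ℤ × ℤ), IsCompactOperator
          (∑ k ∈ F, (lp.singleContinuousLinearMap ℂ (fun _ : ℤ × ℤ => ℂ) 2 k) ∘L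
            (m k • lp.evalCLM ℂ (fun _ : ℤ × ℤ => ℂ) 2 k) : H2 →L[ℂ] H2) := by
        intro F
        induction F using Finset.induction_on with
        | empty => simpa using isCompactOperator_zero
        | insert k F hk ih =>
          rw [Finset.sum_insert hk]
          refine IsCompactOperator.add ?_ ih
          exact (isCompactOperator_of_locallyCompactSpace_dom
            (m k • lp.evalCLM ℂ (fun _ : ℤ × ℤ => ℂ) 2 k)).clm_comp
            (lp.singleContinuousLinearMap ℂ (fun _ : ℤ × ℤ => ℂ) 2 k)
      exact this F
    · obtain ⟨U, hU, hUn⟩ := exists_diag (fun k => if k ∈ F then 0 else - m k) _ hn.le (fun k => by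
        by_cases hk : k ∈ F
        · simp only [hk, if_true, norm_zero]; exact hn.le
        · simp only [hk, if_false, norm_neg]
          rw [hF, Set.Finite.mem_toFinset] at hk
          exact not_lt.1 hk)
      have : S - T = U := by
        ext x k
        rw [hU]
        have hS : S x k = if k ∈ F then m k * x k else 0 := by
          simp only [S, sum_apply]
          rw [lp.coeFn_sum, Finset.sum_apply]
          simp only [ContinuousLinearMap.comp_apply, lp.singleContinuousLinearMap_apply,
            lp.single_apply, smul_apply]
          have := Finset.sum_ite_eq F k (fun k => m k * x k)
          rw [← this]
          refine Finset.sum_congr rfl fun i _ => ?_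
          by_cases hik : k = i
          · subst hik; simp [lp.evalCLM]
          · simp [hik]
        have : (S - T) x k = S x k - T x k := rfl
        rw [this, hS, hT]
        by_cases hk : k ∈ F <;> simp [hk]
      rw [this]; exact hUn
  choose S hS1 hS2 using hseq
  refine isCompactOperator_of_tendsto (l := atTop) (F := S) ?_ (Eventually.of_forall hS1)
  rw [tendsto_iff_norm_sub_tendsto_zero]
  exact squeeze_zero (fun n => norm_nonneg _) hS2 tendsto_one_div_add_atTop_nhds_zero_nat

lemma exists_shift (j : ℤ × ℤ) :
    ∃ T : H2 →L[ℂ] H2, (∀ x k, T x k = x (k - j)) ∧ ‖T‖ ≤ 1 := by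
  have hmem : ∀ x : H2, Memℓp (fun k => x (k - j)) 2 := fun x =>
    memH ((Equiv.subRight j).summable_iff.2 (H2_summable x))
  let T : H2 →ₗ[ℂ] H2 :=
    { toFun := fun x => ⟨fun k => x (k - j), hmem x⟩
      map_add' := fun x y => rfl
      map_smul' := fun c x => by ext k; simp }
  have hT : ∀ x k, T x k = x (k - j) := fun x k => rfl
  have hb : ∀ x, ‖T x‖ ≤ 1 * ‖x‖ := fun x => by
    have h1 : ‖T x‖ ^ 2 = ‖x‖ ^ 2 := by
      rw [H2_norm_sq, H2_norm_sq]
      exact (Equiv.subRight j).tsum_eq (fun k => ‖x k‖ ^ 2)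
    rw [one_mul]
    exact le_of_sq_le_sq h1.le (by positivity)
  exact ⟨T.mkContinuous 1 hb, fun x k => hT x k, T.mkContinuous_norm_le zero_le_one hb⟩

lemma exists_conv (c : ℤ × ℤ → ℂ) (hc : Summable fun k => ‖c k‖)
    (hs : ∀ k, c (-k) = (starRingEnd ℂ) (c k)) :
    ∃ G : H2 →L[ℂ] H2, (∀ x k, G x k = conv c x k) ∧ ∀ x y, inner ℂ (G x) y = inner ℂ x (G y) := by
  choose sh hsh hshn using exists_shift
  have hsum : Summable fun j => c j • sh j := by
    refine Summable.of_norm_bounded hc fun j => ?_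
    rw [norm_smul]
    exact mul_le_of_le_one_right (norm_nonneg _) (hshn j)
  have happ : ∀ x, HasSum (fun j => c j • sh j x) ((∑' j, c j • sh j) x) := fun x => by
    have := hsum.hasSum.mapL (ContinuousLinearMap.apply ℂ H2 x)
    simpa using this
  refine ⟨∑' j, c j • sh j, fun x k => ?_, fun x y => ?_⟩
  · have := (happ x).mapL (lp.evalCLM ℂ (fun _ : ℤ × ℤ => ℂ) 2 k)
    have h2 := this.tsum_eq
    unfold conv
    rw [show (∑' j, c j • sh j) x k
      = lp.evalCLM ℂ (fun _ : ℤ × ℤ => ℂ) 2 k ((∑' j, c j • sh j) x) from rfl, ← h2]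
    congr 1; ext j
    rw [← hsh]; rfl
  · have hin : ∀ j, inner ℂ (sh j x) y = inner ℂ x (sh (-j) y) := fun j => by
      rw [lp.inner_eq_tsum, lp.inner_eq_tsum, ← (Equiv.addRight j).tsum_eq]
      congr 1; ext k
      simp [hsh]
    have h1 := ((happ x).mapL (innerSL ℂ y)).tsum_eq
    have h2 := ((happ y).mapL (innerSL ℂ x)).tsum_eq
    simp only [innerSL_apply_apply, inner_smul_right] at h1 h2
    rw [← h2, ← inner_conj_symm, ← h1, Complex.conj_tsum, ← (Equiv.neg (ℤ × ℤ)).tsum_eq]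
    congr 1; ext j
    simp only [Equiv.neg_apply, map_mul, hs, Complex.conj_conj, inner_conj_symm]
    rw [hin, neg_neg]

lemma adjoint_diag {m : ℤ × ℤ → ℂ} {T : H2 →L[ℂ] H2} (hT : ∀ x k, T x k = m k * x k) (y : H2)
    (k : ℤ × ℤ) : (ContinuousLinearMap.adjoint T) y k = (starRingEnd ℂ) (m k) * y k := by
  have h1 : inner ℂ (lp.single 2 k (1:ℂ) : H2) ((ContinuousLinearMap.adjoint T) y)
      = (ContinuousLinearMap.adjoint T) y k := by
    rw [lp.inner_single_left]; simp
  have h2 : T (lp.single 2 k (1:ℂ) : H2) = m k • (lp.single 2 k (1:ℂ) : H2) := by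
    ext i
    rw [hT]
    simp only [lp.coeFn_smul, Pi.smul_apply, smul_eq_mul, lp.single_apply]
    by_cases h : i = k
    · subst h; simp
    · simp [h]
  rw [← h1, ContinuousLinearMap.adjoint_inner_right, h2, inner_smul_left, lp.inner_single_left]
  simp

end DiracT

namespace DiracT
open Complex MeasureTheory Filter Topology

/-- symbol of `∂x - i ∂y` -/
noncomputable def sg (a b : ℝ) (k : ℤ × ℤ) : ℂ := sx k - I * sy a b k

lemma sg_eq (a b : ℝ) (k : ℤ × ℤ) :
    sg a b k = ((2 * Real.pi * ((k.2 - a * k.1) / b) : ℝ) : ℂ) + ((2 * Real.pi * k.1 : ℝ) : ℂ) * I := by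
  unfold sg sx sy
  push_cast
  linear_combination -(2 * (Real.pi:ℂ) * ((k.2 - a * k.1) / b)) * I_sq

lemma sg_re (a b : ℝ) (k : ℤ × ℤ) : (sg a b k).re = 2 * Real.pi * ((k.2 - a * k.1) / b) := by
  rw [sg_eq]; simp [-ofReal_mul, -ofReal_div, -ofReal_sub]
lemma sg_im (a b : ℝ) (k : ℤ × ℤ) : (sg a b k).im = 2 * Real.pi * k.1 := by
  rw [sg_eq]; simp [-ofReal_mul, -ofReal_div, -ofReal_sub]

lemma sg_zero (a b : ℝ) : sg a b 0 = 0 := by simp [sg, sx, sy]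

lemma conj_sg (a b : ℝ) (k : ℤ × ℤ) : (starRingEnd ℂ) (sg a b k) = -(sx k + I * sy a b k) := by
  rw [sg_eq]
  simp only [map_add, map_mul, conj_ofReal, conj_I]
  unfold sx sy
  push_cast
  linear_combination (2 * (Real.pi:ℂ) * ((k.2 - a * k.1) / b)) * I_sq

lemma wt_le_sg (a : ℝ) {b : ℝ} (hb : 0 < b) {k : ℤ × ℤ} (hk : k ≠ 0) :
    wt k ≤ 2 * (1 + |a| + b) * ‖sg a b k‖ := by
  have h1 : 2 * Real.pi * |(k.1 : ℝ)| ≤ ‖sg a b k‖ := by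
    have := abs_im_le_norm (sg a b k)
    rwa [sg_im, abs_mul, abs_of_pos (by positivity)] at this
  have h2 : 2 * Real.pi * |((k.2 - a * k.1) / b : ℝ)| ≤ ‖sg a b k‖ := by
    have := abs_re_le_norm (sg a b k)
    rwa [sg_re, abs_mul, abs_of_pos (by positivity)] at this
  have hpi := Real.pi_gt_three
  set q := ((k.2 - a * k.1) / b : ℝ) with hq
  have h3 : (k.2 : ℝ) = b * q + a * k.1 := by rw [hq]; field_simp; ring
  have h4 : |(k.2 : ℝ)| ≤ b * |q| + |a| * |(k.1:ℝ)| := by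
    rw [h3]
    refine (abs_add_le _ _).trans ?_
    rw [abs_mul, abs_mul, abs_of_pos hb]
  have h5 : 1 ≤ |(k.1 : ℝ)| + |(k.2 : ℝ)| := by
    have : k.1 ≠ 0 ∨ k.2 ≠ 0 := by
      by_contra h; push Not at h; exact hk (Prod.ext h.1 h.2)
    rcases this with h | h
    · have h6 : (1:ℝ) ≤ |(k.1 : ℝ)| := by exact_mod_cast Int.one_le_abs h
      linarith [abs_nonneg (k.2 : ℝ)]
    · have h6 : (1:ℝ) ≤ |(k.2 : ℝ)| := by exact_mod_cast Int.one_le_abs h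
      linarith [abs_nonneg (k.1 : ℝ)]
  have hn1 := abs_nonneg (k.1 : ℝ)
  have hn2 := abs_nonneg q
  have ha := abs_nonneg a
  have h6 : |(k.1 : ℝ)| ≤ ‖sg a b k‖ / 2 := by nlinarith
  have h7 : |q| ≤ ‖sg a b k‖ / 2 := by nlinarith
  unfold wt
  have h8 : |a| * |(k.1:ℝ)| ≤ |a| * (‖sg a b k‖ / 2) := by gcongr
  have h9 : b * |q| ≤ b * (‖sg a b k‖ / 2) := by gcongr
  nlinarith [norm_nonneg (sg a b k)]

/-- solutions of the weighted Dirac equation -/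
structure Sol (a b : ℝ) (h : ℝ × ℝ → ℝ) (φ₁ φ₂ : ℝ × ℝ → ℂ) : Prop where
  s1 : SP a b φ₁
  s2 : SP a b φ₂
  e1 : ∀ p, dX φ₂ p - I * dY φ₂ p = (h p : ℂ) * φ₁ p
  e2 : ∀ p, -(dX φ₁ p + I * dY φ₁ p) = (h p : ℂ) * φ₂ p

lemma RD.sg {c : ℤ × ℤ → ℂ} (hc : RD c) (a b : ℝ) : RD (fun k => sg a b k * c k) := by
  have := hc.sx.add ((hc.sy a b).const_mul (-I))
  refine this.of_le fun k => ?_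
  unfold DiracT.sg
  apply le_of_eq; congr 1; ring

lemma RD.csg {c : ℤ × ℤ → ℂ} (hc : RD c) (a b : ℝ) :
    RD (fun k => (starRingEnd ℂ) (DiracT.sg a b k) * c k) := by
  refine (hc.sg a b).of_le fun k => ?_
  simp

lemma dm_ev {c : ℤ × ℤ → ℂ} (hc : RD c) (a b : ℝ) (p : ℝ × ℝ) :
    dX (ev a b c) p - I * dY (ev a b c) p = ev a b (fun k => sg a b k * c k) p := by
  rw [dX_ev hc, dY_ev hc, sub_eq_add_neg, ← neg_mul, ← ev_const_mul,
    ← ev_add hc.sx ((hc.sy a b).const_mul _)]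
  congr 1; ext k; unfold sg; ring

lemma dp_ev {c : ℤ × ℤ → ℂ} (hc : RD c) (a b : ℝ) (p : ℝ × ℝ) :
    -(dX (ev a b c) p + I * dY (ev a b c) p)
      = ev a b (fun k => (starRingEnd ℂ) (sg a b k) * c k) p := by
  rw [dX_ev hc, dY_ev hc, ← ev_const_mul,
    ← ev_add hc.sx ((hc.sy a b).const_mul _), ← neg_one_mul, ← ev_const_mul]
  congr 1; ext k; rw [conj_sg]; ring

lemma ev_inj {a b : ℝ} (hb : 0 < b) {c d : ℤ × ℤ → ℂ} (hc : RD c) (hd : RD d)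
    (h : ∀ p, ev a b c p = ev a b d p) : c = d := by
  have h1 := ev_coeff (a := a) hb (hc.add (hd.const_mul (-1))) (fun p => by
    rw [ev_add hc (hd.const_mul _), ev_const_mul, h]; ring)
  ext k
  have := h1 k
  linear_combination this

lemma RD.summable_sq {c : ℤ × ℤ → ℂ} (hc : RD c) : Summable fun k => ‖c k‖ ^ 2 := by
  obtain ⟨C, hC⟩ := hc 0
  refine Summable.of_nonneg_of_le (fun k => by positivity) (fun k => ?_) (hc.summable_norm.mul_left C)
  have := hC k
  rw [pow_zero, mul_one] at this
  rw [sq]; gcongr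

/-- vector in `H2` with given coefficients -/
noncomputable def toH (c : ℤ × ℤ → ℂ) (hc : RD c) : H2 := ⟨c, memH hc.summable_sq⟩

lemma toH_apply (c : ℤ × ℤ → ℂ) (hc : RD c) (k) : toH c hc k = c k := rfl

lemma parseval_norm {a b : ℝ} (hb : 0 < b) {c : ℤ × ℤ → ℂ} (hc : RD c) :
    ∫ p, ‖ev a b c p‖ ^ 2 ∂(muT b) = b * ∑' k, ‖c k‖ ^ 2 := by
  have h := parseval (a := a) hb hc hc
  have e : ∀ z : ℂ, (starRingEnd ℂ) z * z = ((‖z‖ ^ 2 : ℝ) : ℂ) := fun z => by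
    rw [mul_comm, Complex.mul_conj, Complex.normSq_eq_norm_sq]
  simp only [e] at h
  rw [integral_complex_ofReal, ← ofReal_tsum, ← ofReal_mul] at h
  exact_mod_cast h

lemma SP_exp {a b : ℝ} {L : ℝ × ℝ → ℝ} (hL : SP a b L) (t : ℝ) :
    SP a b (fun p => ((Real.exp (t * L p) : ℝ) : ℂ)) where
  smooth := ofRealCLM.contDiff.comp ((contDiff_const.mul hL.smooth).exp)
  p1 := fun p => by simp only [hL.p1]
  p2 := fun p => by simp only [hL.p2]

/-- inverse symbol -/
noncomputable def al (a b : ℝ) (k : ℤ × ℤ) : ℂ := (sg a b k)⁻¹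

lemma al_le (a : ℝ) {b : ℝ} (hb : 0 < b) (k : ℤ × ℤ) :
    ‖al a b k‖ * wt k ≤ 2 * (1 + |a| + b) := by
  have ha := abs_nonneg a
  unfold al
  by_cases hk : k = 0
  · subst hk; rw [sg_zero]; simp; positivity
  · have h := wt_le_sg a hb hk
    have hp : 0 < ‖sg a b k‖ := by
      by_contra hc
      have h0 : ‖sg a b k‖ = 0 := le_antisymm (not_lt.1 hc) (norm_nonneg _)
      rw [h0, mul_zero] at h
      linarith [wt_pos k]
    rw [norm_inv, inv_mul_le_iff₀ hp]
    linarith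

lemma sg_ne {a b : ℝ} (hb : 0 < b) {k : ℤ × ℤ} (hk : k ≠ 0) : sg a b k ≠ 0 := by
  intro h
  have h1 := wt_le_sg a hb hk
  rw [h, norm_zero, mul_zero] at h1
  linarith [wt_pos k]

lemma tendsto_al (a : ℝ) {b : ℝ} (hb : 0 < b) : Tendsto (al a b) cofinite (𝓝 0) := by
  rw [tendsto_zero_iff_norm_tendsto_zero]
  have h1 := (summable_wt.tendsto_cofinite_zero).sqrt.sqrt.const_mul (2 * (1 + |a| + b))
  simp only [Real.sqrt_zero, mul_zero] at h1
  refine squeeze_zero (fun k => norm_nonneg _) (fun k => ?_) h1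
  have hw := wt_pos k
  rw [show (wt k ^ 4)⁻¹ = (((wt k)⁻¹) ^ 2) ^ 2 by field_simp, Real.sqrt_sq (by positivity),
    Real.sqrt_sq (by positivity), ← div_eq_mul_inv, le_div_iff₀ hw]
  exact al_le a hb k

end DiracT

namespace DiracT
open Complex MeasureTheory Filter Topology

lemma conj_mul_self (z : ℂ) : (starRingEnd ℂ) z * z = ((‖z‖ ^ 2 : ℝ) : ℂ) := by
  rw [mul_comm, Complex.mul_conj, Complex.normSq_eq_norm_sq]

/-- coefficients of a solution -/
lemma Sol.coeff {a b : ℝ} (hb : 0 < b) {h : ℝ × ℝ → ℝ} {φ₁ φ₂ : ℝ × ℝ → ℂ} (hs : Sol a b h φ₁ φ₂) :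
    ∃ c d, RD c ∧ RD d ∧ (∀ p, ev a b c p = φ₁ p) ∧ (∀ p, ev a b d p = φ₂ p) ∧
      (∀ p, ev a b (fun k => sg a b k * d k) p = (h p : ℂ) * φ₁ p) ∧
      (∀ p, ev a b (fun k => (starRingEnd ℂ) (sg a b k) * c k) p = (h p : ℂ) * φ₂ p) := by
  obtain ⟨c, hc, hc'⟩ := exists_coeff hb.ne' hs.s1
  obtain ⟨d, hd, hd'⟩ := exists_coeff hb.ne' hs.s2
  refine ⟨c, d, hc, hd, hc', hd', fun p => ?_, fun p => ?_⟩
  · rw [← dm_ev hd, ← hs.e1, ← funext hd']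
  · rw [← dp_ev hc, ← hs.e2, ← funext hc']

lemma Sol.int_eq {a b : ℝ} (hb : 0 < b) {h : ℝ × ℝ → ℝ} {φ₁ φ₂ : ℝ × ℝ → ℂ} (hs : Sol a b h φ₁ φ₂) :
    ∫ p, h p * ‖φ₁ p‖ ^ 2 ∂(muT b) = ∫ p, h p * ‖φ₂ p‖ ^ 2 ∂(muT b) := by
  obtain ⟨c, d, hc, hd, hc', hd', e1, e2⟩ := hs.coeff hb
  have h1 := parseval (a := a) hb hc (hd.sg a b)
  have h2 := parseval (a := a) hb (hc.csg a b) hd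
  have h3 : ∀ k, (starRingEnd ℂ) ((starRingEnd ℂ) (sg a b k) * c k) * d k
      = (starRingEnd ℂ) (c k) * (sg a b k * d k) := fun k => by
    rw [map_mul, conj_conj]; ring
  simp only [h3] at h2
  rw [← h1] at h2
  simp only [hc', hd', e1, e2] at h2
  have h4 : ∀ p, (starRingEnd ℂ) ((h p : ℂ) * φ₂ p) * φ₂ p = ((h p * ‖φ₂ p‖ ^ 2 : ℝ) : ℂ) := fun p => by
    rw [map_mul, conj_ofReal, mul_assoc, conj_mul_self, ofReal_mul]
  have h5 : ∀ p, (starRingEnd ℂ) (φ₁ p) * ((h p : ℂ) * φ₁ p) = ((h p * ‖φ₁ p‖ ^ 2 : ℝ) : ℂ) := fun p => by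
    rw [mul_left_comm, conj_mul_self, ofReal_mul]
  simp only [h4, h5] at h2
  rw [integral_complex_ofReal, integral_complex_ofReal] at h2
  exact (ofReal_injective h2).symm

lemma integral_pos_of {a b : ℝ} (hb : 0 < b) {g : ℝ × ℝ → ℝ} (hg : Continuous g) (h0 : ∀ p, 0 ≤ g p)
    (hp1 : ∀ p : ℝ × ℝ, g (p.1 + 1, p.2) = g p) (hp2 : ∀ p : ℝ × ℝ, g (p.1 + a, p.2 + b) = g p)
    (hi : ∫ p, g p ∂(muT b) = 0) : ∀ p, g p = 0 := by
  -- zero on the closed rectangle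
  have hz : ∀ p ∈ Set.Ioo (0:ℝ) 1 ×ˢ Set.Ioo (0:ℝ) b, g p = 0 := by
    rw [integral_eq_zero_iff_of_nonneg h0 (integrable_muT hg b)] at hi
    have hres : g =ᵐ[volume.restrict (Set.Ioo (0:ℝ) 1 ×ˢ Set.Ioo (0:ℝ) b)] 0 := by
      rw [muT_eq] at hi
      exact ae_restrict_of_ae_restrict_of_subset
        (Set.prod_mono Set.Ioo_subset_Ioc_self Set.Ioo_subset_Ioc_self) hi
    exact Measure.eqOn_open_of_ae_eq hres (isOpen_Ioo.prod isOpen_Ioo) hg.continuousOn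
      continuousOn_const
  have hz2 : ∀ p ∈ Set.Icc (0:ℝ) 1 ×ˢ Set.Icc (0:ℝ) b, g p = 0 := by
    have hcl : closure (Set.Ioo (0:ℝ) 1 ×ˢ Set.Ioo (0:ℝ) b) = Set.Icc (0:ℝ) 1 ×ˢ Set.Icc (0:ℝ) b := by
      rw [closure_prod_eq, closure_Ioo zero_ne_one, closure_Ioo hb.ne]
    intro p hp
    rw [← hcl] at hp
    exact (isClosed_eq hg continuous_const).closure_subset_iff.2 (fun q hq => hz q hq) hp
  have hpz1 : ∀ (n : ℤ) (p : ℝ × ℝ), g (p.1 + n, p.2) = g p := by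
    intro n p
    have : Function.Periodic (fun x => g (x, p.2)) 1 := fun x => hp1 (x, p.2)
    have := (this.int_mul n) p.1
    simpa using this
  have hpz2 : ∀ (n : ℤ) (p : ℝ × ℝ), g (p.1 + n * a, p.2 + n * b) = g p := by
    intro n p
    have : Function.Periodic (fun t : ℝ => g (p.1 + t * a, p.2 + t * b)) 1 := fun t => by
      have := hp2 (p.1 + t * a, p.2 + t * b)
      simp only at this ⊢
      rw [← this]; congr 1; ext <;> simp <;> ring
    have := (this.int_mul n) 0
    simpa using this
  intro p
  set n : ℤ := -⌊p.2 / b⌋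
  set q : ℝ × ℝ := (p.1 + n * a, p.2 + n * b)
  rw [← hpz2 n p, ← hpz1 (-⌊q.1⌋) q]
  apply hz2
  simp only [Set.mem_prod, Set.mem_Icc, q, n]
  push_cast
  have h1 := Int.floor_le (p.1 + -(⌊p.2 / b⌋ : ℝ) * a)
  have h2 := (Int.lt_floor_add_one (p.1 + -(⌊p.2 / b⌋ : ℝ) * a)).le
  have h3 := Int.floor_le (p.2 / b)
  have h4 := (Int.lt_floor_add_one (p.2 / b)).le
  rw [le_div_iff₀ hb] at h3
  rw [div_le_iff₀ hb] at h4
  refine ⟨⟨?_, ?_⟩, ?_, ?_⟩ <;> linarith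

theorem spectral {a b : ℝ} (hb : 0 < b) {L : ℝ × ℝ → ℝ} (hL : SP a b L)
    (hne : ∃ (h : ℝ × ℝ → ℝ) (φ₁ φ₂ : ℝ × ℝ → ℂ), Sol a b h φ₁ φ₂ ∧ 0 < ∫ p, h p * ‖φ₂ p‖ ^ 2 ∂(muT b)) :
    ∃ R : ℝ, 0 < R ∧
      (∃ φ₁ φ₂ : ℝ × ℝ → ℂ, Sol a b (fun p => Real.exp (L p) / R) φ₁ φ₂ ∧ ∃ p, φ₁ p ≠ 0) ∧
      ∀ (h : ℝ × ℝ → ℝ) (φ₁ φ₂ : ℝ × ℝ → ℂ), Sol a b h φ₁ φ₂ → Continuous h →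
        ∫ p, h p * (‖φ₁ p‖ ^ 2 + ‖φ₂ p‖ ^ 2) ∂(muT b)
          ≤ R * ∫ p, h p ^ 2 * (‖φ₁ p‖ ^ 2 + ‖φ₂ p‖ ^ 2) * Real.exp (-L p) ∂(muT b) := by
  obtain ⟨g, hg, hge⟩ := exists_coeff hb.ne' (SP_exp hL (1/2))
  have hgs : ∀ k, g (-k) = (starRingEnd ℂ) (g k) := by
    have := ev_inj (a := a) hb hg hg.star (fun p => by
      rw [← conj_ev, hge, conj_ofReal])
    intro k
    have := congrFun this (-k)
    simpa using this
  obtain ⟨G, hG, hGs⟩ := exists_conv g hg.summable_norm hgs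
  obtain ⟨A, hA, hAc⟩ := exists_diag_compact (al a b) (tendsto_al a hb)
  set e0 : H2 := lp.single 2 (0 : ℤ × ℤ) (1:ℂ) with he0
  have hGe : ∀ x : H2, inner ℂ (G e0) x = G x 0 := fun x => by
    rw [hGs, he0, lp.inner_single_left]; simp
  -- a test pair for a solution
  have test : ∀ (h : ℝ × ℝ → ℝ) (φ₁ φ₂ : ℝ × ℝ → ℂ), Sol a b h φ₁ φ₂ →
      ∃ x y : H2, inner ℂ (G e0) x = 0 ∧ inner ℂ (G e0) y = 0 ∧
        (b:ℂ) * inner ℂ y (G (A (G x))) = ((∫ p, h p * ‖φ₂ p‖ ^ 2 ∂(muT b) : ℝ) : ℂ) ∧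
        b * ‖x‖ ^ 2 = ∫ p, h p ^ 2 * ‖φ₁ p‖ ^ 2 * Real.exp (-L p) ∂(muT b) ∧
        b * ‖y‖ ^ 2 = ∫ p, h p ^ 2 * ‖φ₂ p‖ ^ 2 * Real.exp (-L p) ∂(muT b) := by
    intro h φ₁ φ₂ hs
    obtain ⟨c, d, hc, hd, hc', hd', e1, e2⟩ := hs.coeff hb
    have key : ∀ (w : ℤ × ℤ → ℂ) (φ : ℝ × ℝ → ℂ), RD w → (∀ p, ev a b w p = (h p : ℂ) * φ p) →
        ∃ x : H2, (∀ k, G x k = w k) ∧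
          b * ‖x‖ ^ 2 = ∫ p, h p ^ 2 * ‖φ p‖ ^ 2 * Real.exp (-L p) ∂(muT b) := by
      intro w φ hw hwe
      obtain ⟨x, hx, hxe⟩ := exists_coeff hb.ne' ((SP_exp hL (-1/2)).mul (SP_ev a hb.ne' hw))
      refine ⟨toH x hx, fun k => ?_, ?_⟩
      · rw [hG]
        have : conv g x = w := ev_inj (a := a) hb (hg.conv hx) hw (fun p => by
          rw [← ev_mul hg hx, hge, hxe, ← mul_assoc, ← ofReal_mul, ← Real.exp_add]
          rw [show 1 / 2 * L p + -1 / 2 * L p = 0 by ring]; simp)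
        exact congrFun this k
      · rw [H2_norm_sq]
        simp only [toH_apply]
        rw [← parseval_norm (a := a) hb hx]
        congr 1; ext p
        rw [hxe, hwe, norm_mul, norm_mul, norm_real, norm_real, mul_pow, mul_pow, Real.norm_eq_abs,
          Real.norm_eq_abs, sq_abs, sq_abs, ← Real.exp_nat_mul]
        rw [show ((2:ℕ):ℝ) * (-1 / 2 * L p) = - L p by push_cast; ring]; ring
    obtain ⟨x, hx1, hx2⟩ := key _ φ₁ (hd.sg a b) e1
    obtain ⟨y, hy1, hy2⟩ := key _ φ₂ (hc.csg a b) e2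
    refine ⟨x, y, by rw [hGe, hx1, sg_zero, zero_mul], by rw [hGe, hy1, sg_zero]; simp, ?_, hx2, hy2⟩
    rw [← hGs, lp.inner_eq_tsum]
    have h2 := parseval (a := a) hb (hc.csg a b) hd
    have h4 : ∀ p, (starRingEnd ℂ) ((h p : ℂ) * φ₂ p) * φ₂ p = ((h p * ‖φ₂ p‖ ^ 2 : ℝ) : ℂ) := fun p => by
      rw [map_mul, conj_ofReal, mul_assoc, conj_mul_self, ofReal_mul]
    simp only [e2, hd', h4] at h2
    rw [integral_complex_ofReal] at h2
    rw [h2]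
    congr 2; ext k
    rw [hA, hx1, hy1, RCLike.inner_apply]
    by_cases hk : k = 0
    · subst hk; simp [sg_zero]
    · unfold al
      rw [← mul_assoc, inv_mul_cancel₀ (sg_ne hb hk)]; ring
  have hbc : (b:ℂ) ≠ 0 := by exact_mod_cast hb.ne'
  obtain ⟨R, hR, ⟨x, y, β, γ, hx0, hx, hy, hxy1, hxy2⟩, hin⟩ := abstract_spectral G A hGs hAc e0 (by
    obtain ⟨h, φ₁, φ₂, hs, hpos⟩ := hne
    obtain ⟨x, y, hx, hy, hxy, _⟩ := test h φ₁ φ₂ hs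
    refine ⟨x, y, hx, hy, fun h0 => ?_⟩
    rw [h0, mul_zero] at hxy
    have : ∫ p, h p * ‖φ₂ p‖ ^ 2 ∂(muT b) = 0 := by exact_mod_cast hxy.symm
    exact hpos.ne' this)
  have hRc : (R:ℂ) ≠ 0 := by exact_mod_cast hR.ne'
  refine ⟨R, hR, ?_, ?_⟩
  · set u := A (G x) - β • e0 with hu
    set v := (ContinuousLinearMap.adjoint A) (G y) - γ • e0 with hv
    have hGG1 : ∀ k, (R:ℂ) * G x k = conv g (conv g v) k := fun k => by
      have h1 : G (G v) k = (R:ℂ) * G x k := by rw [hxy2, map_smul]; rfl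
      rw [← h1, hG]
      congr 1; ext k; rw [hG]
    have hGG2 : ∀ k, (R:ℂ) * G y k = conv g (conv g u) k := fun k => by
      have h1 : G (G u) k = (R:ℂ) * G y k := by rw [hxy1, map_smul]; rfl
      rw [← h1, hG]
      congr 1; ext k; rw [hG]
    have hu_app : ∀ k, u k = al a b k * G x k - β * (if k = 0 then 1 else 0) := fun k => by
      rw [hu, lp.coeFn_sub, Pi.sub_apply, hA, lp.coeFn_smul, Pi.smul_apply, smul_eq_mul, he0,
        lp.single_apply, Pi.single_apply]
    have hv_app : ∀ k, v k = (starRingEnd ℂ) (al a b k) * G y k - γ * (if k = 0 then 1 else 0) := fun k => by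
      rw [hv, lp.coeFn_sub, Pi.sub_apply, adjoint_diag hA, lp.coeFn_smul, Pi.smul_apply, smul_eq_mul, he0,
        lp.single_apply, Pi.single_apply]
    have step : ∀ (N : ℕ) (u v : ℤ × ℤ → ℂ) (m : ℤ × ℤ → ℂ) (w : ℤ × ℤ → ℂ) (β : ℂ),
        (∀ k, ‖m k‖ = ‖al a b k‖) → (∀ k, (R:ℂ) * w k = conv g (conv g v) k) →
        (∀ k, u k = m k * w k - β * (if k = 0 then 1 else 0)) →
        (∃ C : ℝ, ∀ k, ‖v k‖ * wt k ^ N ≤ C) → ∃ C : ℝ, ∀ k, ‖u k‖ * wt k ^ (N+1) ≤ C := by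
      intro N u v m w β hm hw hu ⟨C, hC⟩
      obtain ⟨C1, hC1⟩ := conv_bound hg N hC
      obtain ⟨C2, hC2⟩ := conv_bound hg N hC1
      refine ⟨2 * (1 + |a| + b) * (C2 / R) + ‖β‖, fun k => ?_⟩
      have hwk := wt_pos k
      have h1 : ‖w k‖ * wt k ^ N ≤ C2 / R := by
        rw [le_div_iff₀ hR]
        have := hC2 k
        rw [← hw, norm_mul, norm_real, Real.norm_eq_abs, abs_of_pos hR] at this
        linarith
      have h2 : ‖u k‖ ≤ ‖m k‖ * ‖w k‖ + ‖β * (if k = 0 then 1 else 0)‖ := by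
        rw [hu, ← norm_mul]; exact norm_sub_le _ _
      have h3 : ‖β * (if k = 0 then 1 else 0)‖ * wt k ^ (N+1) ≤ ‖β‖ := by
        by_cases hk : k = 0
        · subst hk; simp [wt]
        · simp [hk]
      calc ‖u k‖ * wt k ^ (N+1) ≤ (‖m k‖ * ‖w k‖ + ‖β * (if k = 0 then 1 else 0)‖) * wt k ^ (N+1) := by gcongr
        _ = (‖m k‖ * wt k) * (‖w k‖ * wt k ^ N) + ‖β * (if k = 0 then 1 else 0)‖ * wt k ^ (N+1) := by ring
        _ ≤ _ := by
          have h4 := al_le a hb k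
          rw [← hm] at h4
          gcongr
    have hN : ∀ N : ℕ, (∃ C : ℝ, ∀ k, ‖u k‖ * wt k ^ N ≤ C) ∧ (∃ C : ℝ, ∀ k, ‖v k‖ * wt k ^ N ≤ C) := by
      intro N
      induction N with
      | zero =>
        exact ⟨⟨‖u‖, fun k => by simpa using lp.norm_apply_le_norm (by simp) u k⟩,
          ⟨‖v‖, fun k => by simpa using lp.norm_apply_le_norm (by simp) v k⟩⟩
      | succ N ih =>
        exact ⟨step N u v (al a b) (fun k => G x k) β (fun k => rfl) hGG1 hu_app ih.2,
          step N v u (fun k => (starRingEnd ℂ) (al a b k)) (fun k => G y k) γ (fun k => by simp) hGG2 hv_app ih.1⟩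
    have hu_rd : RD u := fun N => (hN N).1
    have hv_rd : RD v := fun N => (hN N).2
    have hgg : ∀ (w : ℤ × ℤ → ℂ), RD w → ∀ p, ev a b (conv g (conv g w)) p
        = ((Real.exp (L p) : ℝ) : ℂ) * ev a b w p := fun w hw p => by
      rw [← ev_mul hg (hg.conv hw), ← ev_mul hg hw, hge, ← mul_assoc, ← ofReal_mul, ← Real.exp_add]
      rw [show 1 / 2 * L p + 1 / 2 * L p = L p by ring]
    refine ⟨ev a b v, ev a b u, ⟨SP_ev a hb.ne' hv_rd, SP_ev a hb.ne' hu_rd, fun p => ?_, fun p => ?_⟩, ?_⟩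
    · rw [dm_ev hu_rd]
      have : (fun k => sg a b k * u k) = fun k => (R:ℂ)⁻¹ * conv g (conv g v) k := by
        ext k
        rw [← hGG1, inv_mul_cancel_left₀ hRc, hu_app]
        by_cases hk : k = 0
        · subst hk; rw [sg_zero, zero_mul, ← hGe, hx]
        · unfold al; simp [hk, sg_ne hb hk]
      rw [this, ev_const_mul, hgg _ hv_rd, ofReal_div]; ring
    · rw [dp_ev hv_rd]
      have : (fun k => (starRingEnd ℂ) (sg a b k) * v k) = fun k => (R:ℂ)⁻¹ * conv g (conv g u) k := by
        ext k
        rw [← hGG2, inv_mul_cancel_left₀ hRc, hv_app]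
        by_cases hk : k = 0
        · subst hk; rw [sg_zero, map_zero, zero_mul, ← hGe, hy]
        · unfold al; simp [hk, sg_ne hb hk]
      rw [this, ev_const_mul, hgg _ hu_rd, ofReal_div]; ring
    · by_contra hcon
      push Not at hcon
      have h1 := ev_coeff hb hv_rd hcon
      have h2 : v = 0 := by ext k; exact h1 k
      rw [h2, map_zero] at hxy2
      exact hx0 ((smul_eq_zero.1 hxy2.symm).resolve_left hRc)
  · intro h φ₁ φ₂ hs hh
    obtain ⟨x, y, hx, hy, h1, h2, h3⟩ := test h φ₁ φ₂ hs
    have c1 := hs.s1.cont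
    have c2 := hs.s2.cont
    have cL := hL.cont
    have h4 := hin x y hx hy
    have h5 : b * ‖inner ℂ y (G (A (G x)))‖ = |∫ p, h p * ‖φ₂ p‖ ^ 2 ∂(muT b)| := by
      have := congrArg norm h1
      rwa [norm_mul, norm_real, norm_real, Real.norm_eq_abs, Real.norm_eq_abs, abs_of_pos hb] at this
    have e1 : ∫ p, h p * (‖φ₁ p‖ ^ 2 + ‖φ₂ p‖ ^ 2) ∂(muT b) = 2 * ∫ p, h p * ‖φ₂ p‖ ^ 2 ∂(muT b) := by
      simp only [mul_add]
      rw [integral_add (integrable_muT (by fun_prop) b) (integrable_muT (by fun_prop) b), hs.int_eq hb]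
      ring
    have e2 : ∫ p, h p ^ 2 * (‖φ₁ p‖ ^ 2 + ‖φ₂ p‖ ^ 2) * Real.exp (-L p) ∂(muT b)
        = b * ‖x‖ ^ 2 + b * ‖y‖ ^ 2 := by
      rw [h2, h3]
      simp only [mul_add, add_mul]
      rw [integral_add (integrable_muT (by fun_prop) b) (integrable_muT (by fun_prop) b)]
    rw [e1, e2]
    have h6 := le_abs_self (∫ p, h p * ‖φ₂ p‖ ^ 2 ∂(muT b))
    have h7 : b * ‖inner ℂ y (G (A (G x)))‖ ≤ b * (R * ‖x‖ * ‖y‖) := by gcongr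
    have h8 : 0 ≤ b * R * (‖x‖ - ‖y‖) ^ 2 := by positivity
    nlinarith

end DiracT

namespace DiracT
open Complex MeasureTheory Filter Topology

lemma arc_ineq {τ Θ u u' : ℝ → ℝ} {κ α β : ℝ} (hαβ : α ≤ β) (hτ : Continuous τ) (hτ0 : ∀ y, 0 < τ y)
    (hΘ : ∀ y, HasDerivAt Θ (τ y) y) (hκ : 0 < κ) (hu : ∀ y, HasDerivAt u (u' y) y)
    (hu' : Continuous u') (hlt : κ * (Θ β - Θ α) < Real.pi) (hend : u α = u β) :
    κ ^ 2 * ∫ y in α..β, τ y * (u y - u α) ^ 2 ≤ ∫ y in α..β, u' y ^ 2 / τ y := by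
  set c := u α with hc
  have hΘm : Monotone Θ := by
    apply monotone_of_deriv_nonneg (fun y => (hΘ y).differentiableAt)
    intro y; rw [(hΘ y).deriv]; exact (hτ0 y).le
  have hΘc : Continuous Θ := continuous_iff_continuousAt.2 fun y => (hΘ y).continuousAt
  have huc : Continuous u := continuous_iff_continuousAt.2 fun y => (hu y).continuousAt
  set m := (Θ α + Θ β) / 2 with hm
  have hw : ∀ y ∈ Set.uIcc α β, Real.cos (κ * (Θ y - m)) ≠ 0 := by
    intro y hy
    rw [Set.uIcc_of_le hαβ] at hy
    have h1 := hΘm hy.1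
    have h2 := hΘm hy.2
    apply ne_of_gt
    apply Real.cos_pos_of_mem_Ioo
    constructor <;> nlinarith
  set tn : ℝ → ℝ := fun y => Real.tan (κ * (Θ y - m)) with htn
  have hwd : ∀ y ∈ Set.uIcc α β, HasDerivAt (fun y => κ * (u y - c) ^ 2 * tn y)
      (2 * κ * (u y - c) * u' y * tn y + κ ^ 2 * τ y * (u y - c) ^ 2 * (1 + tn y ^ 2)) y := by
    intro y hy
    have h1 : HasDerivAt (fun y => κ * (Θ y - m)) (κ * τ y) y := ((hΘ y).sub_const m).const_mul κ
    have h2 := (Real.hasDerivAt_tan (hw y hy)).comp y h1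
    have h3 := ((((hu y).sub_const c).pow 2).const_mul κ).mul h2
    refine h3.congr_deriv ?_
    have h4 : 1 + tn y ^ 2 = 1 / Real.cos (κ * (Θ y - m)) ^ 2 := by
      simp only [htn]
      rw [Real.tan_eq_sin_div_cos]
      have := hw y hy
      field_simp
      rw [add_comm]; exact Real.sin_sq_add_cos_sq _
    rw [h4]
    simp only [Function.comp, htn, Pi.pow_apply]
    push_cast
    ring
  have htc : ContinuousOn tn (Set.uIcc α β) := by
    intro y hy
    exact ((Real.continuousAt_tan.2 (hw y hy)).comp (f := fun y => κ * (Θ y - m))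
      (by fun_prop)).continuousWithinAt
  have hWc : ContinuousOn (fun y => 2 * κ * (u y - c) * u' y * tn y
      + κ ^ 2 * τ y * (u y - c) ^ 2 * (1 + tn y ^ 2)) (Set.uIcc α β) := by fun_prop
  have hIntg := intervalIntegral.integral_eq_sub_of_hasDerivAt hwd hWc.intervalIntegrable
  rw [← hend] at hIntg
  simp only [hc, sub_self] at hIntg
  have hne : ∀ y, τ y ≠ 0 := fun y => (hτ0 y).ne'
  have i1 : IntervalIntegrable (fun y => u' y ^ 2 / τ y) volume α β :=
    Continuous.intervalIntegrable (by fun_prop (disch := exact hne _)) _ _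
  have i2 : IntervalIntegrable (fun y => κ ^ 2 * (τ y * (u y - c) ^ 2)) volume α β :=
    Continuous.intervalIntegrable (by fun_prop) _ _
  have hpos : 0 ≤ ∫ y in α..β, (u' y ^ 2 / τ y - κ ^ 2 * (τ y * (u y - c) ^ 2)
      + (2 * κ * (u y - c) * u' y * tn y + κ ^ 2 * τ y * (u y - c) ^ 2 * (1 + tn y ^ 2))) := by
    apply intervalIntegral.integral_nonneg hαβ
    intro y _
    have : u' y ^ 2 / τ y - κ ^ 2 * (τ y * (u y - c) ^ 2)
      + (2 * κ * (u y - c) * u' y * tn y + κ ^ 2 * τ y * (u y - c) ^ 2 * (1 + tn y ^ 2))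
      = (u' y + κ * τ y * (u y - c) * tn y) ^ 2 / τ y := by
      have := hne y
      field_simp
      ring
    rw [this]
    have := hτ0 y
    positivity
  rw [intervalIntegral.integral_add (i1.sub i2) hWc.intervalIntegrable,
    intervalIntegral.integral_sub i1 i2, hIntg, intervalIntegral.integral_const_mul] at hpos
  simp only [hc] at hpos ⊢
  linarith

lemma wirtinger {τ u u' : ℝ → ℝ} {κ b : ℝ} (hb : 0 < b) (hτ : Continuous τ) (hτ0 : ∀ y, 0 < τ y)
    (hτp : ∀ y, τ (y + b) = τ y) (hκ : 0 < κ) (hu : ∀ y, HasDerivAt u (u' y) y)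
    (hu' : Continuous u') (hup : ∀ y, u (y + b) = u y) (hu'p : ∀ y, u' (y + b) = u' y)
    (hlt : κ * (∫ y in (0:ℝ)..b, τ y) < 2 * Real.pi) :
    ∃ c : ℝ, κ ^ 2 * ∫ y in (0:ℝ)..b, τ y * (u y - c) ^ 2 ≤ ∫ y in (0:ℝ)..b, u' y ^ 2 / τ y := by
  set T := ∫ y in (0:ℝ)..b, τ y with hT
  have huc : Continuous u := continuous_iff_continuousAt.2 fun y => (hu y).continuousAt
  set Θ : ℝ → ℝ := fun y => ∫ s in (0:ℝ)..y, τ s with hΘdef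
  have hΘ : ∀ y, HasDerivAt Θ (τ y) y := fun y =>
    intervalIntegral.integral_hasDerivAt_right (hτ.intervalIntegrable _ _)
      (hτ.stronglyMeasurableAtFilter _ _) hτ.continuousAt
  have hΘc : Continuous Θ := continuous_iff_continuousAt.2 fun y => (hΘ y).continuousAt
  have hΘm : StrictMono Θ := by
    apply strictMono_of_deriv_pos
    intro y; rw [(hΘ y).deriv]; exact hτ0 y
  have hTp : 0 < T := intervalIntegral.intervalIntegral_pos_of_pos (hτ.intervalIntegrable _ _) hτ0 hb
  have hper : Function.Periodic τ b := hτp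
  have hΘp : ∀ y, Θ (y + b) = Θ y + T := by
    intro y
    simp only [hΘdef, hT]
    rw [← intervalIntegral.integral_add_adjacent_intervals (hτ.intervalIntegrable 0 y)
      (hτ.intervalIntegrable y (y+b)), hper.intervalIntegral_add_eq y 0, zero_add]
  have hΘ0 : Θ 0 = 0 := by simp [hΘdef]
  have hΘn : ∀ n : ℕ, Θ (n * b) = n * T := by
    intro n
    induction n with
    | zero => simp [hΘ0]
    | succ n ih => push_cast; rw [add_mul, one_mul, hΘp, ih]; ring
  have hΘn' : ∀ n : ℕ, Θ (-(n * b)) = -(n * T) := by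
    intro n
    induction n with
    | zero => simp [hΘ0]
    | succ n ih =>
      have := hΘp (-((n + 1 : ℕ) * b))
      rw [show -((n + 1 : ℕ) * b) + b = -(n * b) by push_cast; ring, ih] at this
      push_cast at this ⊢; linarith
  have hsurj : Function.Surjective Θ := by
    intro t
    obtain ⟨n, hn⟩ := exists_nat_ge (|t| / T)
    rw [div_le_iff₀ hTp] at hn
    have h1 : t ∈ Set.Icc (Θ (-(n * b))) (Θ (n * b)) := by
      rw [hΘn, hΘn']; exact abs_le.1 hn
    have hle : -(n * b) ≤ n * b := by
      have : 0 ≤ (n:ℝ) * b := by positivity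
      linarith
    obtain ⟨y, _, hy⟩ := intermediate_value_Icc hle hΘc.continuousOn h1
    exact ⟨y, hy⟩
  set Ψ := (hΘm.orderIsoOfSurjective Θ hsurj).symm with hΨ
  have hΨc : Continuous Ψ := Ψ.continuous
  have hΘΨ : ∀ t, Θ (Ψ t) = t := fun t => (hΘm.orderIsoOfSurjective Θ hsurj).apply_symm_apply t
  have hΨT : ∀ t, Ψ (t + T) = Ψ t + b := by
    intro t
    apply hΘm.injective
    rw [hΘΨ, hΘp, hΘΨ]
  obtain ⟨t, _, ht⟩ : ∃ t ∈ Set.uIcc (0:ℝ) (T/2), u (Ψ t) - u (Ψ (t + T/2)) = 0 := by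
    have hcont : ContinuousOn (fun t => u (Ψ t) - u (Ψ (t + T/2))) (Set.uIcc (0:ℝ) (T/2)) := by fun_prop
    have hi := intermediate_value_uIcc hcont
    have : (0:ℝ) ∈ Set.uIcc (u (Ψ 0) - u (Ψ (0 + T/2))) (u (Ψ (T/2)) - u (Ψ (T/2 + T/2))) := by
      rw [add_halves, zero_add, ← zero_add T, hΨT, hup, zero_add, Set.mem_uIcc]
      rcases le_total (u (Ψ 0)) (u (Ψ (T/2))) with h | h
      · left; constructor <;> linarith
      · right; constructor <;> linarith
    obtain ⟨t, ht1, ht2⟩ := hi this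
    exact ⟨t, ht1, ht2⟩
  set y0 := Ψ t with hy0
  set y1 := Ψ (t + T/2) with hy1
  have h01 : y0 ≤ y1 := Ψ.monotone (by linarith)
  have h2 : Ψ (t + T) = y0 + b := hΨT t
  have h12 : y1 ≤ y0 + b := by rw [← h2]; exact Ψ.monotone (by linarith)
  have hu01 : u y0 = u y1 := by linarith
  have hne : ∀ y, τ y ≠ 0 := fun y => (hτ0 y).ne'
  have a1 := arc_ineq h01 hτ hτ0 hΘ hκ hu hu' (by rw [hΘΨ, hΘΨ]; linarith) hu01
  have a2 := arc_ineq h12 hτ hτ0 hΘ hκ hu hu' (by rw [hΘp, hΘΨ, hΘΨ]; linarith) (by rw [hup]; exact hu01.symm)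
  have c1 : Continuous (fun y => τ y * (u y - u y0) ^ 2) := by fun_prop
  have c2 : Continuous (fun y => u' y ^ 2 / τ y) := by fun_prop (disch := exact hne _)
  have p1 : Function.Periodic (fun y => τ y * (u y - u y0) ^ 2) b := fun y => by simp only [hτp, hup]
  have p2 : Function.Periodic (fun y => u' y ^ 2 / τ y) b := fun y => by simp only [hτp, hu'p]
  refine ⟨u y0, ?_⟩
  have e1 := p1.intervalIntegral_add_eq 0 y0
  have e2 := p2.intervalIntegral_add_eq 0 y0
  rw [zero_add] at e1 e2
  rw [e1, e2, ← intervalIntegral.integral_add_adjacent_intervals (c1.intervalIntegrable y0 y1)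
    (c1.intervalIntegrable y1 _), ← intervalIntegral.integral_add_adjacent_intervals
    (c2.intervalIntegrable y0 y1) (c2.intervalIntegrable y1 _), mul_add]
  rw [← hu01] at a2
  exact add_le_add a1 a2

end DiracT

namespace DiracT
open Complex MeasureTheory Filter Topology

lemma slice_aux1 (F g c D : ℝ) (hD : D ≠ 0) :
    F * D * g ^ 2 - 2 * c * (F * g) + c ^ 2 * (F / D) = F * (D * g - c) ^ 2 / D := by
  field_simp
  ring

lemma slice_aux2 (F k r D K : ℝ) (hD : D ≠ 0) (hK : K ≠ 0) (hk : k ≠ 0) (eD : D = 1 - r * F)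
    (eK : K = 1 - r * k) : k / K - k ^ 2 / (2 * k * K ^ 2) + 1 / (2 * k * K ^ 2) * F ^ 2 - F / D
      = (F - k) ^ 2 * (1 - r * (F + 2 * k)) / (2 * k * K ^ 2 * D) := by
  field_simp
  rw [eD, eK]
  ring

lemma slice_aux3 (τ k r D K : ℝ) (hD : D ≠ 0) (hK : K ≠ 0) (eD : D = 1 - r * τ)
    (eK : K = 1 - r * k) : τ / D - (k / K + (τ - k) / K ^ 2)
      = (τ - k) ^ 2 * r / (D * K ^ 2) := by
  field_simp
  rw [eD, eK]
  ring

lemma slice_ineq {F : ℝ → ℝ} {g : ℝ → ℂ} {k r τ : ℝ} (hF : Continuous F) (hg : Continuous g)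
    (hr : 0 < r) (hk : 0 < k) (hrk : r * k < 1) (h0 : ∀ x, 0 < F x) (hle : ∀ x, r * (F x + 2 * k) ≤ 1)
    (hτ : τ = ((∫ x in (0:ℝ)..1, F x ^ 2) + k ^ 2) / (2 * k)) :
    ‖∫ x in (0:ℝ)..1, (F x : ℂ) * g x‖ ^ 2 / τ
      ≤ (∫ x in (0:ℝ)..1, F x * (1 - r * F x) * ‖g x‖ ^ 2)
        + r * ‖∫ x in (0:ℝ)..1, (F x : ℂ) * g x‖ ^ 2 := by
  have hd : ∀ x, 0 < 1 - r * F x := fun x => by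
    have := hle x; have : 0 < r * k := by positivity
    nlinarith
  have hdn : ∀ x, 1 - r * F x ≠ 0 := fun x => (hd x).ne'
  have hτ0 : 0 < τ := by
    rw [hτ]
    have : 0 ≤ ∫ x in (0:ℝ)..1, F x ^ 2 :=
      intervalIntegral.integral_nonneg zero_le_one fun x _ => by positivity
    positivity
  set X := ∫ x in (0:ℝ)..1, F x * ‖g x‖ with hX
  set S := ∫ x in (0:ℝ)..1, F x / (1 - r * F x) with hS
  set B := ∫ x in (0:ℝ)..1, F x * (1 - r * F x) * ‖g x‖ ^ 2 with hB
  set Y := ‖∫ x in (0:ℝ)..1, (F x : ℂ) * g x‖ with hY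
  have hYX : Y ≤ X := by
    rw [hY, hX]
    refine (intervalIntegral.norm_integral_le_integral_norm zero_le_one).trans (le_of_eq ?_)
    congr 1; ext x
    rw [norm_mul, norm_real, Real.norm_eq_abs, abs_of_pos (h0 x)]
  have hY0 : 0 ≤ Y := norm_nonneg _
  have hcS : Continuous (fun x => F x / (1 - r * F x)) := by fun_prop (disch := exact hdn _)
  have hS0 : 0 < S := intervalIntegral.intervalIntegral_pos_of_pos (hcS.intervalIntegrable _ _)
    (fun x => div_pos (h0 x) (hd x)) one_pos
  have hB0 : 0 ≤ B := intervalIntegral.integral_nonneg zero_le_one fun x _ => by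
    have := h0 x; have := hd x; positivity
  -- Cauchy-Schwarz
  have hCS : X ^ 2 ≤ B * S := by
    have h1 : 0 ≤ ∫ x in (0:ℝ)..1, (F x * (1 - r * F x) * ‖g x‖ ^ 2 - 2 * (X / S) * (F x * ‖g x‖)
        + (X / S) ^ 2 * (F x / (1 - r * F x))) := by
      apply intervalIntegral.integral_nonneg zero_le_one
      intro x _
      have hh : F x * (1 - r * F x) * ‖g x‖ ^ 2 - 2 * (X / S) * (F x * ‖g x‖)
        + (X / S) ^ 2 * (F x / (1 - r * F x))
        = F x * ((1 - r * F x) * ‖g x‖ - X / S) ^ 2 / (1 - r * F x) := slice_aux1 _ _ _ _ (hdn x)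
      rw [hh]
      have := h0 x; have := hd x; positivity
    have i1 : IntervalIntegrable (fun x => F x * (1 - r * F x) * ‖g x‖ ^ 2) volume 0 1 :=
      Continuous.intervalIntegrable (by fun_prop) _ _
    have i2 : IntervalIntegrable (fun x => 2 * (X / S) * (F x * ‖g x‖)) volume 0 1 :=
      Continuous.intervalIntegrable (by fun_prop) _ _
    rw [intervalIntegral.integral_add (i1.sub i2) ((hcS.intervalIntegrable _ _).const_mul _),
      intervalIntegral.integral_sub i1 i2, intervalIntegral.integral_const_mul,
      intervalIntegral.integral_const_mul, ← hB, ← hX, ← hS] at h1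
    have h2 : B - 2 * (X / S) * X + (X / S) ^ 2 * S = B - X ^ 2 / S := by field_simp; ring
    rw [h2, sub_nonneg, div_le_iff₀ hS0] at h1
    exact h1
  have hrk' : 0 < 1 - r * k := by linarith
  have hSle : S ≤ k / (1 - r * k) + (τ - k) / (1 - r * k) ^ 2 := by
    have h1 : S ≤ ∫ x in (0:ℝ)..1, (k / (1 - r * k) - k ^ 2 / (2 * k * (1 - r * k) ^ 2)
        + 1 / (2 * k * (1 - r * k) ^ 2) * F x ^ 2) := by
      apply intervalIntegral.integral_mono_on zero_le_one (hcS.intervalIntegrable _ _)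
        (Continuous.intervalIntegrable (by fun_prop) _ _)
      intro x _
      have hh : k / (1 - r * k) - k ^ 2 / (2 * k * (1 - r * k) ^ 2)
        + 1 / (2 * k * (1 - r * k) ^ 2) * F x ^ 2 - F x / (1 - r * F x)
        = (F x - k) ^ 2 * (1 - r * (F x + 2 * k)) / (2 * k * (1 - r * k) ^ 2 * (1 - r * F x)) :=
        slice_aux2 _ _ _ _ _ (hdn x) hrk'.ne' hk.ne' rfl rfl
      have h3 : 0 ≤ (F x - k) ^ 2 * (1 - r * (F x + 2 * k)) / (2 * k * (1 - r * k) ^ 2 * (1 - r * F x)) := by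
        have := hd x
        have h4 : 0 ≤ 1 - r * (F x + 2 * k) := by linarith [hle x]
        positivity
      linarith
    rw [intervalIntegral.integral_add (by simp) (Continuous.intervalIntegrable (by fun_prop) _ _),
      intervalIntegral.integral_const, intervalIntegral.integral_const_mul] at h1
    refine h1.trans (le_of_eq ?_)
    rw [hτ]
    simp only [sub_zero, one_smul]
    have := hrk'.ne'
    field_simp
    ring
  have hfin : Y ^ 2 * (1 - r * τ) ≤ B * τ := by
    by_cases hrt : r * τ < 1
    · have hrt' : 0 < 1 - r * τ := by linarith
      have h1 : S * (1 - r * τ) ≤ τ := by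
        have hh : τ / (1 - r * τ) - (k / (1 - r * k) + (τ - k) / (1 - r * k) ^ 2)
          = (τ - k) ^ 2 * r / ((1 - r * τ) * (1 - r * k) ^ 2) :=
          slice_aux3 _ _ _ _ _ hrt'.ne' hrk'.ne' rfl rfl
        have h3 : 0 ≤ (τ - k) ^ 2 * r / ((1 - r * τ) * (1 - r * k) ^ 2) := by positivity
        rw [← le_div_iff₀ hrt']
        linarith
      calc Y ^ 2 * (1 - r * τ) ≤ X ^ 2 * (1 - r * τ) := by gcongr
        _ ≤ B * S * (1 - r * τ) := by gcongr
        _ = B * (S * (1 - r * τ)) := by ring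
        _ ≤ B * τ := by gcongr
    · have : Y ^ 2 * (1 - r * τ) ≤ 0 := mul_nonpos_of_nonneg_of_nonpos (by positivity) (by linarith)
      have : 0 ≤ B * τ := by positivity
      linarith
  rw [div_le_iff₀ hτ0]
  nlinarith

lemma zero_mode {τ : ℝ → ℝ} {p1 p2 h1 h2 : ℝ → ℂ} {κ b : ℝ} (hb : 0 < b) (hτ : Continuous τ)
    (hτ0 : ∀ y, 0 < τ y) (hτp : ∀ y, τ (y + b) = τ y) (hκ : 0 < κ)
    (hlt : κ * (∫ y in (0:ℝ)..b, τ y) < 2 * Real.pi)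
    (d1 : ∀ y, HasDerivAt p1 (I * h2 y) y) (d2 : ∀ y, HasDerivAt p2 (I * h1 y) y)
    (c1 : Continuous h1) (c2 : Continuous h2) (q1 : ∀ y, p1 (y + b) = p1 y)
    (q2 : ∀ y, p2 (y + b) = p2 y) (q4 : ∀ y, h2 (y + b) = h2 y) :
    2 * (∫ y in (0:ℝ)..b, (starRingEnd ℂ) (p1 y) * h1 y).re
      ≤ 1 / κ * ∫ y in (0:ℝ)..b, (‖h1 y‖ ^ 2 + ‖h2 y‖ ^ 2) / τ y := by
  have hre : ∀ y, HasDerivAt (fun y => (p1 y).re) (-(h2 y).im) y := fun y => by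
    have := reCLM.hasFDerivAt.comp_hasDerivAt y (d1 y)
    refine HasDerivAt.congr_deriv (f := fun y => (p1 y).re) this ?_
    simp
  have him : ∀ y, HasDerivAt (fun y => (p1 y).im) ((h2 y).re) y := fun y => by
    have := imCLM.hasFDerivAt.comp_hasDerivAt y (d1 y)
    refine HasDerivAt.congr_deriv (f := fun y => (p1 y).im) this ?_
    simp
  obtain ⟨cr, hcr⟩ := wirtinger hb hτ hτ0 hτp hκ hre (by fun_prop) (fun y => by rw [q1]) (fun y => by simp only [q4]) hlt
  obtain ⟨ci, hci⟩ := wirtinger hb hτ hτ0 hτp hκ him (by fun_prop) (fun y => by rw [q1]) (fun y => by simp only [q4]) hlt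
  have hp1c : Continuous p1 := continuous_iff_continuousAt.2 fun y => (d1 y).continuousAt
  have hne : ∀ y, τ y ≠ 0 := fun y => (hτ0 y).ne'
  set C : ℂ := ⟨cr, ci⟩ with hC
  have hint0 : ∫ y in (0:ℝ)..b, h1 y = 0 := by
    have : ∫ y in (0:ℝ)..b, I * h1 y = p2 b - p2 0 :=
      intervalIntegral.integral_eq_sub_of_hasDerivAt (fun y _ => d2 y)
        (Continuous.intervalIntegrable (by fun_prop) _ _)
    rw [← zero_add b, q2, zero_add, sub_self, intervalIntegral.integral_const_mul] at this
    exact (mul_eq_zero.1 this).resolve_left I_ne_zero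
  have hQ : ∫ y in (0:ℝ)..b, (starRingEnd ℂ) (p1 y) * h1 y
      = ∫ y in (0:ℝ)..b, (starRingEnd ℂ) (p1 y - C) * h1 y := by
    simp only [map_sub, sub_mul]
    rw [intervalIntegral.integral_sub (Continuous.intervalIntegrable (by fun_prop) _ _)
      (Continuous.intervalIntegrable (by fun_prop) _ _), intervalIntegral.integral_const_mul, hint0]
    simp
  have hW : κ ^ 2 * ∫ y in (0:ℝ)..b, τ y * ‖p1 y - C‖ ^ 2 ≤ ∫ y in (0:ℝ)..b, ‖h2 y‖ ^ 2 / τ y := by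
    have e1 : ∀ y, τ y * ‖p1 y - C‖ ^ 2 = τ y * ((p1 y).re - cr) ^ 2 + τ y * ((p1 y).im - ci) ^ 2 := fun y => by
      rw [← Complex.normSq_eq_norm_sq, Complex.normSq_apply]; simp [hC]; ring
    have e2 : ∀ y, ‖h2 y‖ ^ 2 / τ y = (-(h2 y).im) ^ 2 / τ y + (h2 y).re ^ 2 / τ y := fun y => by
      rw [← Complex.normSq_eq_norm_sq, Complex.normSq_apply]; ring
    simp only [e1, e2]
    rw [intervalIntegral.integral_add (Continuous.intervalIntegrable (by fun_prop) _ _)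
      (Continuous.intervalIntegrable (by fun_prop) _ _),
      intervalIntegral.integral_add (Continuous.intervalIntegrable (by fun_prop (disch := exact hne _)) _ _)
      (Continuous.intervalIntegrable (by fun_prop (disch := exact hne _)) _ _), mul_add]
    exact add_le_add hcr hci
  have hAM : 2 * (∫ y in (0:ℝ)..b, (starRingEnd ℂ) (p1 y - C) * h1 y).re
      ≤ κ * (∫ y in (0:ℝ)..b, τ y * ‖p1 y - C‖ ^ 2) + 1 / κ * ∫ y in (0:ℝ)..b, ‖h1 y‖ ^ 2 / τ y := by
    have h1' := (Complex.re_le_norm _).trans (intervalIntegral.norm_integral_le_integral_norm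
      (f := fun y => (starRingEnd ℂ) (p1 y - C) * h1 y) (μ := volume) hb.le)
    have h2' : 2 * ∫ y in (0:ℝ)..b, ‖(starRingEnd ℂ) (p1 y - C) * h1 y‖
        ≤ ∫ y in (0:ℝ)..b, (κ * (τ y * ‖p1 y - C‖ ^ 2) + 1 / κ * (‖h1 y‖ ^ 2 / τ y)) := by
      rw [← intervalIntegral.integral_const_mul]
      apply intervalIntegral.integral_mono_on hb.le (Continuous.intervalIntegrable (by fun_prop) _ _)
        (Continuous.intervalIntegrable (by fun_prop (disch := exact hne _)) _ _)
      intro y _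
      rw [norm_mul, RCLike.norm_conj]
      have hh : κ * (τ y * ‖p1 y - C‖ ^ 2) + 1 / κ * (‖h1 y‖ ^ 2 / τ y) - 2 * (‖p1 y - C‖ * ‖h1 y‖)
        = (κ * τ y * ‖p1 y - C‖ - ‖h1 y‖) ^ 2 / (κ * τ y) := by
        have := hne y
        field_simp
        ring
      have := hτ0 y
      have : 0 ≤ (κ * τ y * ‖p1 y - C‖ - ‖h1 y‖) ^ 2 / (κ * τ y) := by positivity
      linarith
    rw [intervalIntegral.integral_add (Continuous.intervalIntegrable (by fun_prop) _ _)
      (Continuous.intervalIntegrable (by fun_prop (disch := exact hne _)) _ _),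
      intervalIntegral.integral_const_mul, intervalIntegral.integral_const_mul] at h2'
    linarith
  have hsplit : ∫ y in (0:ℝ)..b, (‖h1 y‖ ^ 2 + ‖h2 y‖ ^ 2) / τ y
      = (∫ y in (0:ℝ)..b, ‖h1 y‖ ^ 2 / τ y) + ∫ y in (0:ℝ)..b, ‖h2 y‖ ^ 2 / τ y := by
    simp only [add_div]
    rw [intervalIntegral.integral_add (Continuous.intervalIntegrable (by fun_prop (disch := exact hne _)) _ _)
      (Continuous.intervalIntegrable (by fun_prop (disch := exact hne _)) _ _)]
  rw [hQ, hsplit, mul_add]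
  have : κ * (∫ y in (0:ℝ)..b, τ y * ‖p1 y - C‖ ^ 2) ≤ 1 / κ * ∫ y in (0:ℝ)..b, ‖h2 y‖ ^ 2 / τ y := by
    rw [one_div, le_inv_mul_iff₀ hκ]
    linarith
  linarith

end DiracT

namespace DiracT
open Complex MeasureTheory Filter Topology

noncomputable def z0 (c : ℤ × ℤ → ℂ) : ℤ × ℤ → ℂ := fun k => if k.1 = 0 then c k else 0

lemma RD.z0 {c : ℤ × ℤ → ℂ} (hc : RD c) : RD (z0 c) := hc.of_le fun k => by
  unfold DiracT.z0; split_ifs <;> simp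

lemma ev_z0_x (a b : ℝ) (c : ℤ × ℤ → ℂ) (x y : ℝ) : ev a b (z0 c) (x, y) = ev a b (z0 c) (0, y) := by
  unfold ev
  congr 1; ext k
  unfold z0 ee
  split_ifs with h
  · simp [h]
  · simp

lemma z0_mul (m c : ℤ × ℤ → ℂ) : (fun k => m k * z0 c k) = z0 (fun k => m k * c k) := by
  ext k; unfold z0; split_ifs <;> simp

lemma parseval_z0 {a b : ℝ} (hb : 0 < b) {c d : ℤ × ℤ → ℂ} (hc : RD c) (hd : RD d) :
    ∫ y in (0:ℝ)..b, (starRingEnd ℂ) (ev a b (z0 c) (0, y)) * ev a b (z0 d) (0, y)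
      = b * ∑' k, (starRingEnd ℂ) (z0 c k) * z0 d k := by
  rw [← parseval (a := a) hb hc.z0 hd.z0, integral_muT_yx _ hb.le]
  · congr 1; ext y
    simp only [ev_z0_x a b _ _ y]
    simp
  · have := (contDiff_ev a b hc.z0).continuous
    have := (contDiff_ev a b hd.z0).continuous
    fun_prop

lemma parseval_norm_z0 {a b : ℝ} (hb : 0 < b) {c : ℤ × ℤ → ℂ} (hc : RD c) :
    ∫ y in (0:ℝ)..b, ‖ev a b (z0 c) (0, y)‖ ^ 2 = b * ∑' k, ‖z0 c k‖ ^ 2 := by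
  rw [← parseval_norm (a := a) hb hc.z0, integral_muT_yx _ hb.le]
  · congr 1; ext y
    simp only [ev_z0_x a b _ _ y]
    simp
  · have := (contDiff_ev a b hc.z0).continuous
    fun_prop

lemma ev_z0_per {a b : ℝ} (hb : b ≠ 0) (c : ℤ × ℤ → ℂ) (y : ℝ) :
    ev a b (z0 c) (0, y + b) = ev a b (z0 c) (0, y) := by
  have := ev_per2 a b hb (z0 c) (0, y)
  rw [← this, ev_z0_x a b c (_ + a)]

lemma ev_z0_deriv (a b : ℝ) {c : ℤ × ℤ → ℂ} (hc : RD c) (y : ℝ) :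
    HasDerivAt (fun y => ev a b (z0 c) (0, y)) (ev a b (z0 (fun k => sy a b k * c k)) (0, y)) y := by
  have h1 := hasDerivAt_y ((contDiff_ev a b hc.z0).differentiable (by simp)) 0 y
  rw [(hasFDerivAt_ev hc.z0 a b (0, y)).fderiv] at h1
  simpa [z0_mul] using h1

lemma RD.summable_conj_mul {c d : ℤ × ℤ → ℂ} (hc : RD c) (hd : RD d) :
    Summable fun k => (starRingEnd ℂ) (c k) * d k := by
  refine Summable.of_norm_bounded (hc.summable_sq.add hd.summable_sq) fun k => ?_
  rw [norm_mul, RCLike.norm_conj]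
  nlinarith [sq_nonneg (‖c k‖ - ‖d k‖), sq_nonneg (‖c k‖), sq_nonneg (‖d k‖)]

/-- the quadratic form restricted to the modes -/
noncomputable def qf (a b r : ℝ) (c d : ℤ × ℤ → ℂ) : ℝ :=
  2 * ((b : ℂ) * ∑' k, (starRingEnd ℂ) (c k) * (sg a b k * d k)).re
   - r * (b * (∑' k, ‖sg a b k * d k‖ ^ 2) + b * ∑' k, ‖(starRingEnd ℂ) (sg a b k) * c k‖ ^ 2)

lemma qf_eq {a b : ℝ} (r : ℝ) {c d : ℤ × ℤ → ℂ} (hc : RD c) (hd : RD d) :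
    qf a b r c d = b * ∑' k, (2 * ((starRingEnd ℂ) (c k) * (sg a b k * d k)).re
      - r * (‖sg a b k * d k‖ ^ 2 + ‖(starRingEnd ℂ) (sg a b k) * c k‖ ^ 2)) := by
  have s1 := (hasSum_re (hc.summable_conj_mul (hd.sg a b)).hasSum)
  have s2 := (hd.sg a b).summable_sq
  have s3 := (hc.csg a b).summable_sq
  rw [Summable.tsum_sub (s1.summable.mul_left 2) ((s2.add s3).mul_left r), tsum_mul_left, tsum_mul_left,
    s2.tsum_add s3, s1.tsum_eq]
  unfold qf
  rw [re_ofReal_mul]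
  ring

lemma qf_le {a b r : ℝ} (hb : 0 < b) (hr : r = 1 / (2 * Real.pi)) {c d : ℤ × ℤ → ℂ} (hc : RD c) (hd : RD d) :
    qf a b r c d ≤ qf a b r (z0 c) (z0 d) := by
  rw [qf_eq r hc hd, qf_eq r hc.z0 hd.z0]
  refine mul_le_mul_of_nonneg_left ?_ hb.le
  have key : ∀ {c d : ℤ × ℤ → ℂ}, RD c → RD d → Summable fun k => (2 * ((starRingEnd ℂ) (c k) * (sg a b k * d k)).re
      - r * (‖sg a b k * d k‖ ^ 2 + ‖(starRingEnd ℂ) (sg a b k) * c k‖ ^ 2)) := by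
    intro c d hc hd
    have s1 := (hasSum_re (hc.summable_conj_mul (hd.sg a b)).hasSum)
    exact (s1.summable.mul_left 2).sub (((hd.sg a b).summable_sq.add (hc.csg a b).summable_sq).mul_left r)
  refine Summable.tsum_le_tsum (fun k => ?_) (key hc hd) (key hc.z0 hd.z0)
  unfold z0
  split_ifs with h
  · exact le_rfl
  · simp only [mul_zero, norm_zero, map_zero, zero_re]
    have h1 : 2 * Real.pi ≤ ‖sg a b k‖ := by
      have := abs_im_le_norm (sg a b k)
      rw [sg_im, abs_mul, abs_of_pos Real.two_pi_pos] at this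
      have h2 : (1:ℝ) ≤ |(k.1 : ℝ)| := by exact_mod_cast Int.one_le_abs h
      nlinarith [Real.two_pi_pos]
    have h3 : ((starRingEnd ℂ) (c k) * (sg a b k * d k)).re ≤ ‖c k‖ * (‖sg a b k‖ * ‖d k‖) := by
      refine (re_le_norm _).trans ?_
      rw [norm_mul, norm_mul, RCLike.norm_conj]
    rw [norm_mul, norm_mul, RCLike.norm_conj]
    have hr0 : 0 < r := by rw [hr]; have := Real.pi_pos; positivity
    have h4 : 1 ≤ r * ‖sg a b k‖ := by
      rw [hr, one_div, inv_mul_eq_div, le_div_iff₀ Real.two_pi_pos]; linarith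
    have h5 : 0 ≤ ‖sg a b k‖ * (‖c k‖ * ‖d k‖) := by positivity
    nlinarith [mul_le_mul_of_nonneg_right h4 h5, mul_nonneg hr0.le (mul_nonneg (sq_nonneg ‖sg a b k‖) (sq_nonneg (‖c k‖ - ‖d k‖)))]

set_option maxHeartbeats 1000000 in
lemma linear_lemma {a b : ℝ} (hb : 2 * Real.pi < b) {f : ℝ × ℝ → ℝ} (hf : SP a b f) (hf0 : ∀ p, 0 < f p)
    (hle : ∀ p, f p ≤ 2 * Real.pi - 2 * (2 * Real.pi / b)) {φ₁ φ₂ : ℝ × ℝ → ℂ} (hs : Sol a b f φ₁ φ₂)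
    (hE : ∫ p, f p ^ 2 ∂(muT b) < 4 * Real.pi ^ 2 / b) : ∀ p, φ₁ p = 0 ∧ φ₂ p = 0 := by
  have hpi := Real.pi_pos
  have hb0 : 0 < b := by linarith
  obtain ⟨k, hk⟩ : ∃ k, k = 2 * Real.pi / b := ⟨_, rfl⟩
  obtain ⟨r, hr⟩ : ∃ r, r = 1 / (2 * Real.pi) := ⟨_, rfl⟩
  have hk0 : 0 < k := by rw [hk]; positivity
  have hr0 : 0 < r := by rw [hr]; positivity
  have hrk : r * k < 1 := by
    have h3 : r * k = 1 / b := by rw [hr, hk]; field_simp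
    rw [h3, div_lt_one hb0]
    linarith [Real.pi_gt_three]
  have hrle : ∀ p, r * (f p + 2 * k) ≤ 1 := fun p => by
    rw [hr, one_div, inv_mul_eq_div, div_le_one (by positivity)]
    rw [hk]; linarith [hle p]
  have hfr : ∀ p, 0 < 1 - r * f p := fun p => by
    have := hrle p; have : 0 < r * k := by positivity
    nlinarith
  obtain ⟨c, d, hc, hd, hc', hd', e1, e2⟩ := hs.coeff hb0
  have cf := hf.cont
  have c1 := hs.s1.cont
  have c2 := hs.s2.cont
  -- zero modes
  set p1 : ℝ → ℂ := fun y => ev a b (z0 c) (0, y) with hp1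
  set p2 : ℝ → ℂ := fun y => ev a b (z0 d) (0, y) with hp2
  set h1 : ℝ → ℂ := fun y => ev a b (z0 (fun k => sg a b k * d k)) (0, y) with hh1
  set h2 : ℝ → ℂ := fun y => ev a b (z0 (fun k => (starRingEnd ℂ) (sg a b k) * c k)) (0, y) with hh2
  set τ : ℝ → ℝ := fun y => ((∫ x in (0:ℝ)..1, f (x, y) ^ 2) + k ^ 2) / (2 * k) with hτ
  have ch1 : Continuous h1 := (contDiff_ev a b (hd.sg a b).z0).continuous.comp (by fun_prop)
  have ch2 : Continuous h2 := (contDiff_ev a b (hc.csg a b).z0).continuous.comp (by fun_prop)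
  have hcI : Continuous fun y => ∫ x in (0:ℝ)..1, f (x, y) ^ 2 :=
    intervalIntegral.continuous_parametric_intervalIntegral_of_continuous' (by fun_prop) 0 1
  have cτ : Continuous τ := by
    have : 2 * k ≠ 0 := by positivity
    simp only [hτ]; fun_prop
  have τ0 : ∀ y, 0 < τ y := fun y => by
    have : 0 ≤ ∫ x in (0:ℝ)..1, f (x, y) ^ 2 :=
      intervalIntegral.integral_nonneg zero_le_one fun x _ => by positivity
    simp only [hτ]; positivity
  have τp : ∀ y, τ (y + b) = τ y := fun y => by
    simp only [hτ]
    congr 2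
    have hper : Function.Periodic (fun x => f (x, y) ^ 2) 1 := fun x => by
      have := hf.p1 (x, y); simp only at this ⊢; rw [this]
    have h3 : ∀ x, f (x, y + b) ^ 2 = (fun x => f (x, y) ^ 2) (x - a) := fun x => by
      have := hf.p2 (x - a, y); simp only [sub_add_cancel] at this; simp only [this]
    simp only [h3]
    rw [intervalIntegral.integral_comp_sub_right (fun x => f (x, y) ^ 2)]
    have := hper.intervalIntegral_add_eq (-a) 0
    rw [zero_add] at this
    rw [← this]
    congr 1 <;> ring
  have hT : ∫ y in (0:ℝ)..b, τ y = ((∫ p, f p ^ 2 ∂(muT b)) + b * k ^ 2) / (2 * k) := by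
    simp only [hτ]
    rw [intervalIntegral.integral_div, intervalIntegral.integral_add (hcI.intervalIntegrable _ _) (by simp),
      integral_muT_yx (by fun_prop) hb0.le]
    simp
  set T := ∫ y in (0:ℝ)..b, τ y with hTdef
  have hT0 : 0 < T := intervalIntegral.intervalIntegral_pos_of_pos (cτ.intervalIntegrable _ _) τ0 hb0
  have hT2 : T < 2 * Real.pi := by
    rw [hT, div_lt_iff₀ (by positivity)]
    have h3 : b * k ^ 2 = 4 * Real.pi ^ 2 / b := by rw [hk]; field_simp; ring
    have h4 : 2 * Real.pi * (2 * k) = 2 * (4 * Real.pi ^ 2 / b) := by rw [hk]; field_simp; ring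
    rw [h3, h4]; linarith
  obtain ⟨κ, hκ1, hκ2⟩ : ∃ κ : ℝ, 1 < κ ∧ κ * T < 2 * Real.pi := by
    have h3 : 1 < 2 * Real.pi / T := by rw [lt_div_iff₀ hT0]; linarith
    obtain ⟨κ, h4, h5⟩ := exists_between h3
    exact ⟨κ, h4, by rwa [lt_div_iff₀ hT0] at h5⟩
  have hκ0 : 0 < κ := by linarith
  have d1 : ∀ y, HasDerivAt p1 (I * h2 y) y := fun y => by
    refine (ev_z0_deriv a b hc y).congr_deriv ?_
    rw [hh2]
    simp only
    rw [← ev_const_mul]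
    congr 1
    ext j
    unfold z0
    split_ifs with h
    · beta_reduce
      rw [conj_sg]
      have : sx j = 0 := by simp [sx, h]
      rw [this]
      linear_combination (sy a b j * c j) * I_mul_I
    · simp
  have d2 : ∀ y, HasDerivAt p2 (I * h1 y) y := fun y => by
    refine (ev_z0_deriv a b hd y).congr_deriv ?_
    rw [hh1]
    simp only
    rw [← ev_const_mul]
    congr 1
    ext j
    unfold z0
    split_ifs with h
    · have : sx j = 0 := by simp [sx, h]
      beta_reduce
      unfold sg
      rw [this]
      linear_combination (sy a b j * d j) * I_mul_I
    · simp
  have hQ := zero_mode hb0 cτ τ0 τp hκ0 hκ2 d1 d2 ch1 ch2 (fun y => ev_z0_per hb0.ne' _ y)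
    (fun y => ev_z0_per hb0.ne' _ y) (fun y => ev_z0_per hb0.ne' _ y)
  set Q0 := 2 * (∫ y in (0:ℝ)..b, (starRingEnd ℂ) (p1 y) * h1 y).re with hQ0
  set Z := ∫ y in (0:ℝ)..b, (‖h1 y‖ ^ 2 + ‖h2 y‖ ^ 2) / τ y with hZ
  set N := ∫ y in (0:ℝ)..b, (‖h1 y‖ ^ 2 + ‖h2 y‖ ^ 2) with hN
  set P := ∫ p, f p * (1 - r * f p) * (‖φ₁ p‖ ^ 2 + ‖φ₂ p‖ ^ 2) ∂(muT b) with hP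
  have hZ0 : 0 ≤ Z := intervalIntegral.integral_nonneg hb0.le fun y _ => by
    have := τ0 y; positivity
  have hN0 : 0 ≤ N := intervalIntegral.integral_nonneg hb0.le fun y _ => by positivity
  -- slices
  have hh1' : ∀ y, h1 y = ∫ x in (0:ℝ)..1, (f (x, y) : ℂ) * φ₁ (x, y) := fun y => by
    rw [hh1]
    simp only
    unfold z0
    rw [← integral_ev_x (hd.sg a b) y]
    simp only [e1]
  have hh2' : ∀ y, h2 y = ∫ x in (0:ℝ)..1, (f (x, y) : ℂ) * φ₂ (x, y) := fun y => by
    rw [hh2]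
    simp only
    unfold z0
    rw [← integral_ev_x (hc.csg a b) y]
    simp only [e2]
  have hcP : Continuous fun y => ∫ x in (0:ℝ)..1, f (x, y) * (1 - r * f (x, y)) * (‖φ₁ (x, y)‖ ^ 2 + ‖φ₂ (x, y)‖ ^ 2) :=
    intervalIntegral.continuous_parametric_intervalIntegral_of_continuous' (by fun_prop) 0 1
  have hτne : ∀ y, τ y ≠ 0 := fun y => (τ0 y).ne'
  have hsl : Z ≤ P + r * N := by
    rw [hP, integral_muT_yx (by fun_prop) hb0.le, hN, ← intervalIntegral.integral_const_mul,
      ← intervalIntegral.integral_add (hcP.intervalIntegrable _ _) (Continuous.intervalIntegrable (by fun_prop) _ _)]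
    apply intervalIntegral.integral_mono_on hb0.le
      (Continuous.intervalIntegrable (by fun_prop (disch := exact hτne)) _ _)
      (Continuous.intervalIntegrable (by fun_prop) _ _)
    intro y _
    have s1 := slice_ineq (F := fun x => f (x, y)) (g := fun x => φ₁ (x, y)) (by fun_prop) (by fun_prop) hr0 hk0 hrk
      (fun x => hf0 _) (fun x => hrle _) (rfl : τ y = _)
    have s2 := slice_ineq (F := fun x => f (x, y)) (g := fun x => φ₂ (x, y)) (by fun_prop) (by fun_prop) hr0 hk0 hrk
      (fun x => hf0 _) (fun x => hrle _) (rfl : τ y = _)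
    rw [← hh1'] at s1
    rw [← hh2'] at s2
    simp only [mul_add]
    rw [add_div, intervalIntegral.integral_add (Continuous.intervalIntegrable (by fun_prop) _ _)
      (Continuous.intervalIntegrable (by fun_prop) _ _)]
    linarith
  have hPq : P = qf a b r c d := by
    unfold qf
    rw [← parseval (a := a) hb0 hc (hd.sg a b), ← parseval_norm (a := a) hb0 (hd.sg a b), ← parseval_norm (a := a) hb0 (hc.csg a b)]
    simp only [hc', hd', e1, e2]
    have h5 : ∀ p, (starRingEnd ℂ) (φ₁ p) * ((f p : ℂ) * φ₁ p) = ((f p * ‖φ₁ p‖ ^ 2 : ℝ) : ℂ) := fun p => by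
      rw [mul_left_comm, conj_mul_self, ofReal_mul]
    simp only [h5]
    rw [integral_complex_ofReal, ofReal_re]
    have h6 := hs.int_eq hb0
    have h7 : 2 * ∫ p, f p * ‖φ₁ p‖ ^ 2 ∂(muT b) = (∫ p, f p * ‖φ₁ p‖ ^ 2 ∂(muT b)) + ∫ p, f p * ‖φ₂ p‖ ^ 2 ∂(muT b) := by
      rw [← h6]; ring
    have I1 := integrable_muT (g := fun p => f p * ‖φ₁ p‖ ^ 2) (by fun_prop) b
    have I2 := integrable_muT (g := fun p => f p * ‖φ₂ p‖ ^ 2) (by fun_prop) b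
    have I3 := integrable_muT (g := fun p => ‖(f p : ℂ) * φ₁ p‖ ^ 2) (by fun_prop) b
    have I4 := integrable_muT (g := fun p => ‖(f p : ℂ) * φ₂ p‖ ^ 2) (by fun_prop) b
    rw [h7, ← integral_add I1 I2, ← integral_add I3 I4, ← integral_const_mul, ← integral_sub (by exact I1.add I2) (by exact (I3.add I4).const_mul r), hP]
    congr 1; ext p
    rw [norm_mul, norm_mul, norm_real, mul_pow, mul_pow, Real.norm_eq_abs, sq_abs]
    ring
  have hq0 : qf a b r (z0 c) (z0 d) = Q0 - r * N := by
    unfold qf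
    have z1 := z0_mul (sg a b) d
    have z2 := z0_mul (fun k => (starRingEnd ℂ) (sg a b k)) c
    have z1' := fun k => congrFun z1 k
    have z2' := fun k => congrFun z2 k
    simp only [z1', z2']
    rw [← parseval_z0 (a := a) hb0 hc (hd.sg a b), ← parseval_norm_z0 (a := a) hb0 (hd.sg a b), ← parseval_norm_z0 (a := a) hb0 (hc.csg a b),
      ← intervalIntegral.integral_add (Continuous.intervalIntegrable (by exact ch1.norm.pow 2) _ _)
      (Continuous.intervalIntegrable (by exact ch2.norm.pow 2) _ _)]
  have hqle := qf_le (a := a) hb0 hr hc hd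
  have hZQ : Z ≤ Q0 := by linarith
  have hZ' : Z ≤ 0 := by
    have : Z ≤ 1 / κ * Z := hZQ.trans hQ
    rw [one_div, inv_mul_eq_div, le_div_iff₀ hκ0] at this
    nlinarith
  have hZe : Z = 0 := le_antisymm hZ' hZ0
  have hP0 : P ≤ 0 := by
    rw [hZe] at hQ
    have : 0 ≤ r * N := by positivity
    linarith
  have hnn : ∀ p, 0 ≤ f p * (1 - r * f p) * (‖φ₁ p‖ ^ 2 + ‖φ₂ p‖ ^ 2) := fun p => by
    have := hf0 p; have := hfr p; positivity
  have hPz : P = 0 := le_antisymm hP0 (integral_nonneg hnn)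
  intro p
  have h3 := integral_pos_of (a := a) hb0 (by fun_prop) hnn (fun p => by simp only [hf.p1, hs.s1.p1, hs.s2.p1])
    (fun p => by simp only [hf.p2, hs.s1.p2, hs.s2.p2]) hPz p
  have h4 : ‖φ₁ p‖ ^ 2 + ‖φ₂ p‖ ^ 2 = 0 :=
    (mul_eq_zero.1 h3).resolve_left (mul_pos (hf0 p) (hfr p)).ne'
  constructor
  · have : ‖φ₁ p‖ ^ 2 = 0 := by have := sq_nonneg ‖φ₁ p‖; have := sq_nonneg ‖φ₂ p‖; linarith
    simpa using this
  · have : ‖φ₂ p‖ ^ 2 = 0 := by have := sq_nonneg ‖φ₁ p‖; have := sq_nonneg ‖φ₂ p‖; linarith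
    simpa using this

end DiracT

namespace DiracT
open MeasureTheory Filter Topology

lemma log_aux : (0.916 : ℝ) ≤ Real.log 2.5 := by
  rw [Real.le_log_iff_exp_le (by norm_num)]
  refine (Real.exp_bound' (by norm_num) (by norm_num) (n := 9) (by norm_num)).trans ?_
  simp only [Finset.sum_range_succ, Finset.sum_range_zero, Nat.factorial]
  norm_num

lemma exp_aux : Real.exp 0.193184 ≤ 1.2149 := by
  refine (Real.exp_bound' (by norm_num) (by norm_num) (n := 6) (by norm_num)).trans ?_
  simp only [Finset.sum_range_succ, Finset.sum_range_zero, Nat.factorial]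
  norm_num

lemma sup_bound {V a J : ℝ → ℝ} {F ε : ℝ} (hF : 0 < F) (hε : ε ≤ 0.01)
    (da : ∀ r, 0 < r → HasDerivAt a (r * V r) r) (dJ : ∀ r, 0 < r → HasDerivAt J (a r / r) r)
    (a0 : ∀ r, 0 < r → 0 ≤ a r) (a1 : ∀ r, 0 < r → a r ≤ F ^ 2 * r ^ 2 / 2)
    (J0 : ∀ r, 0 < r → 0 ≤ J r) (J1 : ∀ r, 0 < r → J r ≤ F ^ 2 * r ^ 2 / 4)
    (hV : ∀ r, 0 < r → r ≤ 1 / 2 → (F * Real.exp (-ε)) ^ 2 * Real.exp (-(2 * J r)) ≤ V r)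
    (ha : a (1 / 2) < 1) : F ≤ 4.28 := by
  by_contra! hcon
  set Ft := F * Real.exp (-ε) with hFt
  have hFt0 : 0 < Ft := by positivity
  have hV0 : ∀ r, 0 < r → r ≤ 1 / 2 → 0 ≤ V r := fun r h1 h2 => le_trans (by positivity) (hV r h1 h2)
  have hlt : ∀ r, 0 < r → r ≤ 1 / 2 → a r < 1 := by
    intro r h1 h2
    have hm : MonotoneOn a (Set.Icc r (1 / 2)) := by
      apply monotoneOn_of_deriv_nonneg (convex_Icc _ _)
      · exact fun x hx => (da x (h1.trans_le hx.1)).continuousAt.continuousWithinAt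
      · exact fun x hx => (da x (h1.trans_le (interior_subset hx).1)).differentiableAt.differentiableWithinAt
      · intro x hx
        have hx' := interior_subset hx
        rw [(da x (h1.trans_le hx'.1)).deriv]
        exact mul_nonneg (h1.trans_le hx'.1).le (hV0 x (h1.trans_le hx'.1) hx'.2)
    exact (hm ⟨le_rfl, h2⟩ ⟨h2, le_rfl⟩ h2).trans_lt ha
  set z : ℝ → ℝ := fun r => Ft * r * Real.exp (-J r) with hz
  have dz : ∀ r, 0 < r → HasDerivAt z (z r * (1 - a r) / r) r := by
    intro r hr
    have h1 := (((hasDerivAt_id r).const_mul Ft)).mul (dJ r hr).neg.exp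
    refine h1.congr_deriv ?_
    simp only [hz, id, Pi.neg_apply]
    field_simp
    ring
  set e : ℝ → ℝ := fun r => (1 - a r) ^ 2 + z r ^ 2 with he
  have de : ∀ r, 0 < r → HasDerivAt e (2 * (1 - a r) * (z r ^ 2 - r ^ 2 * V r) / r) r := by
    intro r hr
    have h1 := (((da r hr).const_sub 1).pow 2).add ((dz r hr).pow 2)
    refine h1.congr_deriv ?_
    simp
    field_simp
    ring
  have hzV : ∀ r, 0 < r → r ≤ 1 / 2 → z r ^ 2 ≤ r ^ 2 * V r := by
    intro r h1 h2
    have h3 := hV r h1 h2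
    have h4 : z r ^ 2 = r ^ 2 * (Ft ^ 2 * Real.exp (-(2 * J r))) := by
      have : Real.exp (-(2 * J r)) = Real.exp (-J r) ^ 2 := by
        rw [← Real.exp_nat_mul]; congr 1; push_cast; ring
      rw [this]; simp only [hz]; ring
    rw [h4]; gcongr
  have hean : AntitoneOn e (Set.Ioc 0 (1 / 2)) := by
    apply antitoneOn_of_deriv_nonpos (convex_Ioc _ _)
    · exact fun x hx => (de x hx.1).continuousAt.continuousWithinAt
    · exact fun x hx => (de x (interior_subset hx).1).differentiableAt.differentiableWithinAt
    · intro x hx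
      have hx' := interior_subset hx
      rw [(de x hx'.1).deriv]
      apply div_nonpos_of_nonpos_of_nonneg _ hx'.1.le
      exact mul_nonpos_of_nonneg_of_nonpos (by linarith [hlt x hx'.1 hx'.2]) (by linarith [hzV x hx'.1 hx'.2])
  have he1 : ∀ r, 0 < r → r ≤ 1 / 2 → e r ≤ 1 := by
    intro r h1 h2
    have hb : ∀ᶠ s in 𝓝[>] (0:ℝ), e r ≤ 1 + Ft ^ 2 * s ^ 2 := by
      have : Set.Ioo 0 r ∈ 𝓝[>] (0:ℝ) := Ioo_mem_nhdsGT h1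
      filter_upwards [this] with s hs
      have h3 := hean ⟨hs.1, hs.2.le.trans h2⟩ ⟨h1, h2⟩ hs.2.le
      have h4 := a0 s hs.1
      have h5 := hlt s hs.1 (hs.2.le.trans h2)
      have h6 : Real.exp (-J s) ≤ 1 := Real.exp_le_one_iff.2 (by linarith [J0 s hs.1])
      have h7 : z s ≤ Ft * s := by
        have : Ft * s * Real.exp (-J s) ≤ Ft * s * 1 := by
          have := hs.1
          gcongr
        simpa using this
      have h8 : 0 ≤ z s := by have := hs.1; positivity
      have h9 : z s ^ 2 ≤ (Ft * s) ^ 2 := by gcongr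
      have h10 : (1 - a s) ^ 2 ≤ 1 := by nlinarith
      have : e s = (1 - a s) ^ 2 + z s ^ 2 := rfl
      rw [mul_pow] at h9
      linarith
    have ht : Tendsto (fun s : ℝ => 1 + Ft ^ 2 * s ^ 2) (𝓝[>] 0) (𝓝 (1 + Ft ^ 2 * 0 ^ 2)) :=
      (Continuous.tendsto (by fun_prop) 0).mono_left nhdsWithin_le_nhds
    have := ge_of_tendsto ht hb
    simpa using this
  -- choose radii
  obtain ⟨R, hR⟩ : ∃ R, R = 2.14 / F := ⟨_, rfl⟩
  obtain ⟨r1, hr1⟩ : ∃ R, R = 0.856 / F := ⟨_, rfl⟩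
  have hR0 : 0 < R := by rw [hR]; positivity
  have hr10 : 0 < r1 := by rw [hr1]; positivity
  have hR2 : R ≤ 1 / 2 := by rw [hR, div_le_iff₀ hF]; linarith
  have hrR : r1 ≤ R := by rw [hR, hr1]; gcongr; norm_num
  obtain ⟨κ, hκ⟩ : ∃ κ, κ = Real.sqrt (e R) := ⟨_, rfl⟩
  have hzR : 0 < z R := by positivity
  have heR : 0 < e R := by simp only [he]; positivity
  have hκ0 : 0 < κ := by rw [hκ]; positivity
  have hκ2 : κ ^ 2 = e R := by rw [hκ, Real.sq_sqrt heR.le]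
  have hκ1 : κ ≤ 1 := by rw [hκ]; exact Real.sqrt_le_one.2 (he1 R hR0 hR2)
  have hzκ : z R ≤ κ := by
    rw [hκ]; apply Real.le_sqrt_of_sq_le; simp only [he]; nlinarith [sq_nonneg (1 - a R)]
  set G : ℝ → ℝ := fun r => Real.exp (J r) / r with hG
  have hG0 : ∀ r, 0 < r → 0 < G r := fun r hr => by positivity
  have dG : ∀ r, 0 < r → HasDerivAt G (-(G r * (1 - a r)) / r) r := by
    intro r hr
    have h1 := (dJ r hr).exp.div (hasDerivAt_id r) hr.ne'
    refine h1.congr_deriv ?_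
    simp only [hG, id]
    field_simp
    ring
  have hGR : Ft / κ ≤ G R := by
    have : G R = Ft / z R := by
      simp only [hG, hz, Real.exp_neg]
      have := Real.exp_pos (J R)
      field_simp
    rw [this]
    gcongr
  have mem : ∀ x ∈ interior (Set.Icc r1 R), 0 < x ∧ x ≤ R ∧ x ≤ 1 / 2 := fun x hx => by
    have := interior_subset hx
    exact ⟨hr10.trans_le this.1, this.2, this.2.trans hR2⟩
  have pos : ∀ x ∈ Set.Icc r1 R, 0 < x := fun x hx => hr10.trans_le hx.1
  have hGan : AntitoneOn G (Set.Icc r1 R) := by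
    apply antitoneOn_of_deriv_nonpos (convex_Icc _ _)
    · exact fun x hx => (dG x (pos x hx)).continuousAt.continuousWithinAt
    · exact fun x hx => (dG x (mem x hx).1).differentiableAt.differentiableWithinAt
    · intro x hx
      obtain ⟨m1, m2, m3⟩ := mem x hx
      rw [(dG x m1).deriv]
      apply div_nonpos_of_nonpos_of_nonneg _ m1.le
      have := mul_nonneg (hG0 x m1).le (by linarith [hlt x m1 m3] : 0 ≤ 1 - a x)
      linarith
  set Φ : ℝ → ℝ := fun r => G r * (1 - a r) + Ft * κ * Real.log r with hΦ
  have dΦ : ∀ r, 0 < r → HasDerivAt Φ (-(G r * ((1 - a r) ^ 2 + r ^ 2 * V r) - Ft * κ) / r) r := by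
    intro r hr
    have h1 := ((dG r hr).mul ((da r hr).const_sub 1)).add ((Real.hasDerivAt_log hr.ne').const_mul (Ft * κ))
    refine h1.congr_deriv ?_
    field_simp
    ring
  have hΦan : AntitoneOn Φ (Set.Icc r1 R) := by
    apply antitoneOn_of_deriv_nonpos (convex_Icc _ _)
    · exact fun x hx => (dΦ x (pos x hx)).continuousAt.continuousWithinAt
    · exact fun x hx => (dΦ x (mem x hx).1).differentiableAt.differentiableWithinAt
    · intro x hx
      obtain ⟨m1, m2, m3⟩ := mem x hx
      rw [(dΦ x m1).deriv]
      apply div_nonpos_of_nonpos_of_nonneg _ m1.le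
      have h1 : κ ^ 2 ≤ (1 - a x) ^ 2 + x ^ 2 * V x := by
        rw [hκ2]
        have := hean ⟨m1, m3⟩ ⟨hR0, hR2⟩ m2
        have h2 : e x = (1 - a x) ^ 2 + z x ^ 2 := rfl
        linarith [hzV x m1 m3]
      have h2 : Ft / κ ≤ G x :=
        hGR.trans (hGan (interior_subset hx) ⟨hrR, le_rfl⟩ m2)
      have h3 : Ft * κ = Ft / κ * κ ^ 2 := by field_simp
      have h4 : Ft / κ * κ ^ 2 ≤ G x * ((1 - a x) ^ 2 + x ^ 2 * V x) := by
        have := hG0 x m1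
        gcongr
      linarith
  set Ψ : ℝ → ℝ := fun r => G r - Ft * κ * (Real.log R - Real.log r) ^ 2 / 2 with hΨ
  have dΨ : ∀ r, 0 < r → HasDerivAt Ψ (-(G r * (1 - a r) - Ft * κ * (Real.log R - Real.log r)) / r) r := by
    intro r hr
    have h1 := (dG r hr).sub (((((Real.hasDerivAt_log hr.ne').const_sub (Real.log R)).pow 2).const_mul (Ft * κ)).div_const 2)
    refine h1.congr_deriv ?_
    simp
    field_simp
    ring
  have hΨan : AntitoneOn Ψ (Set.Icc r1 R) := by
    apply antitoneOn_of_deriv_nonpos (convex_Icc _ _)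
    · exact fun x hx => (dΨ x (pos x hx)).continuousAt.continuousWithinAt
    · exact fun x hx => (dΨ x (mem x hx).1).differentiableAt.differentiableWithinAt
    · intro x hx
      obtain ⟨m1, m2, m3⟩ := mem x hx
      rw [(dΨ x m1).deriv]
      apply div_nonpos_of_nonpos_of_nonneg _ m1.le
      have h1 := hΦan (interior_subset hx) ⟨hrR, le_rfl⟩ m2
      simp only [hΦ] at h1
      have := mul_nonneg (hG0 R hR0).le (by linarith [hlt R hR0 hR2] : 0 ≤ 1 - a R)
      linarith
  have hfin := hΨan ⟨le_rfl, hrR⟩ ⟨hrR, le_rfl⟩ hrR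
  simp only [hΨ, sub_self] at hfin
  obtain ⟨s, hs⟩ : ∃ s, s = Real.log R - Real.log r1 := ⟨_, rfl⟩
  rw [← hs] at hfin
  have hs1 : s = Real.log 2.5 := by
    rw [hs, ← Real.log_div hR0.ne' hr10.ne', hR, hr1]
    congr 1
    field_simp
    norm_num
  have hs2 : 0.916 ≤ s := hs1 ▸ log_aux
  have hs3 : s ≤ 1.4 := by
    rw [hs1]
    have := Real.log_le_sub_one_of_pos (show (0:ℝ) < 2.5 / Real.exp 1 by positivity)
    rw [Real.log_div (by norm_num) (Real.exp_pos 1).ne', Real.log_exp] at this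
    have h2 := Real.exp_one_gt_d9
    have h3 : 2.5 / Real.exp 1 ≤ 1 := by rw [div_le_one (Real.exp_pos 1)]; linarith
    linarith
  have hs4 : 0.419528 ≤ s ^ 2 / 2 := by nlinarith
  have hs5 : s ^ 2 / 2 ≤ 1 := by nlinarith
  have hlow : Ft * (1 + s ^ 2 / 2) ≤ G r1 := by
    have h1 : 1 + s ^ 2 / 2 ≤ 1 / κ + κ * (s ^ 2 / 2) := by
      have h2 : 1 / κ + κ * (s ^ 2 / 2) - (1 + s ^ 2 / 2) = (1 - κ) * (1 - κ * (s ^ 2 / 2)) / κ := by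
        field_simp; ring
      have h3 : 0 ≤ 1 - κ * (s ^ 2 / 2) := by nlinarith [sq_nonneg s]
      have h4 : 0 ≤ (1 - κ) * (1 - κ * (s ^ 2 / 2)) / κ :=
        div_nonneg (mul_nonneg (by linarith) h3) hκ0.le
      linarith
    have h5 : Ft * (1 + s ^ 2 / 2) ≤ Ft * (1 / κ + κ * (s ^ 2 / 2)) := by gcongr
    have h6 : Ft * (1 / κ + κ * (s ^ 2 / 2)) = Ft / κ + Ft * κ * s ^ 2 / 2 := by ring
    rw [h6] at h5
    have : Ft * κ * (0:ℝ) ^ 2 / 2 = 0 := by simp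
    linarith
  have hup : G r1 ≤ F * Real.exp 0.183184 / 0.856 := by
    have h1 : G r1 = Real.exp (J r1) * (F / 0.856) := by
      simp only [hG]; rw [hr1]; field_simp
    have h2 : J r1 ≤ 0.183184 := by
      refine (J1 r1 hr10).trans (le_of_eq ?_)
      rw [hr1]; field_simp; norm_num
    rw [h1, mul_comm F, mul_div_assoc]
    gcongr
  have h1 : Ft * (1 + s ^ 2 / 2) ≤ F * Real.exp 0.183184 / 0.856 := hlow.trans hup
  have h2 : F * Real.exp (-0.01) ≤ Ft := by rw [hFt]; gcongr
  have h3 : F * Real.exp (-0.01) * 1.419528 ≤ F * Real.exp 0.183184 / 0.856 := by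
    refine le_trans ?_ h1
    have : (1.419528:ℝ) ≤ 1 + s ^ 2 / 2 := by linarith
    gcongr
  have h4 : Real.exp (-0.01) * 1.419528 * 0.856 ≤ Real.exp 0.183184 := by
    rw [le_div_iff₀ (by norm_num)] at h3
    have : F * (Real.exp (-0.01) * 1.419528 * 0.856) ≤ F * Real.exp 0.183184 := by linarith
    exact le_of_mul_le_mul_left this hF
  have h5 : Real.exp 0.193184 = Real.exp 0.183184 / Real.exp (-0.01) := by
    rw [← Real.exp_sub]; norm_num
  have h6 := exp_aux
  rw [h5, div_le_iff₀ (Real.exp_pos _)] at h6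
  nlinarith [Real.exp_pos (-0.01 : ℝ)]

end DiracT

namespace DiracT
open MeasureTheory Filter Topology

noncomputable def aa (w : ℝ → ℝ) (r : ℝ) : ℝ := ∫ s in (0:ℝ)..r, s * w s
noncomputable def JJ (w : ℝ → ℝ) (r : ℝ) : ℝ := ∫ s in (0:ℝ)..r, aa w s / s

lemma aa_deriv {w : ℝ → ℝ} (hw : Continuous w) (r : ℝ) : HasDerivAt (aa w) (r * w r) r := by
  have hc : Continuous fun s => s * w s := by fun_prop
  exact intervalIntegral.integral_hasDerivAt_right (hc.intervalIntegrable _ _)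
    (hc.stronglyMeasurableAtFilter _ _) hc.continuousAt

lemma aa_cont {w : ℝ → ℝ} (hw : Continuous w) : Continuous (aa w) :=
  continuous_iff_continuousAt.2 fun r => (aa_deriv hw r).continuousAt

lemma aa_div {w : ℝ → ℝ} (s : ℝ) : aa w s / s = s * ∫ u in (0:ℝ)..1, u * w (s * u) := by
  rcases eq_or_ne s 0 with h | h
  · simp [h]
  · have h1 := intervalIntegral.mul_integral_comp_mul_left (a := 0) (b := 1) (f := fun x => x * w x) s
    simp only [mul_zero, mul_one] at h1
    unfold aa
    rw [← h1, mul_div_cancel_left₀ _ h, ← intervalIntegral.integral_const_mul]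
    simp only [mul_assoc]

lemma aa_div_cont {w : ℝ → ℝ} (hw : Continuous w) : Continuous fun s => aa w s / s := by
  simp only [aa_div]
  refine continuous_id.mul ?_
  exact intervalIntegral.continuous_parametric_intervalIntegral_of_continuous' (by fun_prop) 0 1

lemma JJ_deriv {w : ℝ → ℝ} (hw : Continuous w) (r : ℝ) : HasDerivAt (JJ w) (aa w r / r) r := by
  have hc := aa_div_cont hw
  exact intervalIntegral.integral_hasDerivAt_right (hc.intervalIntegrable _ _)
    (hc.stronglyMeasurableAtFilter _ _) hc.continuousAt

lemma JJ_cont {w : ℝ → ℝ} (hw : Continuous w) : Continuous (JJ w) :=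
  continuous_iff_continuousAt.2 fun r => (JJ_deriv hw r).continuousAt

lemma aa_zero (w : ℝ → ℝ) : aa w 0 = 0 := by simp [aa]
lemma JJ_zero (w : ℝ → ℝ) : JJ w 0 = 0 := by simp [JJ]

lemma aa_mono {v w : ℝ → ℝ} (hv : Continuous v) (hw : Continuous w) (h : ∀ s, 0 ≤ s → v s ≤ w s)
    {r : ℝ} (hr : 0 ≤ r) : aa v r ≤ aa w r := by
  apply intervalIntegral.integral_mono_on hr (Continuous.intervalIntegrable (by fun_prop) _ _)
    (Continuous.intervalIntegrable (by fun_prop) _ _)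
  intro s hs
  exact mul_le_mul_of_nonneg_left (h s hs.1) hs.1

lemma aa_const (c r : ℝ) : aa (fun _ => c) r = c * r ^ 2 / 2 := by
  unfold aa
  rw [intervalIntegral.integral_mul_const, integral_id]
  ring

lemma aa_le {w : ℝ → ℝ} (hw : Continuous w) {c : ℝ} (h : ∀ s, 0 ≤ s → w s ≤ c)
    {r : ℝ} (hr : 0 ≤ r) : aa w r ≤ c * r ^ 2 / 2 :=
  (aa_mono hw continuous_const h hr).trans_eq (aa_const c r)

lemma aa_nonneg {w : ℝ → ℝ} (h : ∀ s, 0 ≤ s → 0 ≤ w s) {r : ℝ} (hr : 0 ≤ r) : 0 ≤ aa w r :=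
  intervalIntegral.integral_nonneg hr fun s hs => mul_nonneg hs.1 (h s hs.1)

lemma aa_monotone {w : ℝ → ℝ} (hw : Continuous w) (h : ∀ s, 0 ≤ s → 0 ≤ w s) {r s : ℝ} (hr : 0 ≤ r)
    (hrs : r ≤ s) : aa w r ≤ aa w s := by
  have hc : Continuous fun s => s * w s := by fun_prop
  have h1 := intervalIntegral.integral_add_adjacent_intervals (hc.intervalIntegrable (μ := volume) 0 r)
    (hc.intervalIntegrable r s)
  have h2 : 0 ≤ ∫ x in r..s, x * w x :=
    intervalIntegral.integral_nonneg hrs fun x hx => mul_nonneg (hr.trans hx.1) (h x (hr.trans hx.1))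
  unfold aa
  linarith

lemma aa_add {v w : ℝ → ℝ} (hv : Continuous v) (hw : Continuous w) (r : ℝ) :
    aa (fun s => v s + w s) r = aa v r + aa w r := by
  unfold aa
  rw [← intervalIntegral.integral_add (Continuous.intervalIntegrable (by fun_prop) _ _)
    (Continuous.intervalIntegrable (by fun_prop) _ _)]
  simp only [mul_add]

lemma JJ_add {v w : ℝ → ℝ} (hv : Continuous v) (hw : Continuous w) (r : ℝ) :
    JJ (fun s => v s + w s) r = JJ v r + JJ w r := by
  unfold JJ
  rw [← intervalIntegral.integral_add ((aa_div_cont hv).intervalIntegrable _ _)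
    ((aa_div_cont hw).intervalIntegrable _ _)]
  simp only [aa_add hv hw, add_div]

lemma JJ_mono {v w : ℝ → ℝ} (hv : Continuous v) (hw : Continuous w) (h : ∀ s, 0 ≤ s → v s ≤ w s)
    {r : ℝ} (hr : 0 ≤ r) : JJ v r ≤ JJ w r := by
  apply intervalIntegral.integral_mono_on hr ((aa_div_cont hv).intervalIntegrable _ _)
    ((aa_div_cont hw).intervalIntegrable _ _)
  intro s hs
  exact div_le_div_of_nonneg_right (aa_mono hv hw h hs.1) hs.1

lemma JJ_const (c r : ℝ) : JJ (fun _ => c) r = c * r ^ 2 / 4 := by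
  unfold JJ
  have : ∀ s, aa (fun _ => c) s / s = c / 2 * s := fun s => by
    rcases eq_or_ne s 0 with h | h
    · simp [h]
    · rw [aa_const]; field_simp
  simp only [this]
  rw [intervalIntegral.integral_const_mul, integral_id]
  ring

lemma JJ_le {w : ℝ → ℝ} (hw : Continuous w) {c : ℝ} (h : ∀ s, 0 ≤ s → w s ≤ c)
    {r : ℝ} (hr : 0 ≤ r) : JJ w r ≤ c * r ^ 2 / 4 :=
  (JJ_mono hw continuous_const h hr).trans_eq (JJ_const c r)

lemma JJ_nonneg {w : ℝ → ℝ} (h : ∀ s, 0 ≤ s → 0 ≤ w s) {r : ℝ} (hr : 0 ≤ r) : 0 ≤ JJ w r :=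
  intervalIntegral.integral_nonneg hr fun s hs => div_nonneg (aa_nonneg h hs.1) hs.1

/-- circle averages -/
noncomputable def Av (p : ℝ × ℝ) (g : ℝ × ℝ → ℝ) (r : ℝ) : ℝ :=
  1 / (2 * Real.pi) * ∫ θ in (-Real.pi)..Real.pi, g (p.1 + r * Real.cos θ, p.2 + r * Real.sin θ)

lemma Av_cont {g : ℝ × ℝ → ℝ} (hg : Continuous g) (p : ℝ × ℝ) : Continuous (Av p g) := by
  refine continuous_const.mul ?_
  exact intervalIntegral.continuous_parametric_intervalIntegral_of_continuous' (by fun_prop) _ _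

lemma Av_mono {g h : ℝ × ℝ → ℝ} (hg : Continuous g) (hh : Continuous h) (hgh : ∀ q, g q ≤ h q) (p : ℝ × ℝ) (r : ℝ) :
    Av p g r ≤ Av p h r := by
  have := Real.pi_pos
  unfold Av
  apply mul_le_mul_of_nonneg_left _ (by positivity)
  apply intervalIntegral.integral_mono_on (by linarith) (Continuous.intervalIntegrable (by fun_prop) _ _)
    (Continuous.intervalIntegrable (by fun_prop) _ _)
  intro θ _; exact hgh _

lemma Av_const (p : ℝ × ℝ) (c r : ℝ) : Av p (fun _ => c) r = c := by
  have := Real.pi_pos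
  unfold Av
  rw [intervalIntegral.integral_const, smul_eq_mul]
  field_simp
  ring

lemma Av_add {g h : ℝ × ℝ → ℝ} (hg : Continuous g) (hh : Continuous h) (p : ℝ × ℝ) (r : ℝ) :
    Av p (fun q => g q + h q) r = Av p g r + Av p h r := by
  unfold Av
  rw [intervalIntegral.integral_add (Continuous.intervalIntegrable (by fun_prop) _ _)
    (Continuous.intervalIntegrable (by fun_prop) _ _), mul_add]

lemma Av_zero (p : ℝ × ℝ) (g : ℝ × ℝ → ℝ) : Av p g 0 = g p := by
  have := Real.pi_pos
  unfold Av
  simp only [zero_mul, add_zero, Prod.mk.eta]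
  rw [intervalIntegral.integral_const, smul_eq_mul]
  field_simp
  ring

lemma Av_const_mul (c : ℝ) (g : ℝ × ℝ → ℝ) (p : ℝ × ℝ) (r : ℝ) :
    Av p (fun q => c * g q) r = c * Av p g r := by
  unfold Av
  rw [intervalIntegral.integral_const_mul]; ring

/-- Jensen -/
lemma Av_exp_ge {L : ℝ × ℝ → ℝ} (hL : Continuous L) (p : ℝ × ℝ) (r : ℝ) :
    Real.exp (2 * Av p L r) ≤ Av p (fun q => Real.exp (L q) ^ 2) r := by
  set m := Av p L r with hm
  have h1 : ∀ q, Real.exp (2 * m) * (1 - 2 * m) + Real.exp (2 * m) * 2 * L q ≤ Real.exp (L q) ^ 2 := fun q => by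
    have h2 := Real.add_one_le_exp (2 * L q - 2 * m)
    have h3 : Real.exp (L q) ^ 2 = Real.exp (2 * m) * Real.exp (2 * L q - 2 * m) := by
      rw [← Real.exp_add, ← Real.exp_nat_mul]; congr 1; push_cast; ring
    rw [h3]
    nlinarith [mul_le_mul_of_nonneg_left h2 (Real.exp_pos (2 * m)).le]
  have h2 := Av_mono (by fun_prop) (by fun_prop) h1 p r
  rw [Av_add (by fun_prop) (by fun_prop), Av_const, Av_const_mul, ← hm] at h2
  linarith

lemma hasDerivAt_param {G G' : ℝ → ℝ → ℝ} (hG : Continuous fun q : ℝ × ℝ => G q.1 q.2)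
    (hG' : Continuous fun q : ℝ × ℝ => G' q.1 q.2) (h : ∀ r t, HasDerivAt (fun r => G r t) (G' r t) r)
    (A B r : ℝ) : HasDerivAt (fun r => ∫ t in A..B, G r t) (∫ t in A..B, G' r t) r := by
  have hK : IsCompact (Metric.closedBall r 1 ×ˢ Set.uIcc A B) := (isCompact_closedBall r 1).prod isCompact_uIcc
  obtain ⟨C, hC⟩ := hK.exists_bound_of_continuousOn hG'.continuousOn
  have c1 : ∀ x, Continuous (G x) := fun x => hG.comp (by fun_prop : Continuous fun t : ℝ => (x, t))
  have c2 : ∀ x, Continuous (G' x) := fun x => hG'.comp (by fun_prop : Continuous fun t : ℝ => (x, t))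
  refine (intervalIntegral.hasDerivAt_integral_of_dominated_loc_of_deriv_le (bound := fun _ => C)
    (Metric.closedBall_mem_nhds r one_pos) (Eventually.of_forall fun x => (c1 x).aestronglyMeasurable)
    ((c1 r).intervalIntegrable _ _) (c2 r).aestronglyMeasurable ?_ (by simp) ?_).2
  · exact Eventually.of_forall fun t ht x hx => hC (x, t) ⟨hx, Set.uIoc_subset_uIcc ht⟩
  · exact Eventually.of_forall fun t ht x hx => h x t

noncomputable def pX (f : ℝ × ℝ → ℝ) (p : ℝ × ℝ) : ℝ := fderiv ℝ f p (1, 0)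
noncomputable def pY (f : ℝ × ℝ → ℝ) (p : ℝ × ℝ) : ℝ := fderiv ℝ f p (0, 1)
noncomputable def lap (f : ℝ × ℝ → ℝ) (p : ℝ × ℝ) : ℝ := pX (pX f) p + pY (pY f) p

lemma fderiv_pXY (f : ℝ × ℝ → ℝ) (p : ℝ × ℝ) (u v : ℝ) : fderiv ℝ f p (u, v) = u * pX f p + v * pY f p := by
  have : ((u, v) : ℝ × ℝ) = u • (1, 0) + v • (0, 1) := by simp
  rw [this, map_add, map_smul, map_smul]
  rfl

lemma smooth_pX {f : ℝ × ℝ → ℝ} (hf : ContDiff ℝ (⊤ : ℕ∞) f) : ContDiff ℝ (⊤ : ℕ∞) (pX f) :=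
  (hf.fderiv_right (m := (⊤ : ℕ∞)) (by simp)).clm_apply contDiff_const
lemma smooth_pY {f : ℝ × ℝ → ℝ} (hf : ContDiff ℝ (⊤ : ℕ∞) f) : ContDiff ℝ (⊤ : ℕ∞) (pY f) :=
  (hf.fderiv_right (m := (⊤ : ℕ∞)) (by simp)).clm_apply contDiff_const

lemma deriv_r {f : ℝ × ℝ → ℝ} (hf : ContDiff ℝ (⊤ : ℕ∞) f) (p : ℝ × ℝ) (r θ : ℝ) :
    HasDerivAt (fun r => f (p.1 + r * Real.cos θ, p.2 + r * Real.sin θ))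
      (Real.cos θ * pX f (p.1 + r * Real.cos θ, p.2 + r * Real.sin θ)
        + Real.sin θ * pY f (p.1 + r * Real.cos θ, p.2 + r * Real.sin θ)) r := by
  have h1 : HasDerivAt (fun r => (p.1 + r * Real.cos θ, p.2 + r * Real.sin θ)) (Real.cos θ, Real.sin θ) r := by
    have h2 := ((hasDerivAt_id r).mul_const (Real.cos θ)).const_add p.1
    have h3 := ((hasDerivAt_id r).mul_const (Real.sin θ)).const_add p.2
    simpa using h2.prodMk h3
  have h4 := (hf.differentiable (by simp) (p.1 + r * Real.cos θ, p.2 + r * Real.sin θ)).hasFDerivAt.comp_hasDerivAt r h1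
  rw [fderiv_pXY] at h4
  exact h4

lemma deriv_θ {f : ℝ × ℝ → ℝ} (hf : ContDiff ℝ (⊤ : ℕ∞) f) (p : ℝ × ℝ) (r θ : ℝ) :
    HasDerivAt (fun θ => f (p.1 + r * Real.cos θ, p.2 + r * Real.sin θ))
      (-(r * Real.sin θ) * pX f (p.1 + r * Real.cos θ, p.2 + r * Real.sin θ)
        + r * Real.cos θ * pY f (p.1 + r * Real.cos θ, p.2 + r * Real.sin θ)) θ := by
  have h1 : HasDerivAt (fun θ => (p.1 + r * Real.cos θ, p.2 + r * Real.sin θ)) (-(r * Real.sin θ), r * Real.cos θ) θ := by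
    have h2 := ((Real.hasDerivAt_cos θ).const_mul r).const_add p.1
    have h3 := ((Real.hasDerivAt_sin θ).const_mul r).const_add p.2
    simpa using h2.prodMk h3
  have h4 := (hf.differentiable (by simp) (p.1 + r * Real.cos θ, p.2 + r * Real.sin θ)).hasFDerivAt.comp_hasDerivAt θ h1
  rw [fderiv_pXY] at h4
  exact h4

lemma Av_lower {L μ : ℝ × ℝ → ℝ} (hL : ContDiff ℝ (⊤ : ℕ∞) L) (hμ : Continuous μ) (h : ∀ q, -μ q ≤ lap L q)
    (p : ℝ × ℝ) {r : ℝ} (hr : 0 ≤ r) : L p - JJ (Av p μ) r ≤ Av p L r := by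
  have sX := smooth_pX hL
  have sY := smooth_pY hL
  have cX := sX.continuous
  have cY := sY.continuous
  have cXX := (smooth_pX sX).continuous
  have cXY := (smooth_pY sX).continuous
  have cYX := (smooth_pX sY).continuous
  have cYY := (smooth_pY sY).continuous
  have hpi := Real.pi_pos
  have clap : Continuous (lap L) := by unfold lap; fun_prop
  have cμ := Av_cont hμ p
  set P : ℝ → ℝ → ℝ × ℝ := fun r θ => (p.1 + r * Real.cos θ, p.2 + r * Real.sin θ) with hP
  set M : ℝ → ℝ := fun r => 1 / (2 * Real.pi) * ∫ θ in (-Real.pi)..Real.pi,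
    (Real.cos θ * pX L (P r θ) + Real.sin θ * pY L (P r θ)) with hM
  have d1 : ∀ r, HasDerivAt (Av p L) (M r) r := fun r =>
    (hasDerivAt_param (G := fun r θ => L (P r θ)) (G' := fun r θ => Real.cos θ * pX L (P r θ) + Real.sin θ * pY L (P r θ))
      (hL.continuous.comp (by fun_prop)) (by fun_prop) (fun r θ => deriv_r hL p r θ) _ _ r).const_mul _
  have d2 : ∀ r, HasDerivAt (fun r => r * M r) (r * Av p (lap L) r) r := fun r => by
    have h1 := (hasDerivAt_param (G := fun r θ => r * (Real.cos θ * pX L (P r θ) + Real.sin θ * pY L (P r θ)))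
      (G' := fun r θ => 1 * (Real.cos θ * pX L (P r θ) + Real.sin θ * pY L (P r θ)) +
        r * (Real.cos θ * (Real.cos θ * pX (pX L) (P r θ) + Real.sin θ * pY (pX L) (P r θ)) +
          Real.sin θ * (Real.cos θ * pX (pY L) (P r θ) + Real.sin θ * pY (pY L) (P r θ))))
      (by fun_prop) (by fun_prop)
      (fun r θ => (hasDerivAt_id r).mul (((deriv_r sX p r θ).const_mul _).add ((deriv_r sY p r θ).const_mul _)))
      (-Real.pi) Real.pi r).const_mul (1 / (2 * Real.pi))
    have e1 : (fun r => 1 / (2 * Real.pi) * ∫ θ in (-Real.pi)..Real.pi, r * (Real.cos θ * pX L (P r θ) + Real.sin θ * pY L (P r θ)))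
        = fun r => r * M r := by
      ext r
      rw [intervalIntegral.integral_const_mul]; simp only [hM]; ring
    rw [e1] at h1
    refine h1.congr_deriv ?_
    -- the angular part
    have dθ : ∀ θ, HasDerivAt (fun θ => -Real.sin θ * pX L (P r θ) + Real.cos θ * pY L (P r θ))
        (r * lap L (P r θ) - (1 * (Real.cos θ * pX L (P r θ) + Real.sin θ * pY L (P r θ)) +
        r * (Real.cos θ * (Real.cos θ * pX (pX L) (P r θ) + Real.sin θ * pY (pX L) (P r θ)) +
          Real.sin θ * (Real.cos θ * pX (pY L) (P r θ) + Real.sin θ * pY (pY L) (P r θ))))) θ := fun θ => by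
      have h2 := ((Real.hasDerivAt_sin θ).neg.mul (deriv_θ sX p r θ)).add ((Real.hasDerivAt_cos θ).mul (deriv_θ sY p r θ))
      refine h2.congr_deriv ?_
      simp only [hP, lap, Pi.neg_apply]
      have h3 := Real.sin_sq_add_cos_sq θ
      linear_combination (r * (pX (pX L) (p.1 + r * Real.cos θ, p.2 + r * Real.sin θ) + pY (pY L) (p.1 + r * Real.cos θ, p.2 + r * Real.sin θ))) * h3
    have h4 := intervalIntegral.integral_eq_sub_of_hasDerivAt (a := -Real.pi) (b := Real.pi) (fun θ _ => dθ θ)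
      (Continuous.intervalIntegrable (by fun_prop) _ _)
    rw [intervalIntegral.integral_sub (Continuous.intervalIntegrable (by fun_prop) _ _)
      (Continuous.intervalIntegrable (by fun_prop) _ _), intervalIntegral.integral_const_mul] at h4
    simp only [hP, Real.sin_neg, Real.cos_neg, Real.sin_pi, Real.cos_pi, neg_zero, zero_mul, mul_zero, sub_self] at h4
    unfold Av
    simp only [hP]
    rw [sub_eq_zero] at h4
    rw [← h4]
    ring
  have hN : ∀ r, 0 ≤ r → 0 ≤ r * M r + aa (Av p μ) r := by
    intro r hr
    have hm : MonotoneOn (fun r => r * M r + aa (Av p μ) r) (Set.Ici 0) := by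
      apply monotoneOn_of_deriv_nonneg (convex_Ici _)
      · exact fun x hx => ((d2 x).add (aa_deriv cμ x)).continuousAt.continuousWithinAt
      · exact fun x hx => ((d2 x).add (aa_deriv cμ x)).differentiableAt.differentiableWithinAt
      · intro x hx
        have hd : deriv (fun r => r * M r + aa (Av p μ) r) x = _ := ((d2 x).add (aa_deriv cμ x)).deriv
        rw [hd, ← mul_add, ← Av_add clap hμ]
        have h5 := Av_mono (g := fun _ => 0) continuous_const (clap.add hμ) (fun q => by simp only [Pi.add_apply]; linarith [h q]) p x
        rw [Av_const] at h5
        exact mul_nonneg (interior_subset hx) h5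
    have := hm (Set.mem_Ici.2 le_rfl) (Set.mem_Ici.2 hr) hr
    simpa [aa_zero] using this
  have hm : MonotoneOn (fun r => Av p L r + JJ (Av p μ) r) (Set.Ici 0) := by
    apply monotoneOn_of_deriv_nonneg (convex_Ici _)
    · exact fun x hx => ((d1 x).add (JJ_deriv cμ x)).continuousAt.continuousWithinAt
    · exact fun x hx => ((d1 x).add (JJ_deriv cμ x)).differentiableAt.differentiableWithinAt
    · intro x hx
      have hd : deriv (fun r => Av p L r + JJ (Av p μ) r) x = _ := ((d1 x).add (JJ_deriv cμ x)).deriv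
      rw [hd]
      rw [interior_Ici] at hx
      have hx0 : 0 < x := hx
      have : M x + aa (Av p μ) x / x = (x * M x + aa (Av p μ) x) / x := by field_simp
      rw [this]
      exact div_nonneg (hN x hx0.le) hx0.le
  have := hm (Set.mem_Ici.2 le_rfl) (Set.mem_Ici.2 hr) hr
  simp only [Av_zero, JJ_zero, add_zero] at this
  linarith

end DiracT

namespace DiracT
open MeasureTheory Filter Topology

lemma muT_shift {a b : ℝ} (hb : 0 < b) {g : ℝ × ℝ → ℝ} (hg : Continuous g)
    (hp1 : ∀ p : ℝ × ℝ, g (p.1 + 1, p.2) = g p) (hp2 : ∀ p : ℝ × ℝ, g (p.1 + a, p.2 + b) = g p) (p : ℝ × ℝ) :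
    ∫ y in (-(1/2):ℝ)..(b - 1/2), ∫ x in (-(1/2):ℝ)..(1/2), g (p.1 + x, p.2 + y) = ∫ q, g q ∂(muT b) := by
  have hx : ∀ (u y : ℝ), ∫ x in u..(u+1), g (x, y) = ∫ x in (0:ℝ)..1, g (x, y) := fun u y => by
    have hper : Function.Periodic (fun x => g (x, y)) 1 := fun x => hp1 (x, y)
    have := hper.intervalIntegral_add_eq u 0
    rwa [zero_add] at this
  have hy : Function.Periodic (fun y => ∫ x in (0:ℝ)..1, g (x, y)) b := fun y => by
    have h3 : ∀ x, g (x, y + b) = (fun x => g (x, y)) (x - a) := fun x => by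
      have := hp2 (x - a, y); simpa only [sub_add_cancel] using this
    simp only [h3]
    rw [intervalIntegral.integral_comp_sub_right (fun x => g (x, y)), ← hx (0 - a)]
    congr 1; ring
  have h1 : ∀ y, ∫ x in (-(1/2):ℝ)..(1/2), g (p.1 + x, p.2 + y) = ∫ x in (0:ℝ)..1, g (x, p.2 + y) := fun y => by
    rw [intervalIntegral.integral_comp_add_left (fun x => g (x, p.2 + y)), ← hx (p.1 + -(1/2))]
    congr 1; ring
  simp only [h1]
  rw [intervalIntegral.integral_comp_add_left (fun y => ∫ x in (0:ℝ)..1, g (x, y)), integral_muT_yx hg hb.le]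
  have h2 := hy.intervalIntegral_add_eq (p.2 + -(1/2)) 0
  rw [zero_add] at h2
  rw [← h2]
  congr 1; ring

lemma disc_le {a b : ℝ} (hb : 1 ≤ b) {g : ℝ × ℝ → ℝ} (hg : Continuous g) (h0 : ∀ p, 0 ≤ g p)
    (hp1 : ∀ p : ℝ × ℝ, g (p.1 + 1, p.2) = g p) (hp2 : ∀ p : ℝ × ℝ, g (p.1 + a, p.2 + b) = g p) (p : ℝ × ℝ) :
    aa (Av p g) (1 / 2) ≤ 1 / (2 * Real.pi) * ∫ q, g q ∂(muT b) := by
  have hpi := Real.pi_pos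
  have hb0 : 0 < b := by linarith
  set D : Set (ℝ × ℝ) := {q | q.1 ^ 2 + q.2 ^ 2 < 1 / 4} with hD
  have mD : MeasurableSet D := (isOpen_lt (by fun_prop) continuous_const).measurableSet
  set G : ℝ × ℝ → ℝ := fun q => g (p.1 + q.1, p.2 + q.2) with hG
  have cG : Continuous G := by fun_prop
  have h1 := integral_comp_polarCoord_symm (D.indicator G)
  rw [integral_indicator mD] at h1
  set S : Set (ℝ × ℝ) := Set.Ioc 0 (1 / 2) ×ˢ Set.Ioc (-Real.pi) Real.pi with hS
  set H : ℝ × ℝ → ℝ := fun q => q.1 * g (p.1 + q.1 * Real.cos q.2, p.2 + q.1 * Real.sin q.2) with hH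
  have cH : Continuous H := by fun_prop
  have intOn : ∀ (f : ℝ × ℝ → ℝ) (_ : Continuous f) (u v w z : ℝ), IntegrableOn f (Set.Ioc u v ×ˢ Set.Ioc w z) := by
    intro f hf u v w z
    exact (hf.continuousOn.integrableOn_compact (isCompact_Icc.prod isCompact_Icc)).mono_set
      (Set.prod_mono Set.Ioc_subset_Icc_self Set.Ioc_subset_Icc_self)
  have h2 : ∫ q in polarCoord.target, q.1 • D.indicator G (polarCoord.symm q) = ∫ q in S, H q := by
    set S' : Set (ℝ × ℝ) := Set.Iio (1 / 2) ×ˢ Set.univ with hS'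
    have e1 : ∀ q ∈ polarCoord.target, q.1 • D.indicator G (polarCoord.symm q) = S'.indicator H q := by
      intro q hq
      rw [polarCoord_target] at hq
      have hq1 : 0 < q.1 := hq.1
      have hiff : polarCoord.symm q ∈ D ↔ q ∈ S' := by
        simp only [hD, polarCoord_symm_apply, Set.mem_setOf_eq, hS', Set.mem_prod, Set.mem_Iio, Set.mem_univ, and_true]
        have : (q.1 * Real.cos q.2) ^ 2 + (q.1 * Real.sin q.2) ^ 2 = q.1 ^ 2 := by
          linear_combination q.1 ^ 2 * Real.sin_sq_add_cos_sq q.2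
        rw [this]
        constructor <;> intro h <;> nlinarith
      by_cases h : q ∈ S'
      · rw [Set.indicator_of_mem h, Set.indicator_of_mem (hiff.2 h)]
        simp [hG, hH, polarCoord_symm_apply]
      · rw [Set.indicator_of_notMem h, Set.indicator_of_notMem (fun h' => h (hiff.1 h'))]
        simp
    rw [setIntegral_congr_fun polarCoord.open_target.measurableSet e1,
      setIntegral_indicator (measurableSet_Iio.prod MeasurableSet.univ), polarCoord_target]
    have e2 : (Set.Ioi (0:ℝ) ×ˢ Set.Ioo (-Real.pi) Real.pi) ∩ S' = Set.Ioo 0 (1 / 2) ×ˢ Set.Ioo (-Real.pi) Real.pi := by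
      rw [hS', Set.prod_inter_prod, Set.inter_univ, Set.Ioi_inter_Iio]
    rw [e2]
    apply setIntegral_congr_set
    rw [Measure.volume_eq_prod]
    exact Measure.set_prod_ae_eq Ioo_ae_eq_Ioc Ioo_ae_eq_Ioc
  have h3 : ∫ q in S, H q = 2 * Real.pi * aa (Av p g) (1 / 2) := by
    rw [Measure.volume_eq_prod, setIntegral_prod _ (by rw [← Measure.volume_eq_prod]; exact intOn H cH _ _ _ _)]
    unfold aa
    rw [← intervalIntegral.integral_const_mul, intervalIntegral.integral_of_le (by norm_num)]
    congr 1; ext r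
    unfold Av
    rw [← intervalIntegral.integral_of_le (by linarith), intervalIntegral.integral_const_mul]
    field_simp
  have h4 : ∫ q in D, G q ≤ ∫ q in Set.Ioc (-(1/2) : ℝ) (1/2) ×ˢ Set.Ioc (-(1/2) : ℝ) (b - 1/2), G q := by
    apply setIntegral_mono_set (intOn G cG _ _ _ _) (Eventually.of_forall fun q => h0 _)
    apply HasSubset.Subset.eventuallyLE
    intro q hq
    have hq' : q.1 ^ 2 + q.2 ^ 2 < 1 / 4 := hq
    have a1 : |q.1| < 1 / 2 := abs_lt_of_sq_lt_sq (by nlinarith [sq_nonneg q.2]) (by norm_num)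
    have a2 : |q.2| < 1 / 2 := abs_lt_of_sq_lt_sq (by nlinarith [sq_nonneg q.1]) (by norm_num)
    rw [abs_lt] at a1 a2
    refine ⟨⟨by linarith, by linarith⟩, ⟨by linarith, by linarith⟩⟩
  have h5 : ∫ q in Set.Ioc (-(1/2) : ℝ) (1/2) ×ˢ Set.Ioc (-(1/2) : ℝ) (b - 1/2), G q = ∫ q, g q ∂(muT b) := by
    rw [← muT_shift hb0 hg hp1 hp2 p, Measure.volume_eq_prod]
    rw [← Measure.prod_restrict, integral_prod_symm]
    · rw [intervalIntegral.integral_of_le (by linarith)]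
      simp only [intervalIntegral.integral_of_le (show (-(1/2):ℝ) ≤ 1/2 by norm_num)]
      rfl
    · rw [Measure.prod_restrict, ← Measure.volume_eq_prod]
      exact intOn G cG _ _ _ _
  rw [h2, h3] at h1
  rw [one_div_mul_eq_div, le_div_iff₀ (by positivity)]
  linarith

end DiracT

namespace DiracT
open MeasureTheory Filter Topology

abbrev Sm (f : ℝ × ℝ → ℝ) : Prop := ContDiff ℝ (⊤ : ℕ∞) f

lemma Sm.d {f : ℝ × ℝ → ℝ} (hf : Sm f) (p : ℝ × ℝ) : DifferentiableAt ℝ f p :=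
  (hf.differentiable (by simp)) p

lemma pX_add {f g : ℝ × ℝ → ℝ} (hf : Sm f) (hg : Sm g) : pX (fun p => f p + g p) = fun p => pX f p + pX g p := by
  ext p; unfold pX; rw [fderiv_fun_add (hf.d p) (hg.d p)]; rfl
lemma pY_add {f g : ℝ × ℝ → ℝ} (hf : Sm f) (hg : Sm g) : pY (fun p => f p + g p) = fun p => pY f p + pY g p := by
  ext p; unfold pY; rw [fderiv_fun_add (hf.d p) (hg.d p)]; rfl
lemma pX_sub {f g : ℝ × ℝ → ℝ} (hf : Sm f) (hg : Sm g) : pX (fun p => f p - g p) = fun p => pX f p - pX g p := by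
  ext p; unfold pX; rw [fderiv_fun_sub (hf.d p) (hg.d p)]; rfl
lemma pY_sub {f g : ℝ × ℝ → ℝ} (hf : Sm f) (hg : Sm g) : pY (fun p => f p - g p) = fun p => pY f p - pY g p := by
  ext p; unfold pY; rw [fderiv_fun_sub (hf.d p) (hg.d p)]; rfl
lemma pX_mul {f g : ℝ × ℝ → ℝ} (hf : Sm f) (hg : Sm g) : pX (fun p => f p * g p) = fun p => f p * pX g p + pX f p * g p := by
  ext p; unfold pX; rw [fderiv_fun_mul (hf.d p) (hg.d p)]; simp; ring
lemma pY_mul {f g : ℝ × ℝ → ℝ} (hf : Sm f) (hg : Sm g) : pY (fun p => f p * g p) = fun p => f p * pY g p + pY f p * g p := by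
  ext p; unfold pY; rw [fderiv_fun_mul (hf.d p) (hg.d p)]; simp; ring
lemma pX_const (c : ℝ) : pX (fun _ => c) = fun _ => 0 := by ext p; simp [pX]
lemma pY_const (c : ℝ) : pY (fun _ => c) = fun _ => 0 := by ext p; simp [pY]

lemma pXY_comm {f : ℝ × ℝ → ℝ} (hf : Sm f) : pX (pY f) = pY (pX f) := by
  ext p
  have h1 : DifferentiableAt ℝ (fderiv ℝ f) p :=
    ((hf.fderiv_right (m := (⊤ : ℕ∞)) (by simp)).differentiable (by simp)) p
  have hs : IsSymmSndFDerivAt ℝ f p := (hf.contDiffAt).isSymmSndFDerivAt (by simp only [minSmoothness_of_isRCLikeNormedField]; exact WithTop.coe_le_coe.2 le_top)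
  have e : ∀ v w : ℝ × ℝ, fderiv ℝ (fun q => fderiv ℝ f q v) p w = fderiv ℝ (fderiv ℝ f) p w v := by
    intro v w
    rw [fderiv_clm_apply h1 (differentiableAt_const v)]
    simp
  have h2 : pX (pY f) p = fderiv ℝ (fderiv ℝ f) p (1, 0) (0, 1) := e (0,1) (1,0)
  have h3 : pY (pX f) p = fderiv ℝ (fderiv ℝ f) p (0, 1) (1, 0) := e (1,0) (0,1)
  rw [h2, h3, hs.eq]

lemma pX_log {f : ℝ × ℝ → ℝ} (hf : Sm f) (h0 : ∀ p, 0 < f p) : pX (fun p => Real.log (f p)) = fun p => (f p)⁻¹ * pX f p := by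
  ext p; unfold pX; rw [((hf.d p).hasFDerivAt.log (h0 p).ne').fderiv]; simp
lemma pY_log {f : ℝ × ℝ → ℝ} (hf : Sm f) (h0 : ∀ p, 0 < f p) : pY (fun p => Real.log (f p)) = fun p => (f p)⁻¹ * pY f p := by
  ext p; unfold pY; rw [((hf.d p).hasFDerivAt.log (h0 p).ne').fderiv]; simp
lemma pX_inv {f : ℝ × ℝ → ℝ} (hf : Sm f) (h0 : ∀ p, 0 < f p) : pX (fun p => (f p)⁻¹) = fun p => -((f p)⁻¹ ^ 2 * pX f p) := by
  ext p; unfold pX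
  have := ((hasDerivAt_inv (h0 p).ne').comp_hasFDerivAt p (hf.d p).hasFDerivAt).fderiv
  simp only [Function.comp_def] at this
  rw [this]; simp
lemma pY_inv {f : ℝ × ℝ → ℝ} (hf : Sm f) (h0 : ∀ p, 0 < f p) : pY (fun p => (f p)⁻¹) = fun p => -((f p)⁻¹ ^ 2 * pY f p) := by
  ext p; unfold pY
  have := ((hasDerivAt_inv (h0 p).ne').comp_hasFDerivAt p (hf.d p).hasFDerivAt).fderiv
  simp only [Function.comp_def] at this
  rw [this]; simp

lemma lap_log {f : ℝ × ℝ → ℝ} (hf : Sm f) (h0 : ∀ p, 0 < f p) (p : ℝ × ℝ) :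
    lap (fun p => Real.log (f p)) p = (f p)⁻¹ * lap f p - (f p)⁻¹ ^ 2 * (pX f p ^ 2 + pY f p ^ 2) := by
  have hi : Sm (fun p => (f p)⁻¹) := hf.inv fun p => (h0 p).ne'
  unfold lap
  rw [pX_log hf h0, pY_log hf h0, pX_mul hi (smooth_pX hf), pY_mul hi (smooth_pY hf), pX_inv hf h0, pY_inv hf h0]
  ring

lemma lap_comb {f g : ℝ × ℝ → ℝ} (hf : Sm f) (hg : Sm g) (c d e : ℝ) (p : ℝ × ℝ) :
    lap (fun p => c * f p + d * g p + e) p = c * lap f p + d * lap g p := by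
  have c1 : Sm (fun _ => c) := contDiff_const
  have c2 : Sm (fun _ => d) := contDiff_const
  have c3 : Sm (fun _ => e) := contDiff_const
  have s1 : Sm (fun p => c * f p) := c1.mul hf
  have s2 : Sm (fun p => d * g p) := c2.mul hg
  have s3 : Sm (fun p => c * f p + d * g p) := s1.add s2
  have eX : pX (fun p => c * f p + d * g p + e) = fun p => c * pX f p + d * pX g p := by
    rw [pX_add s3 c3, pX_add s1 s2, pX_mul c1 hf, pX_mul c2 hg, pX_const, pX_const, pX_const]; ext p; ring
  have eY : pY (fun p => c * f p + d * g p + e) = fun p => c * pY f p + d * pY g p := by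
    rw [pY_add s3 c3, pY_add s1 s2, pY_mul c1 hf, pY_mul c2 hg, pY_const, pY_const, pY_const]; ext p; ring
  unfold lap
  rw [eX, eY, pX_add (c1.mul (smooth_pX hf)) (c2.mul (smooth_pX hg)), pY_add (c1.mul (smooth_pY hf)) (c2.mul (smooth_pY hg)),
    pX_mul c1 (smooth_pX hf), pX_mul c2 (smooth_pX hg), pY_mul c1 (smooth_pY hf), pY_mul c2 (smooth_pY hg)]
  simp only [pX_const, pY_const]; ring

lemma lap_sq {u : ℝ × ℝ → ℝ} (hu : Sm u) (p : ℝ × ℝ) :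
    lap (fun p => u p * u p) p = 2 * (pX u p ^ 2 + pY u p ^ 2) + 2 * (u p * lap u p) := by
  unfold lap
  rw [pX_mul hu hu, pY_mul hu hu,
    pX_add (hu.mul (smooth_pX hu)) ((smooth_pX hu).mul hu), pY_add (hu.mul (smooth_pY hu)) ((smooth_pY hu).mul hu),
    pX_mul hu (smooth_pX hu), pX_mul (smooth_pX hu) hu, pY_mul hu (smooth_pY hu), pY_mul (smooth_pY hu) hu]
  ring

lemma lap_add {f g : ℝ × ℝ → ℝ} (hf : Sm f) (hg : Sm g) (p : ℝ × ℝ) :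
    lap (fun p => f p + g p) p = lap f p + lap g p := by
  have := lap_comb hf hg 1 1 0 p
  simpa using this

set_option maxHeartbeats 1000000 in
lemma G_real {f u1 v1 u2 v2 : ℝ × ℝ → ℝ} (hf : Sm f) (h1 : Sm u1) (h2 : Sm v1) (h3 : Sm u2) (h4 : Sm v2)
    (e1 : ∀ p, pX u2 p + pY v2 p = f p * u1 p) (e2 : ∀ p, pX v2 p - pY u2 p = f p * v1 p)
    (e3 : ∀ p, pX u1 p - pY v1 p = -(f p * u2 p)) (e4 : ∀ p, pX v1 p + pY u1 p = -(f p * v2 p))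
    {δ : ℝ} (hδ : 0 < δ) (p : ℝ × ℝ) :
    -(f p ^ 2) ≤ lap (fun p => Real.log (u1 p * u1 p + v1 p * v1 p + (u2 p * u2 p + v2 p * v2 p) + δ)) p := by
  have c3 : Sm (fun _ => δ) := contDiff_const
  have q1 : Sm (fun p => u1 p * u1 p) := h1.mul h1
  have q2 : Sm (fun p => v1 p * v1 p) := h2.mul h2
  have q3 : Sm (fun p => u2 p * u2 p) := h3.mul h3
  have q4 : Sm (fun p => v2 p * v2 p) := h4.mul h4
  have q12 : Sm (fun p => u1 p * u1 p + v1 p * v1 p) := q1.add q2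
  have q34 : Sm (fun p => u2 p * u2 p + v2 p * v2 p) := q3.add q4
  have qn : Sm (fun p => u1 p * u1 p + v1 p * v1 p + (u2 p * u2 p + v2 p * v2 p)) := q12.add q34
  have x1 := smooth_pX h1
  have x2 := smooth_pX h2
  have x3 := smooth_pX h3
  have x4 := smooth_pX h4
  have y1 := smooth_pY h1
  have y2 := smooth_pY h2
  have y3 := smooth_pY h3
  have y4 := smooth_pY h4
  have fx : ∀ {A B C D : ℝ × ℝ → ℝ}, Sm A → Sm B → (∀ p, A p + B p = C p) → pX A p + pX B p = pX C p := by
    intro A B C D hA hB h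
    have : C = fun p => A p + B p := by ext p; exact (h p).symm
    rw [this, pX_add hA hB]
  have neg : ∀ {A : ℝ × ℝ → ℝ}, Sm A → pX (fun p => - A p) p = - pX A p ∧ pY (fun p => - A p) p = - pY A p := by
    intro A hA
    constructor
    · unfold pX; rw [fderiv_fun_neg]; rfl
    · unfold pY; rw [fderiv_fun_neg]; rfl
  have E1 : pX u2 = fun p => f p * u1 p - pY v2 p := by ext p; linarith [e1 p]
  have E2 : pY u2 = fun p => pX v2 p - f p * v1 p := by ext p; linarith [e2 p]
  have E3 : pX v2 = fun p => f p * v1 p + pY u2 p := by ext p; linarith [e2 p]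
  have E4 : pY v2 = fun p => f p * u1 p - pX u2 p := by ext p; linarith [e1 p]
  have E5 : pX u1 = fun p => pY v1 p - f p * u2 p := by ext p; linarith [e3 p]
  have E6 : pY u1 = fun p => -(pX v1 p + f p * v2 p) := by ext p; linarith [e4 p]
  have E7 : pX v1 = fun p => -(pY u1 p + f p * v2 p) := by ext p; linarith [e4 p]
  have E8 : pY v1 = fun p => pX u1 p + f p * u2 p := by ext p; linarith [e3 p]
  have L1 : lap u1 p = -(pX f p * u2 p) - pY f p * v2 p - f p ^ 2 * u1 p := by
    have A : pX (pX u1) p = pX (pY v1) p - (f p * pX u2 p + pX f p * u2 p) := by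
      rw [E5, pX_sub y2 (hf.mul h3), pX_mul hf h3]
    have B : pY (pY u1) p = -(pY (pX v1) p + (f p * pY v2 p + pY f p * v2 p)) := by
      rw [E6, (neg (x2.add (hf.mul h4))).2, pY_add x2 (hf.mul h4), pY_mul hf h4]
    unfold lap
    rw [A, B, pXY_comm h2]; linear_combination - f p * e1 p
  have L2 : lap v1 p = -(pX f p * v2 p) + pY f p * u2 p - f p ^ 2 * v1 p := by
    have A : pX (pX v1) p = -(pX (pY u1) p + (f p * pX v2 p + pX f p * v2 p)) := by
      rw [E7, (neg (y1.add (hf.mul h4))).1, pX_add y1 (hf.mul h4), pX_mul hf h4]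
    have B : pY (pY v1) p = pY (pX u1) p + (f p * pY u2 p + pY f p * u2 p) := by
      rw [E8, pY_add x1 (hf.mul h3), pY_mul hf h3]
    unfold lap
    rw [A, B, pXY_comm h1]; linear_combination - f p * e2 p
  have L3 : lap u2 p = pX f p * u1 p - pY f p * v1 p - f p ^ 2 * u2 p := by
    have A : pX (pX u2) p = (f p * pX u1 p + pX f p * u1 p) - pX (pY v2) p := by
      rw [E1, pX_sub (hf.mul h1) y4, pX_mul hf h1]
    have B : pY (pY u2) p = pY (pX v2) p - (f p * pY v1 p + pY f p * v1 p) := by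
      rw [E2, pY_sub x4 (hf.mul h2), pY_mul hf h2]
    unfold lap
    rw [A, B, pXY_comm h4]; linear_combination f p * e3 p
  have L4 : lap v2 p = pX f p * v1 p + pY f p * u1 p - f p ^ 2 * v2 p := by
    have A : pX (pX v2) p = (f p * pX v1 p + pX f p * v1 p) + pX (pY u2) p := by
      rw [E3, pX_add (hf.mul h2) y3, pX_mul hf h2]
    have B : pY (pY v2) p = (f p * pY u1 p + pY f p * u1 p) - pY (pX u2) p := by
      rw [E4, pY_sub (hf.mul h1) x3, pY_mul hf h1]
    unfold lap
    rw [A, B, pXY_comm h3]; linear_combination f p * e4 p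
  have hpos : ∀ p, 0 < u1 p * u1 p + v1 p * v1 p + (u2 p * u2 p + v2 p * v2 p) + δ := fun p => by
    nlinarith [mul_self_nonneg (u1 p), mul_self_nonneg (v1 p), mul_self_nonneg (u2 p), mul_self_nonneg (v2 p)]
  rw [lap_log (qn.add c3) hpos]
  have hX : pX (fun p => u1 p * u1 p + v1 p * v1 p + (u2 p * u2 p + v2 p * v2 p) + δ) p =
      2 * (u1 p * pX u1 p + v1 p * pX v1 p + u2 p * pX u2 p + v2 p * pX v2 p) := by
    rw [pX_add qn c3, pX_add q12 q34, pX_add q1 q2, pX_add q3 q4, pX_mul h1 h1, pX_mul h2 h2, pX_mul h3 h3, pX_mul h4 h4,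
      pX_const]; ring
  have hY : pY (fun p => u1 p * u1 p + v1 p * v1 p + (u2 p * u2 p + v2 p * v2 p) + δ) p =
      2 * (u1 p * pY u1 p + v1 p * pY v1 p + u2 p * pY u2 p + v2 p * pY v2 p) := by
    rw [pY_add qn c3, pY_add q12 q34, pY_add q1 q2, pY_add q3 q4, pY_mul h1 h1, pY_mul h2 h2, pY_mul h3 h3, pY_mul h4 h4,
      pY_const]; ring
  have hlc : lap (fun _ => δ) p = 0 := by unfold lap; rw [pX_const, pY_const, pX_const, pY_const]; ring
  have hL : lap (fun p => u1 p * u1 p + v1 p * v1 p + (u2 p * u2 p + v2 p * v2 p) + δ) p =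
      2 * (pX u1 p ^ 2 + pY u1 p ^ 2 + pX v1 p ^ 2 + pY v1 p ^ 2 + pX u2 p ^ 2 + pY u2 p ^ 2 + pX v2 p ^ 2 + pY v2 p ^ 2)
      - 2 * f p ^ 2 * (u1 p * u1 p + v1 p * v1 p + (u2 p * u2 p + v2 p * v2 p)) := by
    rw [lap_add qn c3, lap_add q12 q34, lap_add q1 q2, lap_add q3 q4, lap_sq h1, lap_sq h2, lap_sq h3, lap_sq h4, L1, L2, L3, L4, hlc]
    ring
  rw [hX, hY, hL]
  have e1 := e1 p
  have e2 := e2 p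
  have e3 := e3 p
  have e4 := e4 p
  have hp := hpos p
  clear hX hY hL hlc hpos L1 L2 L3 L4 E1 E2 E3 E4 E5 E6 E7 E8 neg fx
  generalize pX u1 p = a1 at *
  generalize pY u1 p = b1 at *
  generalize pX v1 p = a2 at *
  generalize pY v1 p = b2 at *
  generalize pX u2 p = a3 at *
  generalize pY u2 p = b3 at *
  generalize pX v2 p = a4 at *
  generalize pY v2 p = b4 at *
  generalize f p = F at *
  generalize u1 p = x at *
  generalize v1 p = y at *
  generalize u2 p = z at *
  generalize v2 p = w at *
  have r1 : a3 = F * x - b4 := by linarith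
  have r2 : a4 = F * y + b3 := by linarith
  have r3 : a1 = b2 - F * z := by linarith
  have r4 : a2 = -(b1 + F * w) := by linarith
  -- Y
  set n := x * x + y * y + (z * z + w * w) with hn
  set Y := (a1 + b2) ^ 2 + (a2 - b1) ^ 2 + (a3 - b4) ^ 2 + (a4 + b3) ^ 2 with hY
  have hn0 : 0 ≤ n := by
    have := mul_self_nonneg x
    have := mul_self_nonneg y
    have := mul_self_nonneg z
    have := mul_self_nonneg w
    linarith
  have hY0 : 0 ≤ Y := by positivity
  have k1 : 2 * (a1 ^ 2 + b1 ^ 2 + a2 ^ 2 + b2 ^ 2 + a3 ^ 2 + b3 ^ 2 + a4 ^ 2 + b4 ^ 2) - 2 * F ^ 2 * n = Y - F ^ 2 * n := by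
    rw [hY, hn, r1, r2, r3, r4]; ring
  have k2 : (2 * (x * a1 + y * a2 + z * a3 + w * a4)) ^ 2 + (2 * (x * b1 + y * b2 + z * b3 + w * b4)) ^ 2 ≤ n * Y := by
    have g1 : 2 * (x * a1 + y * a2 + z * a3 + w * a4) = x * (a1 + b2) + y * (a2 - b1) + z * (a3 - b4) + w * (a4 + b3) := by
      rw [r1, r2, r3, r4]; ring
    have g2 : 2 * (x * b1 + y * b2 + z * b3 + w * b4) = y * (a1 + b2) - x * (a2 - b1) + z * (a4 + b3) - w * (a3 - b4) := by
      rw [r1, r2, r3, r4]; ring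
    rw [g1, g2, hn, hY]
    generalize a1 + b2 = A
    generalize a2 - b1 = B
    generalize a3 - b4 = C
    generalize a4 + b3 = D
    have := add_nonneg (sq_nonneg (x * C + y * D - z * A - w * B)) (sq_nonneg (y * C - x * D - z * B + w * A))
    linarith only [this]
  rw [k1]
  have k3 : (n + δ)⁻¹ ^ 2 * ((2 * (x * a1 + y * a2 + z * a3 + w * a4)) ^ 2 + (2 * (x * b1 + y * b2 + z * b3 + w * b4)) ^ 2)
      ≤ (n + δ)⁻¹ ^ 2 * (n * Y) := mul_le_mul_of_nonneg_left k2 (by positivity)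
  have k4 : (n + δ)⁻¹ * (Y - F ^ 2 * n) - (n + δ)⁻¹ ^ 2 * (n * Y) + F ^ 2 = δ * (n + δ)⁻¹ ^ 2 * Y + F ^ 2 * δ * (n + δ)⁻¹ := by
    field_simp; ring
  have k5 : 0 ≤ δ * (n + δ)⁻¹ ^ 2 * Y + F ^ 2 * δ * (n + δ)⁻¹ := by positivity
  linarith

end DiracT

namespace DiracT
open MeasureTheory Filter Topology

/-- continuous periodic functions -/
structure CP (a b : ℝ) (g : ℝ × ℝ → ℝ) : Prop where
  cont : Continuous g
  p1 : ∀ p : ℝ × ℝ, g (p.1 + 1, p.2) = g p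
  p2 : ∀ p : ℝ × ℝ, g (p.1 + a, p.2 + b) = g p

lemma SP.cp {a b : ℝ} {L : ℝ × ℝ → ℝ} (h : SP a b L) : CP a b L := ⟨h.cont, h.p1, h.p2⟩

lemma CP.comp {a b : ℝ} {g : ℝ × ℝ → ℝ} (h : CP a b g) {u : ℝ → ℝ} (hu : Continuous u) : CP a b (fun p => u (g p)) :=
  ⟨hu.comp h.cont, fun p => by simp only [h.p1], fun p => by simp only [h.p2]⟩

lemma CP.comp2 {a b : ℝ} {g g' : ℝ × ℝ → ℝ} (h : CP a b g) (h' : CP a b g') {u : ℝ → ℝ → ℝ}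
    (hu : Continuous fun q : ℝ × ℝ => u q.1 q.2) : CP a b (fun p => u (g p) (g' p)) :=
  ⟨hu.comp (h.cont.prodMk h'.cont), fun p => by simp only [h.p1, h'.p1], fun p => by simp only [h.p2, h'.p2]⟩

lemma CP.exists_max {a b : ℝ} (hb : 0 < b) {g : ℝ × ℝ → ℝ} (h : CP a b g) : ∃ p, ∀ q, g q ≤ g p := by
  have hpz1 : ∀ (n : ℤ) (p : ℝ × ℝ), g (p.1 + n, p.2) = g p := by
    intro n p
    have : Function.Periodic (fun x => g (x, p.2)) 1 := fun x => h.p1 (x, p.2)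
    have := (this.int_mul n) p.1
    simpa using this
  have hpz2 : ∀ (n : ℤ) (p : ℝ × ℝ), g (p.1 + n * a, p.2 + n * b) = g p := by
    intro n p
    have : Function.Periodic (fun t : ℝ => g (p.1 + t * a, p.2 + t * b)) 1 := fun t => by
      have := h.p2 (p.1 + t * a, p.2 + t * b)
      simp only at this ⊢
      rw [← this]; congr 1; ext <;> simp <;> ring
    have := (this.int_mul n) 0
    simpa using this
  obtain ⟨p, -, hp⟩ := (isCompact_Icc.prod isCompact_Icc : IsCompact (Set.Icc (0:ℝ) 1 ×ˢ Set.Icc (0:ℝ) b)).exists_isMaxOn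
    ⟨(0, 0), by simp [hb.le]⟩ h.cont.continuousOn
  refine ⟨p, fun x => ?_⟩
  set n : ℤ := -⌊x.2 / b⌋
  set q : ℝ × ℝ := (x.1 + n * a, x.2 + n * b)
  rw [← hpz2 n x, ← hpz1 (-⌊q.1⌋) q]
  apply hp
  simp only [Set.mem_prod, Set.mem_Icc, q, n]
  push_cast
  have h1 := Int.floor_le (x.1 + -(⌊x.2 / b⌋ : ℝ) * a)
  have h2 := (Int.lt_floor_add_one (x.1 + -(⌊x.2 / b⌋ : ℝ) * a)).le
  have h3 := Int.floor_le (x.2 / b)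
  have h4 := (Int.lt_floor_add_one (x.2 / b)).le
  rw [le_div_iff₀ hb] at h3
  rw [div_le_iff₀ hb] at h4
  refine ⟨⟨?_, ?_⟩, ?_, ?_⟩ <;> linarith

/-- total density -/
noncomputable def nn (φ₁ φ₂ : ℝ × ℝ → ℂ) (p : ℝ × ℝ) : ℝ := ‖φ₁ p‖ ^ 2 + ‖φ₂ p‖ ^ 2

lemma nn_nonneg (φ₁ φ₂ : ℝ × ℝ → ℂ) (p : ℝ × ℝ) : 0 ≤ nn φ₁ φ₂ p := by unfold nn; positivity

lemma norm_sq_re_im (z : ℂ) : ‖z‖ ^ 2 = z.re * z.re + z.im * z.im := by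
  rw [← Complex.normSq_eq_norm_sq, Complex.normSq_apply]

lemma nn_smooth {a b : ℝ} {φ₁ φ₂ : ℝ × ℝ → ℂ} (h1 : SP a b φ₁) (h2 : SP a b φ₂) : SP a b (nn φ₁ φ₂) where
  smooth := by
    unfold nn
    exact (h1.smooth.norm_sq ℝ).add (h2.smooth.norm_sq ℝ)
  p1 := fun p => by simp only [nn, h1.p1, h2.p1]
  p2 := fun p => by simp only [nn, h1.p2, h2.p2]

lemma SP_lognn {a b : ℝ} {φ₁ φ₂ : ℝ × ℝ → ℂ} (h1 : SP a b φ₁) (h2 : SP a b φ₂) {δ : ℝ} (hδ : 0 < δ) :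
    SP a b (fun p => Real.log (nn φ₁ φ₂ p + δ)) where
  smooth := ((nn_smooth h1 h2).smooth.add contDiff_const).log fun p => by have := nn_nonneg φ₁ φ₂ p; positivity
  p1 := fun p => by simp only [(nn_smooth h1 h2).p1]
  p2 := fun p => by simp only [(nn_smooth h1 h2).p2]

lemma Sol.G {a b : ℝ} {f : ℝ × ℝ → ℝ} (hf : Sm f) {φ₁ φ₂ : ℝ × ℝ → ℂ} (hs : Sol a b f φ₁ φ₂) {δ : ℝ} (hδ : 0 < δ)
    (p : ℝ × ℝ) : -(f p ^ 2) ≤ lap (fun p => Real.log (nn φ₁ φ₂ p + δ)) p := by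
  have r1 : Sm (fun p => (φ₁ p).re) := Complex.reCLM.contDiff.comp hs.s1.smooth
  have r2 : Sm (fun p => (φ₁ p).im) := Complex.imCLM.contDiff.comp hs.s1.smooth
  have r3 : Sm (fun p => (φ₂ p).re) := Complex.reCLM.contDiff.comp hs.s2.smooth
  have r4 : Sm (fun p => (φ₂ p).im) := Complex.imCLM.contDiff.comp hs.s2.smooth
  have dre : ∀ {φ : ℝ × ℝ → ℂ}, SP a b φ → ∀ p v, fderiv ℝ (fun p => (φ p).re) p v = (fderiv ℝ φ p v).re := by
    intro φ hφ p v
    have := (Complex.reCLM.hasFDerivAt.comp p (hφ.diff p).hasFDerivAt).fderiv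
    simp only [Function.comp_def, Complex.reCLM_apply] at this
    rw [this]; simp
  have dim : ∀ {φ : ℝ × ℝ → ℂ}, SP a b φ → ∀ p v, fderiv ℝ (fun p => (φ p).im) p v = (fderiv ℝ φ p v).im := by
    intro φ hφ p v
    have := (Complex.imCLM.hasFDerivAt.comp p (hφ.diff p).hasFDerivAt).fderiv
    simp only [Function.comp_def, Complex.imCLM_apply] at this
    rw [this]; simp
  have := G_real hf r1 r2 r3 r4 (fun p => ?_) (fun p => ?_) (fun p => ?_) (fun p => ?_) hδ p
  · simpa only [nn, norm_sq_re_im] using this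
  · have := congrArg Complex.re (hs.e1 p)
    simp [_root_.dX, _root_.dY] at this
    simp only [pX, pY, dre hs.s2, dim hs.s2]; linarith
  · have := congrArg Complex.im (hs.e1 p)
    simp [_root_.dX, _root_.dY] at this
    simp only [pX, pY, dre hs.s2, dim hs.s2]; linarith
  · have := congrArg Complex.re (hs.e2 p)
    simp [_root_.dX, _root_.dY] at this
    simp only [pX, pY, dre hs.s1, dim hs.s1]; linarith
  · have := congrArg Complex.im (hs.e2 p)
    simp [_root_.dX, _root_.dY] at this
    simp only [pX, pY, dre hs.s1, dim hs.s1]; linarith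

lemma Av_nonneg {g : ℝ × ℝ → ℝ} (hg : Continuous g) (h : ∀ q, 0 ≤ g q) (p : ℝ × ℝ) (r : ℝ) : 0 ≤ Av p g r := by
  have := Av_mono continuous_const hg h p r
  rwa [Av_const] at this

lemma Av_le {g : ℝ × ℝ → ℝ} (hg : Continuous g) {c : ℝ} (h : ∀ q, g q ≤ c) (p : ℝ × ℝ) (r : ℝ) : Av p g r ≤ c := by
  have := Av_mono hg continuous_const h p r
  rwa [Av_const] at this

lemma aa_disc {a b : ℝ} (hb : 1 ≤ b) {g : ℝ × ℝ → ℝ} (hg : CP a b g) (h0 : ∀ p, 0 ≤ g p) (p : ℝ × ℝ) {r : ℝ} (hr : 0 ≤ r)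
    (hr2 : r ≤ 1 / 2) : aa (Av p g) r ≤ 1 / (2 * Real.pi) * ∫ q, g q ∂(muT b) :=
  (aa_monotone (Av_cont hg.cont p) (fun s _ => Av_nonneg hg.cont h0 p s) hr hr2).trans
    (disc_le hb hg.cont h0 hg.p1 hg.p2 p)

/-- small integral and bounded implies small JJ -/
lemma JJ_small {a b : ℝ} (hb : 1 ≤ b) {g : ℝ × ℝ → ℝ} (hg : CP a b g) (h0 : ∀ p, 0 ≤ g p) {B κ : ℝ}
    (hB : ∀ p, g p ≤ B ^ 2) (hκ0 : 0 ≤ κ)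
    (hκ : B ^ 2 * ∫ q, g q ∂(muT b) ≤ 4 * Real.pi * κ ^ 2) (p : ℝ × ℝ) {r : ℝ} (hr : 0 ≤ r) (hr2 : r ≤ 1 / 2) :
    JJ (Av p g) r ≤ κ / 2 := by
  have hpi := Real.pi_pos
  have hw := Av_cont hg.cont p
  have h1 : ∀ s ∈ Set.Icc 0 r, aa (Av p g) s / s ≤ κ := by
    intro s hs
    rcases hs.1.eq_or_lt with h | h
    · rw [← h]; simpa using hκ0
    rw [div_le_iff₀ h]
    have a0 : 0 ≤ aa (Av p g) s := aa_nonneg (fun s _ => Av_nonneg hg.cont h0 p s) hs.1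
    have a1 := aa_disc hb hg h0 p hs.1 (hs.2.trans hr2)
    have a2 : aa (Av p g) s ≤ B ^ 2 * s ^ 2 / 2 := aa_le hw (fun s _ => Av_le hg.cont hB p s) hs.1
    apply abs_le_of_sq_le_sq' _ (by positivity) |>.2
    have a3 : aa (Av p g) s * aa (Av p g) s ≤ (B ^ 2 * s ^ 2 / 2) * (1 / (2 * Real.pi) * ∫ q, g q ∂(muT b)) :=
      mul_le_mul a2 a1 a0 (by positivity)
    have a4 : (B ^ 2 * s ^ 2 / 2) * (1 / (2 * Real.pi) * ∫ q, g q ∂(muT b)) = s ^ 2 / (4 * Real.pi) * (B ^ 2 * ∫ q, g q ∂(muT b)) := by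
      field_simp; ring
    have a5 : s ^ 2 / (4 * Real.pi) * (B ^ 2 * ∫ q, g q ∂(muT b)) ≤ s ^ 2 / (4 * Real.pi) * (4 * Real.pi * κ ^ 2) :=
      mul_le_mul_of_nonneg_left hκ (by positivity)
    have a6 : s ^ 2 / (4 * Real.pi) * (4 * Real.pi * κ ^ 2) = (κ * s) ^ 2 := by field_simp
    rw [sq]; linarith
  have h2 : JJ (Av p g) r ≤ ∫ _ in (0:ℝ)..r, κ :=
    intervalIntegral.integral_mono_on hr ((aa_div_cont hw).intervalIntegrable _ _) (by simp) h1
  simp only [intervalIntegral.integral_const, sub_zero, smul_eq_mul] at h2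
  nlinarith

/-- the rough uniform bound -/
lemma rough {a b : ℝ} (hb : 1 ≤ b) {L μ : ℝ × ℝ → ℝ} (hL : SP a b L) (hμ : CP a b μ) (h : ∀ q, -μ q ≤ lap L q)
    (h0 : ∀ q, 0 ≤ μ q) {B θ : ℝ} (hB : 2 ≤ B) (hμB : ∀ q, μ q ≤ B ^ 2)
    (hθ : ∫ q, μ q ∂(muT b) ≤ 2 * Real.pi * θ) (hE : ∫ q, Real.exp (L q) ^ 2 ∂(muT b) ≤ 2 * Real.pi)
    (hBθ : Real.log 4 + θ * Real.log B ≤ Real.log B) (p : ℝ × ℝ) : Real.exp (L p) ≤ B := by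
  have hpi := Real.pi_pos
  have hB0 : 0 < B := by linarith
  have hw := Av_cont hμ.cont p
  have hn := fun s (_ : 0 ≤ s) => Av_nonneg hμ.cont h0 p s
  have hiB : 1 / B ≤ 1 / 2 := one_div_le_one_div_of_le (by norm_num) hB
  have hiB0 : 0 < 1 / B := by positivity
  have hθ0 : 0 ≤ θ := by
    have : 0 ≤ ∫ q, μ q ∂(muT b) := integral_nonneg h0
    by_contra! hc
    nlinarith
  have hJ : JJ (Av p μ) (1 / 2) ≤ 1 / 4 + θ * Real.log (B / 2) := by
    have s1 : JJ (Av p μ) (1 / B) ≤ 1 / 4 := by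
      refine (JJ_le hw (fun s _ => Av_le hμ.cont hμB p s) hiB0.le).trans_eq ?_
      field_simp
    have s2 : ∫ s in (1 / B)..(1 / 2), aa (Av p μ) s / s ≤ ∫ s in (1 / B)..(1 / 2), θ * s⁻¹ := by
      apply intervalIntegral.integral_mono_on hiB ((aa_div_cont hw).intervalIntegrable _ _)
      · apply IntervalIntegrable.const_mul
        apply intervalIntegral.intervalIntegrable_inv
        · intro s hs
          rw [Set.uIcc_of_le hiB] at hs
          exact (hiB0.trans_le hs.1).ne'
        · exact continuousOn_id
      · intro s hs
        rw [← div_eq_mul_inv]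
        have hs0 : 0 ≤ s := hiB0.le.trans hs.1
        refine div_le_div_of_nonneg_right ((aa_disc hb hμ h0 p hs0 hs.2).trans ?_) hs0
        rw [one_div_mul_eq_div, div_le_iff₀ (by positivity)]; linarith
    rw [intervalIntegral.integral_const_mul, integral_inv_of_pos hiB0 (by norm_num)] at s2
    have s3 : (1:ℝ) / 2 / (1 / B) = B / 2 := by field_simp
    rw [s3] at s2
    have s4 := intervalIntegral.integral_add_adjacent_intervals ((aa_div_cont hw).intervalIntegrable (μ := volume) 0 (1 / B))
      ((aa_div_cont hw).intervalIntegrable (1 / B) (1 / 2))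
    unfold JJ at s1 ⊢
    linarith
  have hJm : ∀ r, 0 ≤ r → r ≤ 1 / 2 → JJ (Av p μ) r ≤ 1 / 4 + θ * Real.log (B / 2) := by
    intro r hr hr2
    refine le_trans ?_ hJ
    have s4 := intervalIntegral.integral_add_adjacent_intervals ((aa_div_cont hw).intervalIntegrable (μ := volume) 0 r)
      ((aa_div_cont hw).intervalIntegrable r (1 / 2))
    have s5 : 0 ≤ ∫ s in r..(1 / 2), aa (Av p μ) s / s :=
      intervalIntegral.integral_nonneg hr2 fun s hs => div_nonneg (aa_nonneg hn (hr.trans hs.1)) (hr.trans hs.1)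
    unfold JJ
    linarith
  have hlog2 : Real.log (B / 2) = Real.log B - Real.log 2 := Real.log_div hB0.ne' (by norm_num)
  have hl2 : 0 < Real.log 2 := Real.log_pos (by norm_num)
  have hEc : CP a b (fun q => Real.exp (L q) ^ 2) := hL.cp.comp (u := fun x => Real.exp x ^ 2) (by fun_prop)
  set c := Real.exp (2 * (L p - (1 / 4 + θ * Real.log B))) with hc
  have hlow : c / 8 ≤ aa (Av p (fun q => Real.exp (L q) ^ 2)) (1 / 2) := by
    have : aa (fun s => min c (Av p (fun q => Real.exp (L q) ^ 2) s)) (1 / 2) ≤ aa (Av p (fun q => Real.exp (L q) ^ 2)) (1 / 2) :=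
      aa_mono (continuous_const.min (Av_cont hEc.cont p)) (Av_cont hEc.cont p) (fun s _ => min_le_right _ _) (by norm_num)
    refine le_trans (le_of_eq ?_) this
    have e : aa (fun s => min c (Av p (fun q => Real.exp (L q) ^ 2) s)) (1 / 2) = aa (fun _ => c) (1 / 2) := by
      unfold aa
      apply intervalIntegral.integral_congr
      intro s hs
      rw [Set.uIcc_of_le (by norm_num)] at hs
      simp only
      rw [min_eq_left]
      refine le_trans ?_ (Av_exp_ge hL.cont p s)
      rw [hc]
      apply Real.exp_le_exp.2
      have := Av_lower hL.smooth hμ.cont h p hs.1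
      have := hJm s hs.1 hs.2
      nlinarith
    rw [e, aa_const]; ring
  have hup := disc_le hb hEc.cont (fun q => by positivity) hEc.p1 hEc.p2 p
  have hc8 : c ≤ 8 := by
    have : 1 / (2 * Real.pi) * ∫ q, Real.exp (L q) ^ 2 ∂(muT b) ≤ 1 := by
      rw [one_div_mul_eq_div, div_le_iff₀ (by positivity)]; linarith
    linarith
  have hlc : 2 * (L p - (1 / 4 + θ * Real.log B)) ≤ Real.log 8 := by
    rw [Real.le_log_iff_exp_le (by norm_num)]; exact hc8
  have h8 : Real.log 8 = 3 * Real.log 2 := by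
    rw [show (8:ℝ) = 2 ^ 3 by norm_num, Real.log_pow]; norm_num
  have h4 : Real.log 4 = 2 * Real.log 2 := by
    rw [show (4:ℝ) = 2 ^ 2 by norm_num, Real.log_pow]; norm_num
  have := Real.log_two_gt_d9
  rw [← Real.le_log_iff_exp_le hB0]
  linarith

/-- the sharp bound -/
lemma sharp {a b : ℝ} (hb : 1 ≤ b) {L μ : ℝ × ℝ → ℝ} (hL : SP a b L) (hμ : CP a b μ) (h : ∀ q, -μ q ≤ lap L q)
    (h0 : ∀ q, 0 ≤ μ q) {B : ℝ} (hμB : ∀ q, μ q ≤ B ^ 2)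
    (hρ : B ^ 2 * ∫ q, |μ q - Real.exp (L q) ^ 2| ∂(muT b) ≤ 4 * Real.pi * 0.01 ^ 2)
    (hE : ∫ q, Real.exp (L q) ^ 2 ∂(muT b) < 2 * Real.pi) (q : ℝ × ℝ) : Real.exp (L q) ≤ 4.28 := by
  have hpi := Real.pi_pos
  obtain ⟨p, hp⟩ := hL.cp.exists_max (by linarith)
  refine (Real.exp_le_exp.2 (hp q)).trans ?_
  have hEc : CP a b (fun q => Real.exp (L q) ^ 2) := hL.cp.comp (u := fun x => Real.exp x ^ 2) (by fun_prop)
  have hρc : CP a b (fun q => max (μ q - Real.exp (L q) ^ 2) 0) :=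
    hμ.comp2 hEc (u := fun x y => max (x - y) 0) (by fun_prop)
  have hρa : CP a b (fun q => |μ q - Real.exp (L q) ^ 2|) :=
    hμ.comp2 hEc (u := fun x y => |x - y|) (by fun_prop)
  have hV := Av_cont hEc.cont p
  have hVn := fun s (_ : 0 ≤ s) => Av_nonneg hEc.cont (fun q => by positivity) p s
  have hVF := fun s (_ : 0 ≤ s) => Av_le hEc.cont (c := Real.exp (L p) ^ 2)
    (fun q => by have := Real.exp_le_exp.2 (hp q); gcongr) p s
  have hIntg : B ^ 2 * ∫ q, max (μ q - Real.exp (L q) ^ 2) 0 ∂(muT b) ≤ 4 * Real.pi * 0.01 ^ 2 := by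
    refine le_trans (mul_le_mul_of_nonneg_left ?_ (sq_nonneg B)) hρ
    apply integral_mono (integrable_muT hρc.cont b) (integrable_muT hρa.cont b)
    intro q
    exact max_le (le_abs_self _) (abs_nonneg _)
  have hJ := fun r (hr : 0 ≤ r) (hr2 : r ≤ 1 / 2) => JJ_small hb hρc (fun q => le_max_right _ _) (B := B) (κ := 0.01)
    (fun q => max_le (by have := hμB q; have := sq_nonneg (Real.exp (L q)); linarith) (sq_nonneg B)) (by norm_num) hIntg p hr hr2
  refine sup_bound (V := Av p (fun q => Real.exp (L q) ^ 2)) (a := aa (Av p (fun q => Real.exp (L q) ^ 2)))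
    (J := JJ (Av p (fun q => Real.exp (L q) ^ 2))) (ε := 0.01) (Real.exp_pos _) le_rfl
    (fun r _ => aa_deriv hV r) (fun r _ => JJ_deriv hV r) (fun r hr => aa_nonneg hVn hr.le) (fun r hr => aa_le hV hVF hr.le)
    (fun r hr => JJ_nonneg hVn hr.le) (fun r hr => JJ_le hV hVF hr.le) ?_ ?_
  · intro r hr hr2
    refine le_trans ?_ (Av_exp_ge hL.cont p r)
    rw [← Real.exp_add, ← Real.exp_nat_mul, ← Real.exp_add]
    apply Real.exp_le_exp.2
    have e1 := Av_lower hL.smooth hμ.cont h p hr.le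
    have e2 : JJ (Av p μ) r ≤ JJ (fun s => Av p (fun q => Real.exp (L q) ^ 2) s + Av p (fun q => max (μ q - Real.exp (L q) ^ 2) 0) s) r := by
      apply JJ_mono (Av_cont hμ.cont p) (hV.add (Av_cont hρc.cont p)) _ hr.le
      intro s _
      rw [Pi.add_apply, ← Av_add hEc.cont hρc.cont]
      apply Av_mono hμ.cont (hEc.cont.add hρc.cont)
      intro q
      have := le_max_left (μ q - Real.exp (L q) ^ 2) 0
      change μ q ≤ Real.exp (L q) ^ 2 + max (μ q - Real.exp (L q) ^ 2) 0
      linarith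
    rw [JJ_add hV (Av_cont hρc.cont p)] at e2
    have e3 := hJ r hr.le hr2
    push_cast
    linarith
  · refine (disc_le hb hEc.cont (fun q => by positivity) hEc.p1 hEc.p2 p).trans_lt ?_
    rw [one_div_mul_eq_div, div_lt_iff₀ (by positivity)]; linarith

end DiracT

namespace DiracT
open MeasureTheory Filter Topology

/-- normalized state -/
structure St (a b : ℝ) (L : ℝ × ℝ → ℝ) (φ₁ φ₂ : ℝ × ℝ → ℂ) : Prop where
  sp : SP a b L
  sol : Sol a b (fun p => Real.exp (L p)) φ₁ φ₂
  ne : ∃ p, φ₁ p ≠ 0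
  test : ∀ (h : ℝ × ℝ → ℝ) (ψ₁ ψ₂ : ℝ × ℝ → ℂ), Sol a b h ψ₁ ψ₂ → Continuous h →
    ∫ p, h p * nn ψ₁ ψ₂ p ∂(muT b) ≤ ∫ p, h p ^ 2 * nn ψ₁ ψ₂ p * Real.exp (-L p) ∂(muT b)

lemma Sol.pos {a b : ℝ} (hb : 0 < b) {L : ℝ × ℝ → ℝ} (hL : SP a b L) {φ₁ φ₂ : ℝ × ℝ → ℂ}
    (hs : Sol a b (fun p => Real.exp (L p)) φ₁ φ₂) (hne : ∃ p, φ₁ p ≠ 0 ∨ φ₂ p ≠ 0) :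
    0 < ∫ p, Real.exp (L p) * nn φ₁ φ₂ p ∂(muT b) ∧ 0 < ∫ p, Real.exp (L p) * ‖φ₂ p‖ ^ 2 ∂(muT b) := by
  have c0 : Continuous fun p => Real.exp (L p) := Real.continuous_exp.comp hL.cont
  have c1 : Continuous fun p => ‖φ₁ p‖ ^ 2 := (hs.s1.cont.norm.pow 2)
  have c2 : Continuous fun p => ‖φ₂ p‖ ^ 2 := (hs.s2.cont.norm.pow 2)
  have key : 0 < ∫ p, Real.exp (L p) * nn φ₁ φ₂ p ∂(muT b) := by
    have hn := nn_smooth hs.s1 hs.s2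
    have h0 : ∀ p, 0 ≤ Real.exp (L p) * nn φ₁ φ₂ p := fun p => mul_nonneg (Real.exp_pos _).le (nn_nonneg _ _ _)
    refine lt_of_le_of_ne (integral_nonneg h0) fun h => ?_
    have := integral_pos_of (a := a) hb (g := fun p => Real.exp (L p) * nn φ₁ φ₂ p) (c0.mul hn.cont) h0 (fun p => by simp only [hL.p1, hn.p1])
      (fun p => by simp only [hL.p2, hn.p2]) h.symm
    obtain ⟨p, hp⟩ := hne
    have h2 : nn φ₁ φ₂ p = 0 := by
      rcases mul_eq_zero.1 (this p) with h | h
      · exact absurd h (Real.exp_pos _).ne'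
      · exact h
    unfold nn at h2
    rcases hp with hp | hp
    · have := norm_pos_iff.2 hp
      nlinarith [sq_nonneg ‖φ₂ p‖]
    · have := norm_pos_iff.2 hp
      nlinarith [sq_nonneg ‖φ₁ p‖]
  refine ⟨key, ?_⟩
  have e := hs.int_eq hb
  unfold nn at key
  simp only [mul_add] at key
  have i1 : Integrable (fun p => Real.exp (L p) * ‖φ₁ p‖ ^ 2) (muT b) := integrable_muT (c0.mul c1) b
  have i2 : Integrable (fun p => Real.exp (L p) * ‖φ₂ p‖ ^ 2) (muT b) := integrable_muT (c0.mul c2) b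
  rw [integral_add i1 i2, e] at key
  linarith

lemma exists_St {a b : ℝ} (hb : 0 < b) {L K : ℝ × ℝ → ℝ} (hL : SP a b L) (hK : SP a b K) {φ₁ φ₂ : ℝ × ℝ → ℂ}
    (hs : Sol a b (fun p => Real.exp (L p)) φ₁ φ₂) (hne : ∃ p, φ₁ p ≠ 0 ∨ φ₂ p ≠ 0) :
    ∃ c ψ₁ ψ₂, St a b (fun p => K p - c) ψ₁ ψ₂ := by
  obtain ⟨R, hR, ⟨ψ₁, ψ₂, hsol, hn⟩, ht⟩ := spectral hb hK ⟨_, φ₁, φ₂, hs, (hs.pos hb hL hne).2⟩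
  have hlog : Real.exp (Real.log R) = R := Real.exp_log hR
  refine ⟨Real.log R, ψ₁, ψ₂, ⟨⟨hK.smooth.sub contDiff_const, fun p => by simp only [hK.p1], fun p => by simp only [hK.p2]⟩, ?_, hn, ?_⟩⟩
  · simpa only [Real.exp_sub, hlog] using hsol
  · intro h χ₁ χ₂ h1 h2
    refine (ht h χ₁ χ₂ h1 h2).trans_eq ?_
    rw [← integral_const_mul]
    congr 1; ext p
    rw [show -(K p - Real.log R) = -K p + Real.log R by ring, Real.exp_add, hlog]
    unfold nn; ring

/-- energy -/
noncomputable def En (b : ℝ) (L : ℝ × ℝ → ℝ) : ℝ := ∫ p, Real.exp (L p) ^ 2 ∂(muT b)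

lemma St_init {a b : ℝ} (hb : 0 < b) {L : ℝ × ℝ → ℝ} (hL : SP a b L) {φ₁ φ₂ : ℝ × ℝ → ℂ}
    (hs : Sol a b (fun p => Real.exp (L p)) φ₁ φ₂) (hne : ∃ p, φ₁ p ≠ 0 ∨ φ₂ p ≠ 0) :
    ∃ L' ψ₁ ψ₂, St a b L' ψ₁ ψ₂ ∧ En b L' ≤ En b L := by
  obtain ⟨c, ψ₁, ψ₂, h⟩ := exists_St hb hL hL hs hne
  refine ⟨_, ψ₁, ψ₂, h, ?_⟩
  have h1 := h.test _ φ₁ φ₂ hs (Real.continuous_exp.comp hL.cont)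
  have h2 : ∀ p, Real.exp (L p) ^ 2 * nn φ₁ φ₂ p * Real.exp (-(L p - c)) = Real.exp c * (Real.exp (L p) * nn φ₁ φ₂ p) := fun p => by
    have : Real.exp (L p) ^ 2 * Real.exp (-(L p - c)) = Real.exp c * Real.exp (L p) := by
      rw [← Real.exp_nat_mul, ← Real.exp_add, ← Real.exp_add]; congr 1; push_cast; ring
    linear_combination nn φ₁ φ₂ p * this
  simp only [h2] at h1
  rw [integral_const_mul] at h1
  have h3 := (hs.pos hb hL hne).1
  have hc : 0 ≤ c := by
    by_contra! hc
    have : Real.exp c < 1 := by simpa using hc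
    nlinarith
  unfold En
  have cL := hL.cont
  apply integral_mono (integrable_muT (by fun_prop) b) (integrable_muT (by fun_prop) b)
  intro p
  have : Real.exp (L p - c) ≤ Real.exp (L p) := Real.exp_le_exp.2 (by linarith)
  simp only
  gcongr

lemma St_step {a b : ℝ} (hb : 0 < b) {L : ℝ × ℝ → ℝ} {φ₁ φ₂ : ℝ × ℝ → ℂ} (h : St a b L φ₁ φ₂) {ε : ℝ} (hε : 0 < ε) :
    ∃ L' ψ₁ ψ₂, St a b L' ψ₁ ψ₂ ∧
      En b L' + ∫ p, (Real.exp (L' p) - Real.exp (L p)) ^ 2 ∂(muT b) ≤ En b L + ε ∧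
      ∀ μ : ℝ × ℝ → ℝ, (∀ p, -μ p ≤ lap L p) → ∀ p, -(2 / 3 * μ p + 1 / 3 * Real.exp (L p) ^ 2) ≤ lap L' p := by
  have hne : ∃ p, φ₁ p ≠ 0 ∨ φ₂ p ≠ 0 := h.ne.imp fun p hp => Or.inl hp
  have hn := nn_smooth h.sol.s1 h.sol.s2
  have cL := h.sp.cont
  have cn := hn.cont
  have sf : Sm (fun p => Real.exp (L p)) := h.sp.smooth.exp
  obtain ⟨P, hP⟩ : ∃ P, P = ∫ p, Real.exp (L p) * nn φ₁ φ₂ p ∂(muT b) := ⟨_, rfl⟩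
  have hP0 : 0 < P := by rw [hP]; exact (h.sol.pos hb h.sp hne).1
  -- reference weight
  obtain ⟨Q, hQ⟩ : ∃ Q, Q = ∫ p, Real.exp (2 * L p + Real.log (nn φ₁ φ₂ p + 1)) ^ ((2:ℝ)/3) ∂(muT b) := ⟨_, rfl⟩
  obtain ⟨W, hW⟩ : ∃ W, W = ∫ p, Real.exp (L p) ∂(muT b) := ⟨_, rfl⟩
  have hW0 : 0 ≤ W := by rw [hW]; exact integral_nonneg fun p => (Real.exp_pos _).le
  have hQ0 : 0 ≤ Q := by rw [hQ]; exact integral_nonneg fun p => by positivity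
  set C := Q / P with hC
  have hC0 : 0 ≤ C := by positivity
  set δ := min 1 (ε / (2 * (C ^ 3 * W + 1))) with hδ
  have hδ0 : 0 < δ := by positivity
  have hδ1 : δ ≤ 1 := min_le_left _ _
  have hδε : 2 * (C ^ 3 * (δ * W)) ≤ ε := by
    have h1 : δ ≤ ε / (2 * (C ^ 3 * W + 1)) := min_le_right _ _
    rw [le_div_iff₀ (by positivity)] at h1
    nlinarith
  have hl := SP_lognn h.sol.s1 h.sol.s2 hδ0
  have cl := hl.cont
  set M : ℝ × ℝ → ℝ := fun p => Real.log (nn φ₁ φ₂ p + δ) with hM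
  have hexpM : ∀ p, Real.exp (M p) = nn φ₁ φ₂ p + δ := fun p => by
    have := nn_nonneg φ₁ φ₂ p
    exact Real.exp_log (by positivity)
  have hK : SP a b (fun p => 2 / 3 * L p + 1 / 3 * M p + 0) :=
    ⟨((contDiff_const.mul h.sp.smooth).add (contDiff_const.mul hl.smooth)).add contDiff_const,
      fun p => by simp only [h.sp.p1, hl.p1], fun p => by simp only [h.sp.p2, hl.p2]⟩
  obtain ⟨c, ψ₁, ψ₂, h'⟩ := exists_St hb h.sp hK h.sol hne
  have hLe : (fun p => 2 / 3 * L p + 1 / 3 * M p + 0 - c) = fun p => 2 / 3 * L p + 1 / 3 * M p + (-c) := by ext p; ring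
  rw [hLe] at h'
  refine ⟨_, ψ₁, ψ₂, h', ?_, ?_⟩
  · -- energy
    set L' : ℝ × ℝ → ℝ := fun p => 2 / 3 * L p + 1 / 3 * M p + (-c) with hL'
    have cL' : Continuous L' := h'.sp.cont
    have hcube : ∀ p, Real.exp (L' p) ^ 3 = Real.exp (-c) ^ 3 * (Real.exp (L p) ^ 2 * (nn φ₁ φ₂ p + δ)) := fun p => by
      rw [← hexpM]
      simp only [← Real.exp_nat_mul, ← Real.exp_add]
      congr 1; simp only [hL']; push_cast; ring
    have ht := h'.test _ φ₁ φ₂ h.sol (Real.continuous_exp.comp cL)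
    rw [← hP] at ht
    have hinv : ∀ p, Real.exp (-L' p) * Real.exp (L' p) = 1 := fun p => by rw [← Real.exp_add]; simp
    have hpt : ∀ p, Real.exp (-c) ^ 3 * (Real.exp (L p) ^ 2 * nn φ₁ φ₂ p * Real.exp (-L' p)) ≤ Real.exp (L' p) ^ 2 := fun p => by
      have e1 : Real.exp (L' p) ^ 2 = Real.exp (-L' p) * Real.exp (L' p) ^ 3 := by
        linear_combination - Real.exp (L' p) ^ 2 * hinv p
      rw [e1, hcube]
      have : 0 ≤ Real.exp (-L' p) * (Real.exp (-c) ^ 3 * (Real.exp (L p) ^ 2 * δ)) := by positivity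
      linarith
    have hmain : Real.exp (-c) ^ 3 * P ≤ En b L' := by
      have h1 : Real.exp (-c) ^ 3 * P ≤ Real.exp (-c) ^ 3 * ∫ p, Real.exp (L p) ^ 2 * nn φ₁ φ₂ p * Real.exp (-L' p) ∂(muT b) :=
        mul_le_mul_of_nonneg_left ht (by positivity)
      rw [← integral_const_mul] at h1
      refine h1.trans (integral_mono (integrable_muT (by fun_prop) b) (integrable_muT (by fun_prop) b) hpt)
    -- bound on exp(-c)
    have hEQ : En b L' ≤ Real.exp (-c) ^ 2 * Q := by
      rw [hQ, ← integral_const_mul]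
      unfold En
      have cq : Continuous fun p => Real.log (nn φ₁ φ₂ p + 1) := (SP_lognn h.sol.s1 h.sol.s2 one_pos).cont
      simp only [← Real.exp_mul, ← Real.exp_nat_mul]
      apply integral_mono (integrable_muT (by fun_prop) b) (integrable_muT (by fun_prop) b)
      intro p
      simp only [← Real.exp_add]
      apply Real.exp_le_exp.2
      have : M p ≤ Real.log (nn φ₁ φ₂ p + 1) := Real.log_le_log (by have := nn_nonneg φ₁ φ₂ p; positivity) (by linarith)
      simp only [hL']; push_cast; linarith
    have hec : Real.exp (-c) ≤ C := by
      rw [hC, le_div_iff₀ hP0]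
      have h1 : Real.exp (-c) ^ 2 * (Real.exp (-c) * P) ≤ Real.exp (-c) ^ 2 * Q := by
        calc _ = Real.exp (-c) ^ 3 * P := by ring
          _ ≤ _ := hmain.trans hEQ
      exact le_of_mul_le_mul_left h1 (by positivity)
    have hec3 : Real.exp (-c) ^ 3 ≤ C ^ 3 := by gcongr
    -- pointwise
    have hpw : ∀ p, 3 * Real.exp (L' p) ^ 2 - Real.exp (L p) ^ 2 + (Real.exp (L' p) - Real.exp (L p)) ^ 2 ≤
        2 * (Real.exp (-c) ^ 3 * (Real.exp (L p) * nn φ₁ φ₂ p)) + 2 * (Real.exp (-c) ^ 3 * δ) * Real.exp (L p) := fun p => by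
      have hc := hcube p
      have hx := Real.exp_pos (L' p)
      have hy := Real.exp_pos (L p)
      generalize Real.exp (L' p) = x at *
      generalize Real.exp (L p) = y at *
      generalize Real.exp (-c) ^ 3 = e at *
      generalize nn φ₁ φ₂ p = n at *
      have h1 : e * (y * n) + e * δ * y = x ^ 3 / y := by
        rw [hc]; field_simp
      have h2 : 2 * (x ^ 3 / y) - (3 * x ^ 2 - y ^ 2 + (x - y) ^ 2) = 2 * (x * (x - y) ^ 2 / y) := by field_simp; ring
      have h3 : 0 ≤ x * (x - y) ^ 2 / y := by positivity
      linarith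
    have i1 : Integrable (fun p => Real.exp (L' p) ^ 2) (muT b) := integrable_muT (by fun_prop) b
    have i2 : Integrable (fun p => Real.exp (L p) ^ 2) (muT b) := integrable_muT (by fun_prop) b
    have i3 : Integrable (fun p => (Real.exp (L' p) - Real.exp (L p)) ^ 2) (muT b) := integrable_muT (by fun_prop) b
    have i4 : Integrable (fun p => Real.exp (L p) * nn φ₁ φ₂ p) (muT b) := integrable_muT (by fun_prop) b
    have i5 : Integrable (fun p => Real.exp (L p)) (muT b) := integrable_muT (by fun_prop) b
    have hI := integral_mono (((i1.const_mul 3).sub i2).add i3)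
      (((i4.const_mul (Real.exp (-c) ^ 3)).const_mul 2).add (i5.const_mul (2 * (Real.exp (-c) ^ 3 * δ)))) hpw
    have r1 : ∫ p, (3 * Real.exp (L' p) ^ 2 - Real.exp (L p) ^ 2 + (Real.exp (L' p) - Real.exp (L p)) ^ 2) ∂(muT b) =
        3 * En b L' - En b L + ∫ p, (Real.exp (L' p) - Real.exp (L p)) ^ 2 ∂(muT b) := by
      have i6 : Integrable (fun p => 3 * Real.exp (L' p) ^ 2 - Real.exp (L p) ^ 2) (muT b) := (i1.const_mul 3).sub i2
      rw [integral_add i6 i3, integral_sub (i1.const_mul 3) i2, integral_const_mul]; rfl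
    have r2 : ∫ p, (2 * (Real.exp (-c) ^ 3 * (Real.exp (L p) * nn φ₁ φ₂ p)) + 2 * (Real.exp (-c) ^ 3 * δ) * Real.exp (L p)) ∂(muT b) =
        2 * (Real.exp (-c) ^ 3 * P) + 2 * (Real.exp (-c) ^ 3 * δ) * W := by
      rw [integral_add ((i4.const_mul (Real.exp (-c) ^ 3)).const_mul 2) (i5.const_mul (2 * (Real.exp (-c) ^ 3 * δ))),
        integral_const_mul, integral_const_mul, integral_const_mul, hP, hW]
    have hI2 := (r1.symm.le.trans hI).trans r2.le
    have hfin : Real.exp (-c) ^ 3 * (δ * W) ≤ C ^ 3 * (δ * W) := mul_le_mul_of_nonneg_right hec3 (by positivity)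
    linarith
  · intro μ hμ p
    have := lap_comb h.sp.smooth hl.smooth (2 / 3) (1 / 3) (-c) p
    rw [this]
    have g := h.sol.G sf hδ0 p
    have := hμ p
    linarith

end DiracT

namespace DiracT
open MeasureTheory Filter Topology

lemma seq_small {u d : ℕ → ℝ} (h0 : ∀ k, 0 ≤ u k) (h : ∀ k, u (k + 1) ≤ 2 / 3 * u k + d k)
    (hd : ∀ ε > 0, ∃ k0, ∀ k ≥ k0, d k ≤ ε) : ∀ ε > 0, ∃ k0, ∀ k ≥ k0, u k ≤ ε := by
  intro ε hε
  obtain ⟨k1, hk1⟩ := hd (ε / 6) (by positivity)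
  have h1 : ∀ j, u (k1 + j) - ε / 2 ≤ (2 / 3) ^ j * u k1 := by
    intro j
    induction j with
    | zero => simp; linarith
    | succ j ih =>
      have e1 := h (k1 + j)
      have e2 := hk1 (k1 + j) (by omega)
      rw [pow_succ, ← add_assoc]
      linarith
  have h2 : Tendsto (fun j : ℕ => (2 / 3 : ℝ) ^ j * u k1) atTop (𝓝 0) := by
    have := (tendsto_pow_atTop_nhds_zero_of_lt_one (r := (2 / 3 : ℝ)) (by norm_num) (by norm_num)).mul_const (u k1)
    simpa using this
  obtain ⟨j0, hj0⟩ := eventually_atTop.1 (h2.eventually_le_const (show (0:ℝ) < ε / 2 by positivity))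
  refine ⟨k1 + j0, fun k hk => ?_⟩
  obtain ⟨j, rfl⟩ : ∃ j, k = k1 + j := ⟨k - k1, by omega⟩
  have := hj0 j (by omega)
  have := h1 j
  linarith

lemma CP_lap {a b : ℝ} {L : ℝ × ℝ → ℝ} (hL : SP a b L) : CP a b (lap L) := by
  have h1 := ((hL.pd (1, 0)).pd (1, 0)).cp
  have h2 := ((hL.pd (0, 1)).pd (0, 1)).cp
  exact h1.comp2 h2 (u := fun x y => x + y) (by fun_prop)

/-- iterated curvature bounds -/
noncomputable def mus (M : ℝ) (L : ℕ → ℝ × ℝ → ℝ) : ℕ → ℝ × ℝ → ℝ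
  | 0 => fun _ => M
  | k + 1 => fun p => 2 / 3 * mus M L k p + 1 / 3 * Real.exp (L k p) ^ 2

theorem core {a b : ℝ} (hb : 2 * Real.pi < b) {L : ℝ × ℝ → ℝ} (hL : SP a b L) {φ₁ φ₂ : ℝ × ℝ → ℂ}
    (hs : Sol a b (fun p => Real.exp (L p)) φ₁ φ₂) (hne : ∃ p, φ₁ p ≠ 0 ∨ φ₂ p ≠ 0) :
    4 * Real.pi ^ 2 / b ≤ En b L := by
  by_contra! hcon
  have hpi := Real.pi_gt_three
  have hb0 : 0 < b := by linarith
  have hb1 : 1 ≤ b := by linarith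
  obtain ⟨L0, χ₁, χ₂, hSt0, hE0⟩ := St_init hb0 hL hs hne
  obtain ⟨η, hη⟩ : ∃ η, η = (4 * Real.pi ^ 2 / b - En b L) / 2 := ⟨_, rfl⟩
  have hη0 : 0 < η := by rw [hη]; linarith
  obtain ⟨Es, hEs⟩ : ∃ Es, Es = En b L + η := ⟨_, rfl⟩
  have hEs1 : Es < 4 * Real.pi ^ 2 / b := by rw [hEs]; linarith
  have hEs2 : Es < 2 * Real.pi := by
    refine hEs1.trans ?_
    rw [div_lt_iff₀ hb0]; nlinarith
  have hstep : ∀ (k : ℕ) (s : {L // ∃ φ₁ φ₂, St a b L φ₁ φ₂}), ∃ s' : {L // ∃ φ₁ φ₂, St a b L φ₁ φ₂},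
      En b s'.1 + ∫ p, (Real.exp (s'.1 p) - Real.exp (s.1 p)) ^ 2 ∂(muT b) ≤ En b s.1 + η / 2 ^ (k + 1) ∧
      ∀ μ : ℝ × ℝ → ℝ, (∀ p, -μ p ≤ lap s.1 p) → ∀ p, -(2 / 3 * μ p + 1 / 3 * Real.exp (s.1 p) ^ 2) ≤ lap s'.1 p := by
    rintro k ⟨K, ψ₁, ψ₂, hK⟩
    obtain ⟨K', ζ₁, ζ₂, h1, h2, h3⟩ := St_step hb0 hK (ε := η / 2 ^ (k + 1)) (by positivity)
    exact ⟨⟨K', ζ₁, ζ₂, h1⟩, h2, h3⟩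
  choose nxt hn1 hn2 using hstep
  obtain ⟨sq, sq0, sqs⟩ : ∃ sq : ℕ → {L // ∃ φ₁ φ₂, St a b L φ₁ φ₂}, sq 0 = ⟨L0, χ₁, χ₂, hSt0⟩ ∧ ∀ k, sq (k + 1) = nxt k (sq k) :=
    ⟨fun n => Nat.rec ⟨L0, χ₁, χ₂, hSt0⟩ (fun k s => nxt k s) n, rfl, fun k => rfl⟩
  obtain ⟨S, hS⟩ : ∃ S : ℕ → ℝ × ℝ → ℝ, ∀ k, S k = (sq k).1 := ⟨fun k => (sq k).1, fun k => rfl⟩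
  have hS0 : S 0 = L0 := by rw [hS, sq0]
  have hSt : ∀ k, ∃ φ₁ φ₂, St a b (S k) φ₁ φ₂ := fun k => by rw [hS]; exact (sq k).2
  have hsp : ∀ k, SP a b (S k) := fun k => by obtain ⟨_, _, h⟩ := hSt k; exact h.sp
  obtain ⟨D, hD⟩ : ∃ D : ℕ → ℝ, ∀ k, D k = ∫ p, (Real.exp (S (k + 1) p) - Real.exp (S k p)) ^ 2 ∂(muT b) := ⟨_, fun k => rfl⟩
  have hD0 : ∀ k, 0 ≤ D k := fun k => by rw [hD]; exact integral_nonneg fun p => sq_nonneg _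
  have hEstep : ∀ k, En b (S (k + 1)) + D k ≤ En b (S k) + η / 2 ^ (k + 1) := fun k => by
    have := hn1 k (sq k)
    rw [← sqs, ← hS, ← hS] at this
    rw [hD]; exact this
  have hlap : ∀ k (μ : ℝ × ℝ → ℝ), (∀ p, -μ p ≤ lap (S k) p) → ∀ p, -(2 / 3 * μ p + 1 / 3 * Real.exp (S k p) ^ 2) ≤ lap (S (k + 1)) p := fun k => by
    have := hn2 k (sq k)
    rw [← sqs, ← hS, ← hS] at this
    exact this
  clear hn1 hn2 hS sqs sq0 sq nxt
  have hEn0 : ∀ K, 0 ≤ En b K := fun K => integral_nonneg fun p => sq_nonneg _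
  -- monotone energies
  have hanti : Antitone (fun k => En b (S k) + η / 2 ^ k) := by
    apply antitone_nat_of_succ_le
    intro k
    have h1 := hEstep k
    have h2 := hD0 k
    have h3 : η / 2 ^ k = 2 * (η / 2 ^ (k + 1)) := by rw [pow_succ]; field_simp
    linarith
  have hEk : ∀ k, En b (S k) ≤ Es := fun k => by
    have h1 := hanti (Nat.zero_le k)
    simp only [pow_zero, div_one, hS0] at h1
    have : 0 < η / 2 ^ k := by positivity
    rw [hEs]; linarith
  have hDlim : ∀ ε > 0, ∃ k0, ∀ k ≥ k0, D k ≤ ε := by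
    have hbd : BddBelow (Set.range fun k => En b (S k) + η / 2 ^ k) := ⟨0, by
      rintro _ ⟨k, rfl⟩
      have := hEn0 (S k)
      simp only; positivity⟩
    have h1 := tendsto_atTop_ciInf hanti hbd
    have h2 := h1.sub ((tendsto_add_atTop_iff_nat 1).2 h1)
    rw [sub_self] at h2
    intro ε hε
    obtain ⟨k0, hk0⟩ := eventually_atTop.1 (h2.eventually_le_const hε)
    refine ⟨k0, fun k hk => ?_⟩
    have h4 := hk0 k hk
    have h1 := hEstep k
    have h3 : η / 2 ^ k = 2 * (η / 2 ^ (k + 1)) := by rw [pow_succ]; field_simp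
    linarith
  -- curvature bounds
  obtain ⟨M, hM0, hM⟩ : ∃ M : ℝ, 0 ≤ M ∧ ∀ p, -M ≤ lap (S 0) p := by
    obtain ⟨p, hp⟩ := ((CP_lap (hsp 0)).comp (u := fun x => -x) (by fun_prop)).exists_max hb0
    refine ⟨max 0 (-lap (S 0) p), le_max_left _ _, fun q => ?_⟩
    have h1 := hp q
    have h2 := le_max_right 0 (-lap (S 0) p)
    linarith
  obtain ⟨m, m0, ms⟩ : ∃ m : ℕ → ℝ × ℝ → ℝ, (m 0 = fun _ => M) ∧ ∀ k, m (k + 1) = fun p => 2 / 3 * m k p + 1 / 3 * Real.exp (S k p) ^ 2 :=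
    ⟨mus M S, rfl, fun k => rfl⟩
  have hm : ∀ k, CP a b (m k) ∧ (∀ p, 0 ≤ m k p) ∧ ∀ p, -m k p ≤ lap (S k) p := by
    intro k
    induction k with
    | zero => rw [m0]; exact ⟨⟨continuous_const, fun _ => rfl, fun _ => rfl⟩, fun _ => hM0, hM⟩
    | succ k ih =>
      rw [ms]
      refine ⟨ih.1.comp2 (hsp k).cp (u := fun x y => 2 / 3 * x + 1 / 3 * Real.exp y ^ 2) (by fun_prop), fun p => ?_, hlap k _ ih.2.2⟩
      have := ih.2.1 p
      positivity
  have cS : ∀ k, Continuous (S k) := fun k => (hsp k).cont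
  have cm : ∀ k, Continuous (m k) := fun k => (hm k).1.cont
  obtain ⟨N, hN⟩ : ∃ N : ℕ → ℝ, ∀ k, N k = ∫ p, |m k p - Real.exp (S k p) ^ 2| ∂(muT b) := ⟨_, fun k => rfl⟩
  have iE : ∀ k, Integrable (fun p => Real.exp (S k p) ^ 2) (muT b) := fun k => integrable_muT (by have := cS k; fun_prop) b
  have iN : ∀ k, Integrable (fun p => |m k p - Real.exp (S k p) ^ 2|) (muT b) := fun k =>
    integrable_muT (by have := cS k; have := cm k; fun_prop) b
  have iD : ∀ k, Integrable (fun p => |Real.exp (S k p) ^ 2 - Real.exp (S (k + 1) p) ^ 2|) (muT b) := fun k =>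
    integrable_muT (by have := cS k; have := cS (k + 1); fun_prop) b
  have hNlim : ∀ ε > 0, ∃ k0, ∀ k ≥ k0, N k ≤ ε := by
    apply seq_small (d := fun k => ∫ p, |Real.exp (S k p) ^ 2 - Real.exp (S (k + 1) p) ^ 2| ∂(muT b))
    · intro k; rw [hN]; exact integral_nonneg fun p => abs_nonneg _
    · intro k
      rw [hN, hN]
      rw [← integral_const_mul, ← integral_add ((iN k).const_mul _) (iD k)]
      apply integral_mono (iN (k + 1)) (((iN k).const_mul _).add (iD k))
      intro p
      simp only [ms]
      change _ ≤ 2 / 3 * |m k p - Real.exp (S k p) ^ 2| + |Real.exp (S k p) ^ 2 - Real.exp (S (k + 1) p) ^ 2|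
      have h1 : 2 / 3 * m k p + 1 / 3 * Real.exp (S k p) ^ 2 - Real.exp (S (k + 1) p) ^ 2 =
        2 / 3 * (m k p - Real.exp (S k p) ^ 2) + (Real.exp (S k p) ^ 2 - Real.exp (S (k + 1) p) ^ 2) := by ring
      rw [h1]
      refine (abs_add_le _ _).trans_eq ?_
      rw [abs_mul, abs_of_pos (show (0:ℝ) < 2 / 3 by norm_num)]
    · intro ε hε
      obtain ⟨t, ht⟩ : ∃ t, t = ε / (8 * Real.pi) := ⟨_, rfl⟩
      have ht0 : 0 < t := by rw [ht]; positivity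
      obtain ⟨k0, hk0⟩ := hDlim (ε * t) (by positivity)
      refine ⟨k0, fun k hk => ?_⟩
      have iQ : Integrable (fun p => (Real.exp (S (k + 1) p) - Real.exp (S k p)) ^ 2) (muT b) :=
        integrable_muT (by have := cS k; have := cS (k + 1); fun_prop) b
      have h1 : ∀ p, |Real.exp (S k p) ^ 2 - Real.exp (S (k + 1) p) ^ 2| ≤
          1 / (2 * t) * (Real.exp (S (k + 1) p) - Real.exp (S k p)) ^ 2 + t * (Real.exp (S k p) ^ 2 + Real.exp (S (k + 1) p) ^ 2) := by
        intro p
        generalize Real.exp (S k p) = x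
        generalize Real.exp (S (k + 1) p) = y
        have e : ∀ z w : ℝ, z * w ≤ 1 / (2 * t) * z ^ 2 + t / 2 * w ^ 2 := fun z w => by
          have : 1 / (2 * t) * z ^ 2 + t / 2 * w ^ 2 - z * w = (z - t * w) ^ 2 / (2 * t) := by field_simp; ring
          have : 0 ≤ (z - t * w) ^ 2 / (2 * t) := by positivity
          linarith
        have e1 := e (x - y) (x + y)
        have e2 := e (y - x) (x + y)
        have e3 : t / 2 * (x + y) ^ 2 ≤ t * (x ^ 2 + y ^ 2) := by nlinarith [mul_nonneg ht0.le (sq_nonneg (x - y))]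
        have e4 : (x - y) ^ 2 = (y - x) ^ 2 := by ring
        rw [e4] at e1
        rw [abs_le]
        constructor <;> linarith
      have h2 := integral_mono (iD k) ((iQ.const_mul (1 / (2 * t))).add (((iE k).add (iE (k + 1))).const_mul t)) h1
      have h3 : ∫ p, (1 / (2 * t) * (Real.exp (S (k + 1) p) - Real.exp (S k p)) ^ 2 + t * (Real.exp (S k p) ^ 2 + Real.exp (S (k + 1) p) ^ 2)) ∂(muT b)
          = 1 / (2 * t) * D k + t * (En b (S k) + En b (S (k + 1))) := by
        have i7 : Integrable (fun p => t * (Real.exp (S k p) ^ 2 + Real.exp (S (k + 1) p) ^ 2)) (muT b) :=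
          ((iE k).add (iE (k + 1))).const_mul t
        rw [integral_add (iQ.const_mul (1 / (2 * t))) i7, integral_const_mul, integral_const_mul,
          integral_add (iE k) (iE (k + 1)), hD]; rfl
      have h4 := h2.trans h3.le
      have h5 : 1 / (2 * t) * D k ≤ ε / 2 := by
        have := hk0 k hk
        rw [one_div_mul_eq_div, div_le_iff₀ (by positivity)]; linarith
      have h6 : t * (En b (S k) + En b (S (k + 1))) ≤ t * (4 * Real.pi) :=
        mul_le_mul_of_nonneg_left (by linarith [hEk k, hEk (k + 1)]) ht0.le
      have h7 : t * (4 * Real.pi) = ε / 2 := by rw [ht]; field_simp; norm_num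
      linarith
  -- uniform bounds
  obtain ⟨θ, hθ⟩ : ∃ θ, θ = (Es / (2 * Real.pi) + 1) / 2 := ⟨_, rfl⟩
  have hEs3 : Es / (2 * Real.pi) < 1 := by rw [div_lt_one (by positivity)]; exact hEs2
  have hθ1 : θ < 1 := by rw [hθ]; linarith
  have hθ2 : Es < 2 * Real.pi * θ := by
    have : Es / (2 * Real.pi) < θ := by rw [hθ]; linarith
    rw [div_lt_iff₀ (by positivity)] at this
    linarith
  obtain ⟨k0, hk0⟩ := hNlim (2 * Real.pi * θ - Es) (by linarith)
  obtain ⟨p0, hp0⟩ := (hm k0).1.exists_max hb0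
  obtain ⟨B, hB⟩ : ∃ B, B = max 2 (max (m k0 p0) (Real.exp (Real.log 4 / (1 - θ)))) := ⟨_, rfl⟩
  have hB2 : 2 ≤ B := by rw [hB]; exact le_max_left _ _
  have hBm : m k0 p0 ≤ B := by rw [hB]; exact (le_max_left _ _).trans (le_max_right _ _)
  have hBe : Real.exp (Real.log 4 / (1 - θ)) ≤ B := by rw [hB]; exact (le_max_right _ _).trans (le_max_right _ _)
  have hBθ : Real.log 4 + θ * Real.log B ≤ Real.log B := by
    have : Real.log 4 / (1 - θ) ≤ Real.log B := (Real.le_log_iff_exp_le (by linarith)).2 hBe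
    rw [div_le_iff₀ (by linarith)] at this
    linarith
  have hmB : ∀ j p, m (k0 + j) p ≤ B ^ 2 := by
    intro j
    induction j with
    | zero => intro p; have := hp0 p; rw [add_zero]; nlinarith
    | succ j ih =>
      have hIntg : ∫ q, m (k0 + j) q ∂(muT b) ≤ 2 * Real.pi * θ := by
        have h1 : ∫ q, m (k0 + j) q ∂(muT b) ≤ ∫ q, (Real.exp (S (k0 + j) q) ^ 2 + |m (k0 + j) q - Real.exp (S (k0 + j) q) ^ 2|) ∂(muT b) := by
          apply integral_mono (integrable_muT (cm _) b) ((iE _).add (iN _))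
          intro q
          have := le_abs_self (m (k0 + j) q - Real.exp (S (k0 + j) q) ^ 2)
          change m (k0 + j) q ≤ Real.exp (S (k0 + j) q) ^ 2 + |m (k0 + j) q - Real.exp (S (k0 + j) q) ^ 2|
          linarith
        rw [integral_add (iE _) (iN _), ← hN] at h1
        have h2 := hk0 (k0 + j) (by omega)
        have h3 := hEk (k0 + j)
        unfold En at h3
        linarith
      have hr := rough hb1 (hsp (k0 + j)) (hm (k0 + j)).1 (hm (k0 + j)).2.2 (hm (k0 + j)).2.1 hB2 ih hIntg
        (by have := hEk (k0 + j); unfold En at this; linarith) hBθ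
      intro p
      rw [← add_assoc, ms]
      have h1 := ih p
      have h2 : Real.exp (S (k0 + j) p) ^ 2 ≤ B ^ 2 := by have := hr p; gcongr
      simp only
      linarith
  obtain ⟨k1, hk1⟩ := hNlim (4 * Real.pi * 0.01 ^ 2 / B ^ 2) (by positivity)
  have hN1 := hk1 (k0 + k1) (by omega)
  rw [le_div_iff₀ (by positivity), hN] at hN1
  have hE1 := hEk (k0 + k1)
  have hsh := sharp hb1 (hsp (k0 + k1)) (hm (k0 + k1)).1 (hm (k0 + k1)).2.2 (hm (k0 + k1)).2.1 (hmB k1) (by linarith)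
    (by unfold En at hE1; linarith)
  obtain ⟨ψ₁, ψ₂, hψ⟩ := hSt (k0 + k1)
  obtain ⟨p, hp⟩ := hψ.ne
  have hf : SP a b (fun p => Real.exp (S (k0 + k1) p)) :=
    ⟨(hsp _).smooth.exp, fun p => by simp only [(hsp _).p1], fun p => by simp only [(hsp _).p2]⟩
  have hkb : 2 * Real.pi / b < 1 := by rw [div_lt_one hb0]; exact hb
  have := Real.pi_gt_d2
  refine hp (linear_lemma hb hf (fun p => Real.exp_pos _) (fun p => ?_) hψ.sol ?_ p).1
  · refine (hsh p).trans ?_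
    have := Real.pi_gt_d4
    linarith
  · unfold En at hE1; linarith

end DiracT

/-- Theorem 1.4 (lower bound): for the torus `ℝ²/Γ`, `Γ = ℤ(1,0) + ℤ(a,b)` with `|a| ≤ 1/2`
and `b > 2π`, any positive Dirac eigenvalue `λ` of the conformal metric `e^{2ω} g_{a,b}` for
the trivial spin structure satisfies `λ² · Area ≥ 4π²/b`. -/
theorem dirac_first_eigenvalue_flat_torus_trivial_spin_lower_bound
    (a b lam : ℝ) (ha : |a| ≤ 1 / 2) (hb : b > 2 * Real.pi)
    (ω : ℝ × ℝ → ℝ) (hω : ContDiff ℝ (⊤ : ℕ∞) ω)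
    (hω1 : ∀ p : ℝ × ℝ, ω (p.1 + 1, p.2) = ω p)
    (hω2 : ∀ p : ℝ × ℝ, ω (p.1 + a, p.2 + b) = ω p)
    (hlam : 0 < lam)
    (φ : ℝ × ℝ → ℂ × ℂ) (hφ : ContDiff ℝ (⊤ : ℕ∞) φ) (hφ0 : φ ≠ 0)
    (hφ1 : ∀ p : ℝ × ℝ, φ (p.1 + 1, p.2) = φ p)
    (hφ2 : ∀ p : ℝ × ℝ, φ (p.1 + a, p.2 + b) = φ p)
    (heq1 : ∀ p : ℝ × ℝ,
      dX (fun q => (φ q).2) p - Complex.I * dY (fun q => (φ q).2) p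
        = (lam : ℂ) * Real.exp (ω p) * (φ p).1)
    (heq2 : ∀ p : ℝ × ℝ,
      -(dX (fun q => (φ q).1) p + Complex.I * dY (fun q => (φ q).1) p)
        = (lam : ℂ) * Real.exp (ω p) * (φ p).2) :
    lam ^ 2 * b *
      (∫ t in (0:ℝ)..1, ∫ s in (0:ℝ)..1, Real.exp (2 * ω (s + t * a, t * b)))
      ≥ 4 * Real.pi ^ 2 / b := by
  have hb0 : 0 < b := by have := Real.pi_pos; linarith
  have hel : Real.exp (Real.log lam) = lam := Real.exp_log hlam
  have hL : DiracT.SP a b (fun p => ω p + Real.log lam) :=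
    ⟨hω.add contDiff_const, fun p => by simp only [hω1], fun p => by simp only [hω2]⟩
  have hs : DiracT.Sol a b (fun p => Real.exp (ω p + Real.log lam)) (fun q => (φ q).1) (fun q => (φ q).2) :=
    { s1 := ⟨hφ.fst, fun p => by simp only [hφ1], fun p => by simp only [hφ2]⟩
      s2 := ⟨hφ.snd, fun p => by simp only [hφ1], fun p => by simp only [hφ2]⟩
      e1 := fun p => by rw [heq1, Real.exp_add, hel, Complex.ofReal_mul]; ring
      e2 := fun p => by rw [heq2, Real.exp_add, hel, Complex.ofReal_mul]; ring }
  have hne : ∃ p, (φ p).1 ≠ 0 ∨ (φ p).2 ≠ 0 := by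
    by_contra! h
    exact hφ0 (funext fun p => Prod.ext (h p).1 (h p).2)
  have hc := DiracT.core hb hL hs hne
  refine ge_iff_le.2 (hc.trans_eq ?_)
  have hω' : Continuous ω := hω.continuous
  unfold DiracT.En
  have h1 : ∀ p, Real.exp (ω p + Real.log lam) ^ 2 = lam ^ 2 * Real.exp (2 * ω p) := fun p => by
    rw [Real.exp_add, hel, mul_pow, ← Real.exp_nat_mul]; push_cast; ring
  simp only [h1]
  rw [MeasureTheory.integral_const_mul, DiracT.integral_muT_yx (by fun_prop) hb0.le, mul_assoc]
  congr 1
  have h2 := intervalIntegral.mul_integral_comp_mul_left (a := 0) (b := 1)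
    (f := fun y => ∫ x in (0:ℝ)..1, Real.exp (2 * ω (x, y))) b
  rw [mul_zero, mul_one] at h2
  rw [← h2]
  congr 1
  apply intervalIntegral.integral_congr
  intro t _
  have hper : Function.Periodic (fun x => Real.exp (2 * ω (x, t * b))) 1 := fun x => by
    have := hω1 (x, t * b)
    simp only at this ⊢
    rw [this]
  have h3 := hper.intervalIntegral_add_eq (t * a) 0
  have h4 := intervalIntegral.integral_comp_add_right (a := 0) (b := 1) (fun x => Real.exp (2 * ω (x, t * b))) (t * a)
  simp only
  rw [h4, mul_comm b t, zero_add, add_comm 1 (t * a), h3, zero_add]
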